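/- Suppose B̂₀ > 0 and let ν be a quantum limit for 𝓛_α. Let γ ⊂ 𝕋² be a closed geodesic, i.e. γ = {x₀ + tθ₀ mod ℤ² : t ∈ ℝ} where θ₀ = e^⊥/|e| for some primitive e ∈ ℤ², e^⊥ = (−e₂,e₁). If ν(γ) > 0, then B_∞(x,θ₀) = 0 for every x ∈ γ. -/

import Mathlib

open MeasureTheory Filter Topology
open scoped Real ENNReal

noncomputable section

abbrev Pt : Type := ℝ × ℝ

/-- `v ∧ w = v₁w₂ - v₂w₁`. -/
def wedge (v w : Pt) : ℝ := v.1 * w.2 - v.2 * w.1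

/-- Euclidean dot product on `ℝ²`. -/
def dotp (v w : Pt) : ℝ := v.1 * w.1 + v.2 * w.2

/-- The fundamental domain `[0,1]²` of the torus `𝕋² = ℝ²/ℤ²`. -/
def fund : Set Pt := Set.Icc (0, 0) (1, 1)

/-- `ℤ²`-periodicity of a function on `ℝ²`. -/
def IsPeriodic {E : Type*} (f : Pt → E) : Prop :=
  ∀ (m : ℤ × ℤ) (x : Pt), f (x.1 + m.1, x.2 + m.2) = f x

/-- The magnetic translation `𝒯_m^B` associated to the flux `B0 = B̂₀`. -/
def magTrans (B0 : ℝ) (m : ℤ × ℤ) (u : Pt → ℂ) : Pt → ℂ := fun x =>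
  Complex.exp (Complex.I * (B0 / 2) * (wedge ((m.1 : ℝ), (m.2 : ℝ)) x : ℝ)) *
    u (x.1 - m.1, x.2 - m.2)

/-- First partial derivative of a complex valued function on `ℝ²`. -/
def pd1 (u : Pt → ℂ) : Pt → ℂ := fun x => fderiv ℝ u x (1, 0)

/-- Second partial derivative of a complex valued function on `ℝ²`. -/
def pd2 (u : Pt → ℂ) : Pt → ℂ := fun x => fderiv ℝ u x (0, 1)

/-- First partial derivative of a real valued function on `ℝ²`. -/
def pdR1 (f : Pt → ℝ) : Pt → ℝ := fun x => fderiv ℝ f x (1, 0)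

/-- Second partial derivative of a real valued function on `ℝ²`. -/
def pdR2 (f : Pt → ℝ) : Pt → ℝ := fun x => fderiv ℝ f x (0, 1)

/-- The vector potential `A⁰(x₁,x₂) = (B̂₀/2)(−x₂, x₁)`. -/
def A0 (B0 : ℝ) : Pt → Pt := fun x => (B0 / 2 * (-x.2), B0 / 2 * x.1)

/-- `(-i∂₁ - α₁ - A₁) u`. -/
def Dop1 (α : Pt) (A : Pt → Pt) (u : Pt → ℂ) : Pt → ℂ := fun x =>
  -Complex.I * pd1 u x - ((α.1 + (A x).1 : ℝ) : ℂ) * u x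

/-- `(-i∂₂ - α₂ - A₂) u`. -/
def Dop2 (α : Pt) (A : Pt → Pt) (u : Pt → ℂ) : Pt → ℂ := fun x =>
  -Complex.I * pd2 u x - ((α.2 + (A x).2 : ℝ) : ℂ) * u x

/-- The magnetic Laplacian `𝓛_α u = (−i∂₁−α₁−A₁)²u + (−i∂₂−α₂−A₂)²u`. -/
def magLap (α : Pt) (A : Pt → Pt) (u : Pt → ℂ) : Pt → ℂ := fun x =>
  Dop1 α A (Dop1 α A u) x + Dop2 α A (Dop2 α A u) x

/-- Membership in `C^∞(𝕋²,L)`: smooth and invariant under all magnetic translations. -/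
def MemCL (B0 : ℝ) (u : Pt → ℂ) : Prop :=
  ContDiff ℝ (⊤ : ℕ∞) u ∧ ∀ m : ℤ × ℤ, magTrans B0 m u = u

end

/-- The torus `𝕋² = ℝ²/ℤ²`. -/
abbrev T2 : Type := UnitAddCircle × UnitAddCircle

/-- The canonical projection `ℝ² → 𝕋²`. -/
noncomputable def proj2 (x : Pt) : T2 := ((x.1 : UnitAddCircle), (x.2 : UnitAddCircle))

/-- `ν` is a quantum limit for `𝓛_α`: a probability measure on `𝕋²` which is the weak-⋆
limit of the position densities `|u_n|²dx` of a normalized sequence of `o(h_n^{3/2})`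
quasimodes of `h_n²𝓛_α`. -/
def IsQuantumLimit (B0 : ℝ) (α : Pt) (A : Pt → Pt) (ν : MeasureTheory.Measure T2) : Prop :=
  MeasureTheory.IsProbabilityMeasure ν ∧
  ∃ (h : ℕ → ℝ) (u : ℕ → Pt → ℂ),
    (∀ n, 0 < h n) ∧ Tendsto h atTop (𝓝 0) ∧
    (∀ n, ContDiff ℝ 2 (u n)) ∧ (∀ n (m : ℤ × ℤ), magTrans B0 m (u n) = u n) ∧
    (∀ n, ∫ x in fund, ‖u n x‖ ^ 2 = 1) ∧
    ((fun n => (∫ x in fund,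
        ‖((h n ^ 2 : ℝ) : ℂ) * magLap α A (u n) x - u n x‖ ^ 2) ^ ((1 : ℝ) / 2))
      =o[atTop] fun n => h n ^ ((3 : ℝ) / 2)) ∧
    (∀ f : T2 → ℂ, Continuous f →
      Tendsto (fun n => ∫ x in fund, f (proj2 x) * ((‖u n x‖ ^ 2 : ℝ) : ℂ)) atTop
        (𝓝 (∫ p, f p ∂ν)))

theorem hasFDerivAt_setIntegral_of_isCompact {H X E : Type*} [NormedAddCommGroup H]
    [NormedSpace ℝ H] [ProperSpace H] [TopologicalSpace X] [MeasurableSpace X]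
    [OpensMeasurableSpace X] [SecondCountableTopology X] [T2Space X] {μ : Measure X}
    [IsFiniteMeasureOnCompacts μ] [NormedAddCommGroup E] [NormedSpace ℝ E]
    {F : H → X → E} {F' : H → X → H →L[ℝ] E}
    (hF : Continuous (Function.uncurry F)) (hF' : Continuous (Function.uncurry F'))
    (hd : ∀ h x, HasFDerivAt (fun h => F h x) (F' h x) h) {K : Set X} (hK : IsCompact K) (h : H) :
    HasFDerivAt (fun h => ∫ x in K, F h x ∂μ) (∫ x in K, F' h x ∂μ) h := by
  obtain ⟨C, hC⟩ := ((isCompact_closedBall h 1).prod hK).exists_bound_of_continuousOn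
    hF'.continuousOn
  have hfin : IsFiniteMeasure (μ.restrict K) := ⟨by
    rw [Measure.restrict_apply_univ]; exact hK.measure_lt_top⟩
  have hc : ∀ h, Continuous (F h) := fun h => hF.comp (Continuous.prodMk_right h)
  have hc' : ∀ h, Continuous (F' h) := fun h => hF'.comp (Continuous.prodMk_right h)
  refine hasFDerivAt_integral_of_dominated_of_fderiv_le (bound := fun _ => C)
    (Metric.closedBall_mem_nhds h one_pos) ?_ ?_ ?_ ?_ (integrable_const _) ?_
  · exact Eventually.of_forall fun h => (hc h).aestronglyMeasurable
  · exact (hc h).continuousOn.integrableOn_compact hK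
  · exact (hc' h).aestronglyMeasurable
  · filter_upwards [ae_restrict_mem hK.measurableSet] with x hx y hy
    exact hC (y, x) ⟨hy, hx⟩
  · exact Eventually.of_forall fun x y _ => hd y x

theorem contDiff_setIntegral_of_isCompact {H X : Type} [NormedAddCommGroup H]
    [NormedSpace ℝ H] [ProperSpace H] [NormedAddCommGroup X] [NormedSpace ℝ X] [MeasurableSpace X]
    [OpensMeasurableSpace X] [SecondCountableTopology X] {μ : Measure X}
    [IsLocallyFiniteMeasure μ] {K : Set X} (hK : IsCompact K) (n : ℕ) :
    ∀ {E : Type} [NormedAddCommGroup E] [NormedSpace ℝ E] {F : H → X → E},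
    ContDiff ℝ n (Function.uncurry F) → ContDiff ℝ n (fun h => ∫ x in K, F h x ∂μ) := by
  induction n with
  | zero =>
    intro E _ _ F hF
    simp only [Nat.cast_zero, contDiff_zero] at hF ⊢
    exact continuous_parametric_integral_of_continuous hF hK
  | succ n ih =>
    intro E _ _ F hF
    have hcd : Continuous (fderiv ℝ (Function.uncurry F)) :=
      hF.continuous_fderiv (by simp)
    let F' : H → X → H →L[ℝ] E := fun h x =>
      (fderiv ℝ (Function.uncurry F) (h, x)).comp (ContinuousLinearMap.inl ℝ H X)
    have hF'n : ContDiff ℝ n (Function.uncurry F') := by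
      have h1 : ContDiff ℝ n (fderiv ℝ (Function.uncurry F)) :=
        hF.fderiv_right (by norm_cast)
      exact h1.clm_comp contDiff_const
    have hd : ∀ h x, HasFDerivAt (fun h => F h x) (F' h x) h := by
      intro h x
      have h1 : HasFDerivAt (Function.uncurry F) (fderiv ℝ (Function.uncurry F) (h, x)) (h, x) :=
        (hF.differentiable (by simp) (h, x)).hasFDerivAt
      exact HasFDerivAt.comp (g := Function.uncurry F) (f := fun e => (e, x)) h h1
        (hasFDerivAt_prodMk_left h x)
    have key := fun h => hasFDerivAt_setIntegral_of_isCompact (μ := μ) hF.continuous hF'n.continuous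
      hd hK h
    have h2 : ContDiff ℝ ((n : WithTop ℕ∞) + 1) (fun h => ∫ x in K, F h x ∂μ) := by
      rw [contDiff_succ_iff_hasFDerivAt]
      exact ⟨_, ih hF'n, key⟩
    exact_mod_cast h2

theorem isCompact_fund : IsCompact fund := isCompact_Icc

theorem fund_eq : fund = Set.Icc (0:ℝ) 1 ×ˢ Set.Icc (0:ℝ) 1 := by
  rw [fund, Set.Icc_prod_Icc]

theorem setIntegral_fund_eq {F : Pt → ℂ} (hF : Continuous F) :
    ∫ x in fund, F x = ∫ s in (0:ℝ)..1, ∫ t in (0:ℝ)..1, F (s, t) := by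
  have hi : IntegrableOn F (Set.Icc (0:ℝ) 1 ×ˢ Set.Icc (0:ℝ) 1) (volume.prod volume) := by
    rw [← fund_eq]; exact hF.continuousOn.integrableOn_compact isCompact_fund
  rw [fund_eq, Measure.volume_eq_prod, setIntegral_prod _ hi]
  simp only [intervalIntegral.integral_of_le zero_le_one, integral_Icc_eq_integral_Ioc]

theorem IsPeriodic.setIntegral_add {F : Pt → ℂ} (hF : Continuous F) (hp : IsPeriodic F) (c : Pt) :
    ∫ x in fund, F (x + c) = ∫ x in fund, F x := by
  rw [setIntegral_fund_eq hF, setIntegral_fund_eq (by fun_prop)]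
  have h2 : ∀ s, Function.Periodic (fun t => F (s, t)) 1 := fun s t => by
    simpa using hp (0, 1) (s, t)
  have h1 : Function.Periodic (fun s => ∫ t in (0:ℝ)..1, F (s, t)) 1 := fun s => by
    refine intervalIntegral.integral_congr fun t _ => ?_
    simpa using hp (1, 0) (s, t)
  have e2 : ∀ s, ∫ t in (0:ℝ)..1, F (s, t + c.2) = ∫ t in (0:ℝ)..1, F (s, t) := fun s => by
    rw [intervalIntegral.integral_comp_add_right (fun t => F (s, t))]
    have := (h2 s).intervalIntegral_add_eq c.2 0
    simpa [add_comm] using this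
  have e1 := intervalIntegral.integral_comp_add_right
    (fun s => ∫ t in (0:ℝ)..1, F (s, t)) c.1 (a := 0) (b := 1)
  have e3 := h1.intervalIntegral_add_eq c.1 0
  calc _ = ∫ s in (0:ℝ)..1, ∫ t in (0:ℝ)..1, F (s + c.1, t + c.2) := rfl
    _ = ∫ s in (0:ℝ)..1, ∫ t in (0:ℝ)..1, F (s + c.1, t) := by simp only [e2]
    _ = _ := by rw [e1]; simpa [add_comm] using e3

theorem IsPeriodic.setIntegral_fderiv {F : Pt → ℂ} (hF : ContDiff ℝ 1 F) (hp : IsPeriodic F)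
    (v : Pt) : ∫ x in fund, fderiv ℝ F x v = 0 := by
  have hcd : Continuous (fderiv ℝ F) := hF.continuous_fderiv (by simp)
  have key := hasFDerivAt_setIntegral_of_isCompact (H := ℝ) (X := Pt) (μ := volume)
    (F := fun s x => F (x + s • v))
    (F' := fun s x => (fderiv ℝ F (x + s • v)).comp
      ((ContinuousLinearMap.id ℝ ℝ).smulRight v)) (by have := hF.continuous; fun_prop)
    (by simp only [Function.uncurry_def]; fun_prop) (by
      intro s x
      have h1 := (hF.differentiable (by simp) (x + s • v)).hasFDerivAt
      refine h1.comp s ?_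
      exact ((ContinuousLinearMap.id ℝ ℝ).smulRight v).hasFDerivAt.const_add x)
    isCompact_fund 0
  simp only [hp.setIntegral_add hF.continuous] at key
  have h0 := key.unique (hasFDerivAt_const _ _)
  have h1 := congrArg (fun L : ℝ →L[ℝ] ℂ => L 1) h0
  rw [ContinuousLinearMap.integral_apply] at h1
  · simpa using h1
  · refine ContinuousOn.integrableOn_compact isCompact_fund (Continuous.continuousOn ?_)
    fun_prop

noncomputable section

/-- Integration over the fundamental domain. -/
def fundIntegral : C(Pt, ℂ) →ₗ[ℂ] ℂ where
  toFun := fun X => ∫ x in fund, X x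
  map_add' X Y := integral_add (X.continuous.continuousOn.integrableOn_compact isCompact_fund)
    (Y.continuous.continuousOn.integrableOn_compact isCompact_fund)
  map_smul' c _ := integral_smul c _

/-- The `L²` pairing over the fundamental domain, antilinear in the second variable. -/
def ip (X Y : C(Pt, ℂ)) : ℂ := fundIntegral (X * star Y)

/-- The `L²` norm over the fundamental domain. -/
def nrm (X : C(Pt, ℂ)) : ℝ := Real.sqrt (∫ x in fund, ‖X x‖ ^ 2)

theorem ip_def (X Y : C(Pt, ℂ)) :
    ip X Y = ∫ x in fund, X x * (starRingEnd ℂ) (Y x) := rfl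

theorem ip_add_left (X Y Z : C(Pt, ℂ)) : ip (X + Y) Z = ip X Z + ip Y Z := by
  simp [ip, add_mul]

theorem ip_sub_left (X Y Z : C(Pt, ℂ)) : ip (X - Y) Z = ip X Z - ip Y Z := by
  simp [ip, sub_mul]

theorem ip_smul_left (c : ℂ) (X Y : C(Pt, ℂ)) : ip (c • X) Y = c * ip X Y := by
  simp [ip, smul_mul_assoc]

theorem ip_add_right (X Y Z : C(Pt, ℂ)) : ip X (Y + Z) = ip X Y + ip X Z := by
  simp [ip, mul_add]

theorem ip_sub_right (X Y Z : C(Pt, ℂ)) : ip X (Y - Z) = ip X Y - ip X Z := by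
  simp [ip, mul_sub]

theorem ip_smul_right (c : ℂ) (X Y : C(Pt, ℂ)) :
    ip X (c • Y) = (starRingEnd ℂ) c * ip X Y := by
  simp [ip, mul_smul_comm]

theorem ip_mul_left {k : C(Pt, ℂ)} (hk : star k = k) (X Y : C(Pt, ℂ)) :
    ip (k * X) Y = ip X (k * Y) := by
  simp only [ip, star_mul, hk]
  congr 1; ring

theorem nrm_nonneg (X : C(Pt, ℂ)) : 0 ≤ nrm X := Real.sqrt_nonneg _

theorem nrm_sq (X : C(Pt, ℂ)) : nrm X ^ 2 = ∫ x in fund, ‖X x‖ ^ 2 :=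
  Real.sq_sqrt (integral_nonneg fun _ => by positivity)

theorem ip_self (X : C(Pt, ℂ)) : ip X X = ((nrm X ^ 2 : ℝ) : ℂ) := by
  rw [nrm_sq, ip_def, ← integral_complex_ofReal]
  congr 1; ext x
  rw [Complex.mul_conj, Complex.normSq_eq_norm_sq]

theorem norm_ip_le (X Y : C(Pt, ℂ)) : ‖ip X Y‖ ≤ nrm X * nrm Y := by
  have hfin : IsFiniteMeasure ((volume : Measure Pt).restrict fund) := ⟨by
    rw [Measure.restrict_apply_univ]; exact isCompact_fund.measure_lt_top⟩
  have hm : ∀ Z : C(Pt, ℂ), MemLp (fun x => ‖Z x‖) (ENNReal.ofReal 2)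
      ((volume : Measure Pt).restrict fund) := fun Z => by
    obtain ⟨C, hC⟩ := isCompact_fund.exists_bound_of_continuousOn Z.continuous.continuousOn
    refine MemLp.of_bound (by have := Z.continuous; fun_prop) C ?_
    filter_upwards [ae_restrict_mem isCompact_fund.measurableSet] with x hx
    simpa using hC x hx
  have h1 : ‖ip X Y‖ ≤ ∫ x in fund, ‖X x‖ * ‖Y x‖ := by
    rw [ip_def]
    refine (norm_integral_le_integral_norm _).trans (le_of_eq ?_)
    congr 1; ext x; simp
  refine h1.trans ?_
  have h2 := integral_mul_le_Lp_mul_Lq_of_nonneg (μ := (volume : Measure Pt).restrict fund)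
    (Real.HolderConjugate.two_two) (f := fun x => ‖X x‖) (g := fun x => ‖Y x‖)
    (Eventually.of_forall fun _ => norm_nonneg _) (Eventually.of_forall fun _ => norm_nonneg _)
    (hm X) (hm Y)
  simpa [nrm, Real.sqrt_eq_rpow] using h2

theorem nrm_mul_le {k : C(Pt, ℂ)} {K : ℝ} (hk : ∀ x, ‖k x‖ ≤ K) (X : C(Pt, ℂ)) :
    nrm (k * X) ≤ K * nrm X := by
  have hK : 0 ≤ K := (norm_nonneg _).trans (hk 0)
  rw [nrm, nrm, Real.sqrt_le_iff]
  refine ⟨by positivity, ?_⟩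
  rw [mul_pow, Real.sq_sqrt (integral_nonneg fun _ => by positivity), ← integral_const_mul]
  refine integral_mono ?_ ?_ fun x => ?_
  · exact (by fun_prop : Continuous fun x => ‖(k * X) x‖ ^ 2).continuousOn.integrableOn_compact
      isCompact_fund
  · exact (by fun_prop : Continuous fun x => K ^ 2 * ‖X x‖ ^ 2).continuousOn.integrableOn_compact
      isCompact_fund
  · simp only [ContinuousMap.mul_apply, norm_mul, mul_pow]
    gcongr
    exact hk x

theorem norm_ip_mul_le {k : C(Pt, ℂ)} {K M N : ℝ} (hk : ∀ x, ‖k x‖ ≤ K) {X Y : C(Pt, ℂ)}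
    (hX : nrm X ≤ M) (hY : nrm Y ≤ N) : ‖ip (k * X) Y‖ ≤ K * (M * N) := by
  have hK : 0 ≤ K := (norm_nonneg _).trans (hk 0)
  have := nrm_nonneg X
  have := nrm_nonneg Y
  calc ‖ip (k * X) Y‖ ≤ nrm (k * X) * nrm Y := norm_ip_le _ _
    _ ≤ (K * nrm X) * nrm Y := by gcongr; exact nrm_mul_le hk X
    _ = K * (nrm X * nrm Y) := by ring
    _ ≤ K * (M * N) := by gcongr; linarith

theorem IsPeriodic.exists_norm_le {k : C(Pt, ℂ)} (hk : IsPeriodic k) :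
    ∃ K, ∀ x, ‖k x‖ ≤ K := by
  obtain ⟨C, hC⟩ := isCompact_fund.exists_bound_of_continuousOn k.continuous.continuousOn
  refine ⟨C, fun x => ?_⟩
  have h := hk (⌊x.1⌋, ⌊x.2⌋) (Int.fract x.1, Int.fract x.2)
  simp only [Int.fract_add_floor] at h
  rw [show x = (x.1, x.2) from rfl, h]
  exact hC _ ⟨⟨Int.fract_nonneg _, Int.fract_nonneg _⟩,
    ⟨(Int.fract_lt_one _).le, (Int.fract_lt_one _).le⟩⟩

open Classical in
/-- Directional derivative as a continuous map (zero if it is not continuous). -/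
def pdc (v : Pt) (X : C(Pt, ℂ)) : C(Pt, ℂ) :=
  if h : Continuous fun x => fderiv ℝ X x v then ⟨_, h⟩ else 0

theorem pdc_apply {X : C(Pt, ℂ)} (hX : ContDiff ℝ 1 X) (v x : Pt) :
    pdc v X x = fderiv ℝ X x v := by
  have hc : Continuous fun x => fderiv ℝ X x v :=
    (hX.continuous_fderiv (by simp)).clm_apply continuous_const
  rw [pdc, dif_pos hc]; rfl

theorem coe_pdc {X : C(Pt, ℂ)} (hX : ContDiff ℝ 1 X) (v : Pt) :
    ⇑(pdc v X) = fun x => fderiv ℝ X x v := funext (pdc_apply hX v)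

theorem contDiff_pdc {X : C(Pt, ℂ)} (v : Pt) (hX : ContDiff ℝ 2 X) :
    ContDiff ℝ 1 (pdc v X) := by
  rw [coe_pdc (hX.of_le (by norm_num))]
  exact (hX.fderiv_right (by norm_num)).clm_apply contDiff_const

theorem pdc_mul {X Y : C(Pt, ℂ)} (hX : ContDiff ℝ 1 X) (hY : ContDiff ℝ 1 Y) (v : Pt) :
    pdc v (X * Y) = pdc v X * Y + X * pdc v Y := by
  ext x
  have hXY : ContDiff ℝ 1 ⇑(X * Y) := hX.mul hY
  rw [pdc_apply hXY, ContinuousMap.coe_mul, fderiv_mul (hX.differentiable (by simp) x)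
    (hY.differentiable (by simp) x)]
  simp [pdc_apply hX, pdc_apply hY]
  ring

theorem pdc_add {X Y : C(Pt, ℂ)} (hX : ContDiff ℝ 1 X) (hY : ContDiff ℝ 1 Y) (v : Pt) :
    pdc v (X + Y) = pdc v X + pdc v Y := by
  ext x
  have hXY : ContDiff ℝ 1 ⇑(X + Y) := hX.add hY
  rw [pdc_apply hXY, ContinuousMap.coe_add, fderiv_add (hX.differentiable (by simp) x)
    (hY.differentiable (by simp) x)]
  simp [pdc_apply hX, pdc_apply hY]

theorem pdc_smul {X : C(Pt, ℂ)} (hX : ContDiff ℝ 1 X) (c : ℂ) (v : Pt) :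
    pdc v (c • X) = c • pdc v X := by
  ext x
  have hXY : ContDiff ℝ 1 ⇑(c • X) := hX.const_smul c
  rw [pdc_apply hXY, ContinuousMap.coe_smul, fderiv_const_smul (hX.differentiable (by simp) x)]
  simp [pdc_apply hX]

theorem contDiff_star {X : C(Pt, ℂ)} {n : WithTop ℕ∞} (hX : ContDiff ℝ n X) :
    ContDiff ℝ n ⇑(star X) :=
  Complex.conjCLE.contDiff.comp hX

theorem pdc_star {X : C(Pt, ℂ)} (hX : ContDiff ℝ 1 X) (v : Pt) :
    pdc v (star X) = star (pdc v X) := by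
  ext x
  rw [pdc_apply (contDiff_star hX), show ⇑(star X) = Complex.conjCLE ∘ X from rfl,
    fderiv_comp _ (Complex.conjCLE.differentiable _) (hX.differentiable (by simp) x),
    ContinuousLinearEquiv.fderiv]
  simp [pdc_apply hX]

theorem pdc_comm {X : C(Pt, ℂ)} (hX : ContDiff ℝ 2 X) (v w : Pt) :
    pdc v (pdc w X) = pdc w (pdc v X) := by
  have h1 : ContDiff ℝ 1 X := hX.of_le (by norm_num)
  have hd : Differentiable ℝ (fderiv ℝ X) := (hX.fderiv_right (m := 1) (by norm_num)).differentiable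
    (by simp)
  have hs : ∀ v w x, pdc v (pdc w X) x = fderiv ℝ (fderiv ℝ X) x v w := fun v w x => by
    rw [pdc_apply (contDiff_pdc w hX), coe_pdc h1, fderiv_clm_apply (hd x) (by fun_prop)]
    simp
  ext x
  rw [hs, hs]
  exact (hX.contDiffAt.isSymmSndFDerivAt (by simp)) v w

theorem fundIntegral_pdc {X : C(Pt, ℂ)} (hX : ContDiff ℝ 1 X) (hp : IsPeriodic X) (v : Pt) :
    fundIntegral (pdc v X) = 0 := by
  change ∫ x in fund, pdc v X x = 0
  simp only [pdc_apply hX]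
  exact hp.setIntegral_fderiv hX v

/-- Translation by `ℓ • s`. -/
def shift (s : Pt) (ℓ : ℝ) (X : C(Pt, ℂ)) : C(Pt, ℂ) :=
  ⟨fun x => X (x - ℓ • s), by fun_prop⟩

theorem shift_apply (s : Pt) (ℓ : ℝ) (X : C(Pt, ℂ)) (x : Pt) :
    shift s ℓ X x = X (x - ℓ • s) := rfl

theorem contDiff_shift {X : C(Pt, ℂ)} {n : WithTop ℕ∞} (hX : ContDiff ℝ n X) (s : Pt) (ℓ : ℝ) :
    ContDiff ℝ n (shift s ℓ X) :=
  hX.comp (contDiff_id.sub contDiff_const)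

theorem pdc_shift {X : C(Pt, ℂ)} (hX : ContDiff ℝ 1 X) (v s : Pt) (ℓ : ℝ) :
    pdc v (shift s ℓ X) = shift s ℓ (pdc v X) := by
  ext x
  rw [pdc_apply (contDiff_shift hX s ℓ), shift_apply, pdc_apply hX]
  change fderiv ℝ (fun x => X (x - ℓ • s)) x v = _
  rw [fderiv_comp_sub]

theorem hasDerivAt_ip_shift {X : C(Pt, ℂ)} (hX : ContDiff ℝ 1 X) (k Y : C(Pt, ℂ)) (s : Pt)
    (ℓ : ℝ) : HasDerivAt (fun ℓ => ip (k * shift s ℓ X) Y)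
      (-ip (k * shift s ℓ (pdc s X)) Y) ℓ := by
  have hcd : Continuous (fderiv ℝ X) := hX.continuous_fderiv (by simp)
  have key := hasFDerivAt_setIntegral_of_isCompact (H := ℝ) (X := Pt) (μ := volume)
    (F := fun ℓ x => (k x * (starRingEnd ℂ) (Y x)) * X (x - ℓ • s))
    (F' := fun ℓ x => (k x * (starRingEnd ℂ) (Y x)) • ((fderiv ℝ X (x - ℓ • s)).comp
      (-(ContinuousLinearMap.id ℝ ℝ).smulRight s))) (by
        simp only [Function.uncurry_def]; fun_prop)
    (by simp only [Function.uncurry_def]; fun_prop) (by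
      intro ℓ x
      have h1 := (hX.differentiable (by simp) (x - ℓ • s)).hasFDerivAt
      refine HasFDerivAt.const_mul (HasFDerivAt.comp (g := X) ℓ h1 ?_) _
      exact ((ContinuousLinearMap.id ℝ ℝ).smulRight s).hasFDerivAt.const_sub x)
    isCompact_fund ℓ
  have h2 := key.hasDerivAt
  rw [ContinuousLinearMap.integral_apply] at h2
  · refine (h2.congr_deriv ?_).congr_of_eventuallyEq (Eventually.of_forall fun ℓ => ?_)
    · rw [ip_def, ← integral_neg]
      congr 1; ext x
      simp [shift_apply, pdc_apply hX]; ring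
    · change ip (k * shift s ℓ X) Y = _
      rw [ip_def]
      congr 1; ext x
      simp only [ContinuousMap.mul_apply, shift_apply]; ring
  · refine ContinuousOn.integrableOn_compact isCompact_fund (Continuous.continuousOn ?_)
    fun_prop

end

noncomputable section

/-- Translation by an integer vector: `itrans m X x = X (x + m)`. -/
def itrans (m : ℤ × ℤ) (X : C(Pt, ℂ)) : C(Pt, ℂ) := shift ((m.1 : ℝ), (m.2 : ℝ)) (-1) X

theorem itrans_apply (m : ℤ × ℤ) (X : C(Pt, ℂ)) (x : Pt) :
    itrans m X x = X (x.1 + m.1, x.2 + m.2) := by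
  rw [itrans, shift_apply]
  congr 1
  ext <;> simp

theorem isPeriodic_iff_itrans {X : C(Pt, ℂ)} : IsPeriodic X ↔ ∀ m, itrans m X = X := by
  simp only [IsPeriodic, ContinuousMap.ext_iff, itrans_apply]

theorem itrans_mul (m : ℤ × ℤ) (X Y : C(Pt, ℂ)) : itrans m (X * Y) = itrans m X * itrans m Y := rfl
theorem itrans_add (m : ℤ × ℤ) (X Y : C(Pt, ℂ)) : itrans m (X + Y) = itrans m X + itrans m Y := rfl
theorem itrans_sub (m : ℤ × ℤ) (X Y : C(Pt, ℂ)) : itrans m (X - Y) = itrans m X - itrans m Y := rfl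
theorem itrans_smul (m : ℤ × ℤ) (c : ℂ) (X : C(Pt, ℂ)) : itrans m (c • X) = c • itrans m X := rfl
theorem itrans_star (m : ℤ × ℤ) (X : C(Pt, ℂ)) : itrans m (star X) = star (itrans m X) := rfl

theorem itrans_shift (m : ℤ × ℤ) (s : Pt) (ℓ : ℝ) (X : C(Pt, ℂ)) :
    itrans m (shift s ℓ X) = shift s ℓ (itrans m X) := by
  ext x
  simp only [itrans, shift_apply]
  congr 1; abel

theorem pdc_itrans {X : C(Pt, ℂ)} (hX : ContDiff ℝ 1 X) (v : Pt) (m : ℤ × ℤ) :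
    pdc v (itrans m X) = itrans m (pdc v X) := pdc_shift hX _ _ _

theorem contDiff_itrans {X : C(Pt, ℂ)} {n : WithTop ℕ∞} (hX : ContDiff ℝ n X) (m : ℤ × ℤ) :
    ContDiff ℝ n (itrans m X) := contDiff_shift hX _ _

theorem shift_mul (s : Pt) (ℓ : ℝ) (X Y : C(Pt, ℂ)) :
    shift s ℓ (X * Y) = shift s ℓ X * shift s ℓ Y := rfl
theorem shift_add (s : Pt) (ℓ : ℝ) (X Y : C(Pt, ℂ)) :
    shift s ℓ (X + Y) = shift s ℓ X + shift s ℓ Y := rfl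
theorem shift_sub (s : Pt) (ℓ : ℝ) (X Y : C(Pt, ℂ)) :
    shift s ℓ (X - Y) = shift s ℓ X - shift s ℓ Y := rfl
theorem shift_smul (s : Pt) (ℓ : ℝ) (c : ℂ) (X : C(Pt, ℂ)) :
    shift s ℓ (c • X) = c • shift s ℓ X := rfl

theorem hasDerivAt_shift {X : C(Pt, ℂ)} (hX : ContDiff ℝ 1 X) (s x : Pt) (r : ℝ) :
    HasDerivAt (fun r : ℝ => shift s r X x) (-shift s r (pdc s X) x) r := by
  have h1 := (hX.differentiable (by simp) (x - r • s)).hasFDerivAt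
  have h2 : HasDerivAt (fun r : ℝ => x - r • s) (-((1:ℝ) • s)) r :=
    ((hasDerivAt_id r).smul_const s).const_sub x
  have := h1.comp_hasDerivAt r h2
  simpa [shift_apply, pdc_apply hX, Function.comp_def] using this

theorem shift_zero (s : Pt) (X : C(Pt, ℂ)) : shift s 0 X = X := by
  ext x; simp [shift_apply]

theorem norm_sub_shift_le {X : C(Pt, ℂ)} (hX : ContDiff ℝ 1 X) {s : Pt} {K : ℝ}
    (hK : ∀ x, ‖pdc s X x‖ ≤ K) {ℓ : ℝ} (hℓ : 0 ≤ ℓ) (x : Pt) :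
    ‖(X - shift s ℓ X) x‖ ≤ K * ℓ := by
  have := (convex_Icc (0:ℝ) ℓ).norm_image_sub_le_of_norm_hasDerivWithin_le (C := K)
    (fun r _ => (hasDerivAt_shift hX s x r).hasDerivWithinAt)
    (fun r _ => by rw [norm_neg]; exact hK _) (Set.left_mem_Icc.2 hℓ) (Set.right_mem_Icc.2 hℓ)
  rw [shift_zero, norm_sub_rev] at this
  simpa [abs_of_nonneg hℓ] using this

theorem norm_sub_shift_sub_le {X : C(Pt, ℂ)} (hX : ContDiff ℝ 2 X) {s : Pt} {K : ℝ}
    (hK : ∀ x, ‖pdc s (pdc s X) x‖ ≤ K) {ℓ : ℝ} (hℓ : 0 ≤ ℓ) (x : Pt) :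
    ‖(X - shift s ℓ X - (ℓ : ℂ) • pdc s X) x‖ ≤ K * ℓ ^ 2 := by
  have hK0 : 0 ≤ K := (norm_nonneg _).trans (hK 0)
  have hX1 : ContDiff ℝ 1 X := hX.of_le (by norm_num)
  have hd : ∀ r : ℝ, HasDerivAt (fun r : ℝ => shift s r X x + (r : ℂ) * pdc s X x)
      (-shift s r (pdc s X) x + pdc s X x) r := fun r => by
    simpa [Pi.add_def] using (hasDerivAt_shift hX1 s x r).add
      ((Complex.ofRealCLM.hasDerivAt (x := r)).mul_const (pdc s X x))
  have := (convex_Icc (0:ℝ) ℓ).norm_image_sub_le_of_norm_hasDerivWithin_le (C := K * ℓ)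
    (fun r _ => (hd r).hasDerivWithinAt)
    (fun r hr => by
      have := norm_sub_shift_le (contDiff_pdc s hX) hK hr.1 x
      rw [neg_add_eq_sub]
      exact this.trans (by gcongr; exact hr.2)) (Set.left_mem_Icc.2 hℓ) (Set.right_mem_Icc.2 hℓ)
  rw [norm_sub_rev] at this
  simp only [shift_zero, sub_zero, Real.norm_eq_abs, abs_of_nonneg hℓ] at this
  refine le_trans (le_of_eq ?_) (this.trans (by rw [pow_two, mul_assoc]))
  congr 1
  simp
  ring

theorem pdc_zero (v : Pt) : pdc v 0 = 0 := by
  ext x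
  rw [pdc_apply (by exact contDiff_const)]
  change fderiv ℝ (fun _ => (0:ℂ)) x v = 0
  simp

theorem pdc_sub {X Y : C(Pt, ℂ)} (hX : ContDiff ℝ 1 X) (hY : ContDiff ℝ 1 Y) (v : Pt) :
    pdc v (X - Y) = pdc v X - pdc v Y := by
  ext x
  have hXY : ContDiff ℝ 1 ⇑(X - Y) := hX.sub hY
  rw [pdc_apply hXY, ContinuousMap.coe_sub, fderiv_sub (hX.differentiable (by simp) x)
    (hY.differentiable (by simp) x)]
  simp [pdc_apply hX, pdc_apply hY]

theorem IsPeriodic.dir {X : C(Pt, ℂ)} (hX : ContDiff ℝ 1 X) (hp : IsPeriodic X) (v : Pt) :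
    IsPeriodic (pdc v X) := by
  rw [isPeriodic_iff_itrans] at hp ⊢
  intro m
  rw [← pdc_itrans hX, hp]

theorem IsPeriodic.mul {X Y : C(Pt, ℂ)} (hX : IsPeriodic X) (hY : IsPeriodic Y) :
    IsPeriodic ⇑(X * Y) := fun m x => by
  simp only [ContinuousMap.mul_apply, hX m x, hY m x]

/-- Real valued `ℤ²`-periodic functions of class `C^n`. -/
structure Coef (n : WithTop ℕ∞) (a : C(Pt, ℂ)) : Prop where
  contDiff : ContDiff ℝ n a
  per : IsPeriodic a
  real : star a = a

theorem Coef.of_le {n m : WithTop ℕ∞} {a : C(Pt, ℂ)} (ha : Coef n a) (h : m ≤ n) : Coef m a :=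
  ⟨ha.contDiff.of_le h, ha.per, ha.real⟩

theorem Coef.mul {n : WithTop ℕ∞} {a b : C(Pt, ℂ)} (ha : Coef n a) (hb : Coef n b) :
    Coef n (a * b) :=
  ⟨ha.contDiff.mul hb.contDiff, ha.per.mul hb.per, by rw [star_mul, ha.real, hb.real, mul_comm]⟩

theorem Coef.sub {n : WithTop ℕ∞} {a b : C(Pt, ℂ)} (ha : Coef n a) (hb : Coef n b) :
    Coef n (a - b) :=
  ⟨ha.contDiff.sub hb.contDiff, fun m x => by
    simp only [ContinuousMap.sub_apply, ha.per m x, hb.per m x],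
    by rw [star_sub, ha.real, hb.real]⟩

theorem Coef.dir {a : C(Pt, ℂ)} (ha : Coef 2 a) (v : Pt) : Coef 1 (pdc v a) :=
  have h1 : ContDiff ℝ 1 a := ha.contDiff.of_le (by norm_num)
  ⟨contDiff_pdc v ha.contDiff, ha.per.dir h1 v, by rw [← pdc_star h1, ha.real]⟩

/-- A gauge in which the magnetic field is carried by the component of the potential along `t`,
together with the multipliers describing the covariance under integer translations. -/
structure MagFrame where
  s : Pt
  t : Pt
  p : C(Pt, ℂ)
  contDiff_p : ContDiff ℝ 2 p
  real_p : star p = p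
  χ : ℤ × ℤ → C(Pt, ℂ)
  contDiff_χ : ∀ m, ContDiff ℝ 1 (χ m)
  χ_mul_star : ∀ m, χ m * star (χ m) = 1
  pdc_s_χ : ∀ m, pdc s (χ m) = 0
  pdc_t_χ : ∀ m, pdc t (χ m) = Complex.I • ((itrans m p - p) * χ m)
  per_field : IsPeriodic (pdc s p)

namespace MagFrame

variable (M : MagFrame)

/-- The magnetic field. -/
def field : C(Pt, ℂ) := pdc M.s M.p

/-- Semiclassical covariant derivative along `s`. -/
def D (h : ℝ) (X : C(Pt, ℂ)) : C(Pt, ℂ) := (-(Complex.I * h)) • pdc M.s X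

/-- Semiclassical covariant derivative along `t`. -/
def V (h : ℝ) (X : C(Pt, ℂ)) : C(Pt, ℂ) :=
  (-(Complex.I * h)) • pdc M.t X - (h : ℂ) • (M.p * X)

/-- The defect of commutation between `V` and translation along `s`. -/
def β (h ℓ : ℝ) : C(Pt, ℂ) := (h : ℂ) • (M.p - shift M.s ℓ M.p)

/-- Covariance under integer translations. -/
def Cov (X : C(Pt, ℂ)) : Prop := ∀ m, itrans m X = M.χ m * X

theorem coef_field : Coef 1 M.field :=
  ⟨contDiff_pdc _ M.contDiff_p, M.per_field, by
    rw [field, ← pdc_star (M.contDiff_p.of_le (by norm_num)), M.real_p]⟩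

variable {M}

theorem shift_χ (m : ℤ × ℤ) (ℓ : ℝ) : shift M.s ℓ (M.χ m) = M.χ m := by
  ext x
  have hd := hasDerivAt_shift (M.contDiff_χ m) M.s x
  simp only [M.pdc_s_χ, shift_apply, ContinuousMap.zero_apply, neg_zero] at hd
  have := is_const_of_deriv_eq_zero (fun r => (hd r).differentiableAt) (fun r => (hd r).deriv) ℓ 0
  simpa [shift_apply] using this

theorem per_sub_shift (ℓ : ℝ) : IsPeriodic ⇑(M.p - shift M.s ℓ M.p) := by
  rw [isPeriodic_iff_itrans]
  intro m
  have hp1 : ContDiff ℝ 1 M.p := M.contDiff_p.of_le (by norm_num)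
  set c := itrans m M.p - M.p with hc
  have hcd : ContDiff ℝ 1 c := (contDiff_itrans hp1 m).sub hp1
  have hcs : pdc M.s c = 0 := by
    rw [hc, pdc_sub (contDiff_itrans hp1 m) hp1, pdc_itrans hp1,
      isPeriodic_iff_itrans.1 M.per_field, sub_self]
  have hS : shift M.s ℓ c = c := by
    ext x
    have hd := hasDerivAt_shift hcd M.s x
    simp only [hcs, shift_apply, ContinuousMap.zero_apply, neg_zero] at hd
    have := is_const_of_deriv_eq_zero (fun r => (hd r).differentiableAt)
      (fun r => (hd r).deriv) ℓ 0
    simpa [shift_apply] using this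
  rw [hc, shift_sub] at hS
  rw [itrans_sub, itrans_shift]
  linear_combination -hS

namespace Cov

variable {X Y : C(Pt, ℂ)}

theorem mul_star (hX : M.Cov X) (hY : M.Cov Y) : IsPeriodic ⇑(X * star Y) := by
  rw [isPeriodic_iff_itrans]
  intro m
  rw [itrans_mul, itrans_star, hX m, hY m, star_mul]
  linear_combination (X * star Y) * M.χ_mul_star m

theorem mul_left {a : C(Pt, ℂ)} (ha : IsPeriodic a) (hX : M.Cov X) : M.Cov (a * X) := fun m => by
  rw [itrans_mul, isPeriodic_iff_itrans.1 ha, hX m]; ring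

theorem add (hX : M.Cov X) (hY : M.Cov Y) : M.Cov (X + Y) := fun m => by
  rw [itrans_add, hX m, hY m]; ring

theorem sub (hX : M.Cov X) (hY : M.Cov Y) : M.Cov (X - Y) := fun m => by
  rw [itrans_sub, hX m, hY m]; ring

theorem smul (c : ℂ) (hX : M.Cov X) : M.Cov (c • X) := fun m => by
  rw [itrans_smul, hX m, mul_smul_comm]

theorem comp_shift (hX : M.Cov X) (ℓ : ℝ) : M.Cov (shift M.s ℓ X) := fun m => by
  rw [itrans_shift, hX m, shift_mul, shift_χ]

theorem D (hX : M.Cov X) (hX1 : ContDiff ℝ 1 X) (h : ℝ) : M.Cov (M.D h X) := by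
  refine smul _ fun m => ?_
  rw [← pdc_itrans hX1, hX m, pdc_mul (M.contDiff_χ m) hX1, M.pdc_s_χ]; ring

theorem V (hX : M.Cov X) (hX1 : ContDiff ℝ 1 X) (h : ℝ) : M.Cov (M.V h X) := fun m => by
  rw [MagFrame.V, itrans_sub, itrans_smul, itrans_smul, itrans_mul, ← pdc_itrans hX1, hX m,
    pdc_mul (M.contDiff_χ m) hX1, M.pdc_t_χ]
  ext x
  simp
  linear_combination (-(h:ℂ) * (itrans m M.p x - M.p x) * M.χ m x * X x) * Complex.I_sq

theorem nrm_shift (hX : M.Cov X) (ℓ : ℝ) : nrm (shift M.s ℓ X) = nrm X := by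
  have h1 : ip (shift M.s ℓ X) (shift M.s ℓ X) = ip X X := by
    have := (hX.mul_star hX).setIntegral_add (X * star X).continuous (-(ℓ • M.s))
    simp only [← sub_eq_add_neg] at this
    exact this
  rw [ip_self, ip_self, Complex.ofReal_inj] at h1
  exact (pow_left_inj₀ (nrm_nonneg _) (nrm_nonneg _) two_ne_zero).1 h1

end Cov

theorem contDiff_D {X : C(Pt, ℂ)} (hX : ContDiff ℝ 2 X) (h : ℝ) : ContDiff ℝ 1 (M.D h X) :=
  (contDiff_pdc _ hX).const_smul (-(Complex.I * h))

theorem contDiff_V {X : C(Pt, ℂ)} (hX : ContDiff ℝ 2 X) (h : ℝ) : ContDiff ℝ 1 (M.V h X) :=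
  ((contDiff_pdc _ hX).const_smul (-(Complex.I * h))).sub
    (((M.contDiff_p.of_le (by norm_num)).mul (hX.of_le (by norm_num))).const_smul (h : ℂ))

theorem ip_mul_D {a X Y : C(Pt, ℂ)} (ha : Coef 1 a) (hX : M.Cov X) (hY : M.Cov Y)
    (hX1 : ContDiff ℝ 1 X) (hY1 : ContDiff ℝ 1 Y) (h : ℝ) :
    ip (a * M.D h X) Y = ip (a * X) (M.D h Y) + Complex.I * h * ip (pdc M.s a * X) Y := by
  have hXY : ContDiff ℝ 1 ⇑(X * star Y) := hX1.mul (contDiff_star hY1)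
  have h0 := fundIntegral_pdc (X := a * (X * star Y)) (ha.contDiff.mul hXY)
    (ha.per.mul (hX.mul_star hY)) M.s
  rw [pdc_mul ha.contDiff hXY, pdc_mul hX1 (contDiff_star hY1), pdc_star hY1] at h0
  rw [D, D, mul_smul_comm, ip_smul_left, ip_smul_right]
  simp only [ip, map_neg, map_mul, Complex.conj_I, Complex.conj_ofReal]
  have e : pdc M.s a * (X * star Y) + a * (pdc M.s X * star Y + X * star (pdc M.s Y))
      = pdc M.s a * X * star Y + a * pdc M.s X * star Y + a * X * star (pdc M.s Y) := by ring
  rw [e, map_add, map_add] at h0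
  linear_combination (-(Complex.I * h)) * h0

theorem ip_mul_V {a X Y : C(Pt, ℂ)} (ha : Coef 1 a) (hX : M.Cov X) (hY : M.Cov Y)
    (hX1 : ContDiff ℝ 1 X) (hY1 : ContDiff ℝ 1 Y) (h : ℝ) :
    ip (a * M.V h X) Y = ip (a * X) (M.V h Y) + Complex.I * h * ip (pdc M.t a * X) Y := by
  have hXY : ContDiff ℝ 1 ⇑(X * star Y) := hX1.mul (contDiff_star hY1)
  have h0 := fundIntegral_pdc (X := a * (X * star Y)) (ha.contDiff.mul hXY)
    (ha.per.mul (hX.mul_star hY)) M.t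
  rw [pdc_mul ha.contDiff hXY, pdc_mul hX1 (contDiff_star hY1), pdc_star hY1] at h0
  have hp := ip_mul_left M.real_p (a * X) Y
  rw [V, V, mul_sub, ip_sub_left, ip_sub_right, mul_smul_comm, mul_smul_comm, ip_smul_left,
    ip_smul_left, ip_smul_right, ip_smul_right, ← hp, show a * (M.p * X) = M.p * (a * X) by ring]
  simp only [ip, map_neg, map_mul, Complex.conj_I, Complex.conj_ofReal]
  have e : pdc M.t a * (X * star Y) + a * (pdc M.t X * star Y + X * star (pdc M.t Y))
      = pdc M.t a * X * star Y + a * pdc M.t X * star Y + a * X * star (pdc M.t Y) := by ring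
  rw [e, map_add, map_add] at h0
  linear_combination (-(Complex.I * h)) * h0

theorem D_V {X : C(Pt, ℂ)} (hX : ContDiff ℝ 2 X) (h : ℝ) :
    M.D h (M.V h X) = M.V h (M.D h X) + (Complex.I * h ^ 2) • (M.field * X) := by
  have hX1 : ContDiff ℝ 1 X := hX.of_le (by norm_num)
  have hp1 : ContDiff ℝ 1 M.p := M.contDiff_p.of_le (by norm_num)
  have hpX : ContDiff ℝ 1 ⇑(M.p * X) := hp1.mul hX1
  rw [D, V, pdc_sub ((contDiff_pdc M.t hX).const_smul (-(Complex.I * h)))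
    (hpX.const_smul (h : ℂ)), pdc_smul (contDiff_pdc M.t hX), pdc_smul hpX, pdc_mul hp1 hX1,
    V, D, pdc_smul (contDiff_pdc M.s hX), pdc_comm hX, field]
  ext x
  simp
  ring

theorem V_shift {X : C(Pt, ℂ)} (hX : ContDiff ℝ 1 X) (h ℓ : ℝ) :
    M.V h (shift M.s ℓ X) = shift M.s ℓ (M.V h X) - M.β h ℓ * shift M.s ℓ X := by
  rw [V, V, pdc_shift hX, shift_sub, shift_smul, shift_smul, shift_mul, β]
  ext x
  simp
  ring

theorem D_shift {X : C(Pt, ℂ)} (hX : ContDiff ℝ 1 X) (h ℓ : ℝ) :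
    M.D h (shift M.s ℓ X) = shift M.s ℓ (M.D h X) := by
  rw [D, D, pdc_shift hX, shift_smul]

theorem hasDerivAt_ip {X : C(Pt, ℂ)} (hX : ContDiff ℝ 1 X) (k Y : C(Pt, ℂ)) {h : ℝ} (hh : h ≠ 0)
    (ℓ : ℝ) : HasDerivAt (fun ℓ => ip (k * shift M.s ℓ X) Y)
      (-(Complex.I / h) * ip (k * shift M.s ℓ (M.D h X)) Y) ℓ := by
  refine (hasDerivAt_ip_shift hX k Y M.s ℓ).congr_deriv ?_
  rw [D, shift_smul, mul_smul_comm, ip_smul_left]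
  have : (h : ℂ) ≠ 0 := by exact_mod_cast hh
  field_simp
  linear_combination (-ip (k * shift M.s ℓ (pdc M.s X)) Y) * Complex.I_sq

end MagFrame

end

noncomputable section

namespace MagFrame

variable {M : MagFrame}

/-- A function `u` with its covariant derivatives `z = V u`, `w = D u`, the residual `r`, and the
translates `U`, `y`, `v`, `R` of `u`, `z`, `w`, `r` along `s`. -/
structure Orbit (M : MagFrame) (h ℓ : ℝ) (u r z w U y v R : C(Pt, ℂ)) : Prop where
  cov_u : M.Cov u
  cov_z : M.Cov z
  cov_w : M.Cov w
  cov_U : M.Cov U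
  cov_y : M.Cov y
  cov_v : M.Cov v
  smooth_u : ContDiff ℝ 1 u
  smooth_z : ContDiff ℝ 1 z
  smooth_w : ContDiff ℝ 1 w
  smooth_U : ContDiff ℝ 1 U
  smooth_y : ContDiff ℝ 1 y
  smooth_v : ContDiff ℝ 1 v
  V_u : M.V h u = z
  D_u : M.D h u = w
  D_U : M.D h U = v
  V_U : M.V h U = y - M.β h ℓ * U
  D_z : M.D h z = M.V h w + (Complex.I * h ^ 2) • (M.field * u)
  D_y : M.D h y = M.V h v + M.β h ℓ * v + (Complex.I * h ^ 2) • shift M.s ℓ (M.field * u)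
  r_eq : r = M.D h w + M.V h z - u
  R_eq : R = M.D h v + M.V h y + M.β h ℓ * y - U

theorem orbit {u r : C(Pt, ℂ)} (hu : ContDiff ℝ 2 u) (hc : M.Cov u) {h : ℝ}
    (hr : r = M.D h (M.D h u) + M.V h (M.V h u) - u) (ℓ : ℝ) :
    M.Orbit h ℓ u r (M.V h u) (M.D h u) (shift M.s ℓ u) (shift M.s ℓ (M.V h u))
      (shift M.s ℓ (M.D h u)) (shift M.s ℓ r) := by
  have hu1 : ContDiff ℝ 1 u := hu.of_le (by norm_num)
  have hz := contDiff_V (M := M) hu h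
  have hw := contDiff_D (M := M) hu h
  refine ⟨hc, hc.V hu1 h, hc.D hu1 h, hc.comp_shift ℓ, (hc.V hu1 h).comp_shift ℓ,
    (hc.D hu1 h).comp_shift ℓ, hu1, hz, hw, contDiff_shift hu1 _ _, contDiff_shift hz _ _,
    contDiff_shift hw _ _, rfl, rfl, D_shift hu1 h ℓ, V_shift hu1 h ℓ, D_V hu h, ?_, hr, ?_⟩
  · rw [D_shift hz, D_V hu, shift_add, shift_smul, V_shift hw]
    ring
  · rw [hr, D_shift hw, V_shift hz, shift_sub, shift_add]
    ring

namespace Orbit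

variable {h ℓ : ℝ} {u r z w U y v R a : C(Pt, ℂ)}

theorem identity_virial (O : M.Orbit h ℓ u r z w U y v R) (ha : Coef 2 a) :
    ip (a * R) z - ip (a * y) r =
      Complex.I * h * (ip (pdc M.t a * y) z - ip (pdc M.t a * v) w + ip (pdc M.t a * U) u)
      + (ip (a * M.β h ℓ * y) z - ip (a * M.β h ℓ * v) w + ip (a * M.β h ℓ * U) u)
      + Complex.I * h * (ip (pdc M.s a * v) z + ip (pdc M.s a * M.D h y) u)
      + h ^ 2 * ip (pdc M.s (pdc M.s a) * y) u
      - Complex.I * h ^ 2 * ip (a * v) (M.field * u)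
      - Complex.I * h ^ 2 * ip (a * shift M.s ℓ (M.field * u)) w := by
  have h1 : Coef 1 a := ha.of_le (by norm_num)
  have e1 := ip_mul_D h1 O.cov_v O.cov_z O.smooth_v O.smooth_z h
  have e2 := ip_mul_V h1 O.cov_v O.cov_w O.smooth_v O.smooth_w h
  have e3 := ip_mul_D h1 O.cov_y O.cov_w O.smooth_y O.smooth_w h
  have e4 := ip_mul_D (ha.dir M.s) O.cov_y O.cov_u O.smooth_y O.smooth_u h
  have e5 := ip_mul_V h1 O.cov_y O.cov_z O.smooth_y O.smooth_z h
  have e6 := ip_mul_V h1 O.cov_U O.cov_u O.smooth_U O.smooth_u h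
  have e7 := congrArg (fun X => ip (a * v) X) O.D_z
  have e8 := congrArg (fun X => ip (a * X) w) O.D_y
  have e9 := congrArg (fun X => ip (a * y) X) O.r_eq
  have e10 := congrArg (fun X => ip (a * X) z) O.R_eq
  have e11 := congrArg (fun X => ip (a * X) u) O.V_U
  rw [O.V_u] at e6
  rw [O.D_u] at e4
  simp only [mul_add, mul_sub, mul_smul_comm, ip_add_left, ip_sub_left, ip_smul_left, ip_add_right,
    ip_sub_right, ip_smul_right, map_mul, map_pow, Complex.conj_I, Complex.conj_ofReal,
    ← mul_assoc] at e7 e8 e9 e10 e11 ⊢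
  linear_combination e10 - e9 + e1 + e7 + e5 - e2 + e3 - e8 + e6 - e11
    - (Complex.I * h) * e4 - h ^ 2 * ip (pdc M.s (pdc M.s a) * y) u * Complex.I_sq

theorem identity_kinetic (O : M.Orbit h ℓ u r z w U y v R) (ha : Coef 1 a) :
    ip (a * y) z - ip (a * v) w + ip (a * U) u =
      2 * ip (a * U) u - 2 * ip (a * v) w + ip (a * R) u - ip (a * M.β h ℓ * y) u
      - Complex.I * h * ip (pdc M.t a * y) u - Complex.I * h * ip (pdc M.s a * v) u := by
  have e1 := ip_mul_V ha O.cov_y O.cov_u O.smooth_y O.smooth_u h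
  have e2 := ip_mul_D ha O.cov_v O.cov_u O.smooth_v O.smooth_u h
  have e10 := congrArg (fun X => ip (a * X) u) O.R_eq
  rw [O.V_u] at e1
  rw [O.D_u] at e2
  simp only [mul_add, mul_sub, ip_add_left, ip_sub_left, ← mul_assoc] at e10 ⊢
  linear_combination -e1 - e2 - e10

theorem identity_transport (O : M.Orbit h ℓ u r z w U y v R) (ha : Coef 2 a)
    (hat : pdc M.t a = 0) :
    ip (a * R) u - ip (a * U) r =
      2 * Complex.I * h * ip (pdc M.s a * v) u + h ^ 2 * ip (pdc M.s (pdc M.s a) * U) u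
      + ip (a * M.β h ℓ * y) u + ip (a * M.β h ℓ * U) z := by
  have h1 : Coef 1 a := ha.of_le (by norm_num)
  have e1 := ip_mul_V h1 O.cov_y O.cov_u O.smooth_y O.smooth_u h
  have e2 := ip_mul_D h1 O.cov_v O.cov_u O.smooth_v O.smooth_u h
  have e3 := ip_mul_D h1 O.cov_U O.cov_w O.smooth_U O.smooth_w h
  have e4 := ip_mul_D (ha.dir M.s) O.cov_U O.cov_u O.smooth_U O.smooth_u h
  have e5 := ip_mul_V h1 O.cov_U O.cov_z O.smooth_U O.smooth_z h
  have e9 := congrArg (fun X => ip (a * U) X) O.r_eq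
  have e10 := congrArg (fun X => ip (a * X) u) O.R_eq
  have e11 := congrArg (fun X => ip (a * X) z) O.V_U
  have e0 : ∀ X Y : C(Pt, ℂ), ip (0 * X) Y = 0 := fun X Y => by simp [ip]
  rw [O.V_u, hat, e0] at e1
  rw [hat, e0] at e5
  rw [O.D_u] at e2 e4
  rw [O.D_U] at e3 e4
  simp only [mul_add, mul_sub, ip_add_left, ip_sub_left, ip_add_right,
    ip_sub_right, ← mul_assoc] at e9 e10 e11 ⊢
  linear_combination e10 - e9 + e1 + e2 + e3 + e5 - e11 - (Complex.I * h) * e4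
    - h ^ 2 * ip (pdc M.s (pdc M.s a) * U) u * Complex.I_sq

end Orbit

end MagFrame

end

noncomputable section

/-- The supremum of the modulus. -/
def cn (k : C(Pt, ℂ)) : ℝ := ⨆ x, ‖k x‖

theorem cn_nonneg (k : C(Pt, ℂ)) : 0 ≤ cn k := Real.iSup_nonneg fun _ => norm_nonneg _

theorem IsPeriodic.norm_le_cn {k : C(Pt, ℂ)} (hk : IsPeriodic k) (x : Pt) : ‖k x‖ ≤ cn k := by
  obtain ⟨K, hK⟩ := hk.exists_norm_le
  exact le_ciSup (f := fun x => ‖k x‖) ⟨K, by rintro _ ⟨x, rfl⟩; exact hK x⟩ x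

theorem coef_one (n : WithTop ℕ∞) : Coef n (1 : C(Pt, ℂ)) :=
  ⟨contDiff_const, fun _ _ => rfl, star_one _⟩

theorem pdc_one (v : Pt) : pdc v 1 = 0 := by
  ext x
  rw [pdc_apply (by exact contDiff_const)]
  change fderiv ℝ (fun _ => (1:ℂ)) x v = 0
  simp

namespace MagFrame

/-- A normalized covariant quasimode `u` of `D² + V²` with residual `r` of size at most `ε`. -/
structure Quasimode (M : MagFrame) (h ε : ℝ) (u r : C(Pt, ℂ)) : Prop where
  contDiff : ContDiff ℝ 2 u
  cov : M.Cov u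
  eqn : r = M.D h (M.D h u) + M.V h (M.V h u) - u
  h_pos : 0 < h
  h_le : h ≤ 1
  ε_le : ε ≤ 1
  nrm_u : nrm u = 1
  nrm_r : nrm r ≤ ε

variable {M : MagFrame}

/-- A bound for the magnetic field and its derivative along `s`. -/
def bd (M : MagFrame) : ℝ := max (cn M.field) (cn (pdc M.s M.field))

theorem bd_nonneg : 0 ≤ M.bd := (cn_nonneg _).trans (le_max_left _ _)

theorem norm_field_le (x : Pt) : ‖M.field x‖ ≤ M.bd :=
  (M.coef_field.per.norm_le_cn x).trans (le_max_left _ _)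

theorem norm_pdc_field_le (x : Pt) : ‖pdc M.s M.field x‖ ≤ M.bd :=
  ((M.coef_field.per.dir M.coef_field.contDiff M.s).norm_le_cn x).trans (le_max_right _ _)

theorem norm_β_le {h ℓ : ℝ} (hh : 0 ≤ h) (hℓ : 0 ≤ ℓ) (x : Pt) :
    ‖M.β h ℓ x‖ ≤ h * ℓ * M.bd := by
  have h1 := norm_sub_shift_le (M.contDiff_p.of_le (by norm_num)) (s := M.s)
    (fun x => M.norm_field_le x) hℓ x
  rw [β, ContinuousMap.smul_apply, norm_smul, Complex.norm_real, Real.norm_of_nonneg hh]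
  calc h * _ ≤ h * (M.bd * ℓ) := by gcongr
    _ = _ := by ring

theorem norm_β_sub_le {h ℓ : ℝ} (hh : 0 ≤ h) (hℓ : 0 ≤ ℓ) (x : Pt) :
    ‖(M.β h ℓ - ((h * ℓ : ℝ) : ℂ) • M.field) x‖ ≤ h * ℓ ^ 2 * M.bd := by
  have h1 := norm_sub_shift_sub_le M.contDiff_p (s := M.s) (fun x => M.norm_pdc_field_le x) hℓ x
  have e : M.β h ℓ - ((h * ℓ : ℝ) : ℂ) • M.field
      = (h : ℂ) • (M.p - shift M.s ℓ M.p - (ℓ : ℂ) • pdc M.s M.p) := by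
    rw [β, field, smul_sub (h : ℂ) (M.p - shift M.s ℓ M.p), smul_smul]
    push_cast
    rfl
  rw [e, ContinuousMap.smul_apply, norm_smul, Complex.norm_real, Real.norm_of_nonneg hh]
  calc h * _ ≤ h * (M.bd * ℓ ^ 2) := by gcongr
    _ = _ := by ring

/-- `⟨k S_ℓ u, u⟩`. -/
def corr (M : MagFrame) (k u : C(Pt, ℂ)) (ℓ : ℝ) : ℂ := ip (k * shift M.s ℓ u) u

/-- `⟨k S_ℓ u, D u⟩`. -/
def corrD (M : MagFrame) (h : ℝ) (k u : C(Pt, ℂ)) (ℓ : ℝ) : ℂ :=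
  ip (k * shift M.s ℓ u) (M.D h u)

/-- `⟨k S_ℓ u, V u⟩ + ⟨k S_ℓ V u, u⟩`. -/
def corrV (M : MagFrame) (h : ℝ) (k u : C(Pt, ℂ)) (ℓ : ℝ) : ℂ :=
  ip (k * shift M.s ℓ u) (M.V h u) + ip (k * shift M.s ℓ (M.V h u)) u

/-- `⟨k S_ℓ V u, V u⟩ - ⟨k S_ℓ D u, D u⟩ + ⟨k S_ℓ u, u⟩`. -/
def quadr (M : MagFrame) (h : ℝ) (k u : C(Pt, ℂ)) (ℓ : ℝ) : ℂ :=
  ip (k * shift M.s ℓ (M.V h u)) (M.V h u) - ip (k * shift M.s ℓ (M.D h u)) (M.D h u)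
    + ip (k * shift M.s ℓ u) u

theorem quadr_add (h : ℝ) (k k' u : C(Pt, ℂ)) (ℓ : ℝ) :
    M.quadr h (k + k') u ℓ = M.quadr h k u ℓ + M.quadr h k' u ℓ := by
  simp only [quadr, add_mul, ip_add_left]; ring

theorem quadr_smul (h : ℝ) (c : ℂ) (k u : C(Pt, ℂ)) (ℓ : ℝ) :
    M.quadr h (c • k) u ℓ = c * M.quadr h k u ℓ := by
  simp only [quadr, smul_mul_assoc, ip_smul_left]; ring

/-- The derivative of `corr`. -/
def dcorr (M : MagFrame) (h : ℝ) (k u : C(Pt, ℂ)) (ℓ : ℝ) : ℂ :=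
  -(Complex.I / h) * ip (k * shift M.s ℓ (M.D h u)) u

/-- The derivative of `corrD`. -/
def dcorrD (M : MagFrame) (h : ℝ) (k u : C(Pt, ℂ)) (ℓ : ℝ) : ℂ :=
  -(Complex.I / h) * ip (k * shift M.s ℓ (M.D h u)) (M.D h u)

/-- The derivative of `corrV`. -/
def dcorrV (M : MagFrame) (h : ℝ) (k u : C(Pt, ℂ)) (ℓ : ℝ) : ℂ :=
  -(Complex.I / h) * (ip (k * shift M.s ℓ (M.D h u)) (M.V h u)
    + ip (k * M.D h (shift M.s ℓ (M.V h u))) u)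

namespace Quasimode

variable {h ε : ℝ} {u r : C(Pt, ℂ)}

theorem orbit (q : M.Quasimode h ε u r) (ℓ : ℝ) :
    M.Orbit h ℓ u r (M.V h u) (M.D h u) (shift M.s ℓ u) (shift M.s ℓ (M.V h u))
      (shift M.s ℓ (M.D h u)) (shift M.s ℓ r) :=
  MagFrame.orbit q.contDiff q.cov q.eqn ℓ

theorem smooth (q : M.Quasimode h ε u r) : ContDiff ℝ 1 u := q.contDiff.of_le (by norm_num)

theorem ε_nonneg (q : M.Quasimode h ε u r) : 0 ≤ ε := (nrm_nonneg r).trans q.nrm_r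

theorem cov_r (q : M.Quasimode h ε u r) : M.Cov r := by
  rw [q.eqn]
  exact (((q.cov.D q.smooth h).D (contDiff_D q.contDiff h) h).add
    ((q.cov.V q.smooth h).V (contDiff_V q.contDiff h) h)).sub q.cov

theorem sq_add_sq_le (q : M.Quasimode h ε u r) : nrm (M.V h u) ^ 2 + nrm (M.D h u) ^ 2 ≤ 2 := by
  have O := q.orbit 0
  have e1 := ip_mul_V (coef_one 1) O.cov_z O.cov_u O.smooth_z O.smooth_u h
  have e2 := ip_mul_D (coef_one 1) O.cov_w O.cov_u O.smooth_w O.smooth_u h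
  have e3 := congrArg (fun X => ip X u) q.eqn
  have e0 : ∀ X Y : C(Pt, ℂ), ip (0 * X) Y = 0 := fun X Y => by simp [ip]
  rw [pdc_one, e0, one_mul, one_mul, ip_self] at e1 e2
  simp only [ip_add_left, ip_sub_left] at e3
  rw [ip_self u, q.nrm_u] at e3
  have e4 : ((nrm (M.V h u) ^ 2 + nrm (M.D h u) ^ 2 : ℝ) : ℂ) = ip r u + 1 := by
    push_cast at e1 e2 e3 ⊢
    linear_combination -e1 - e2 - e3
  have h1 : ‖ip r u‖ ≤ 1 :=
    (norm_ip_le r u).trans (by rw [q.nrm_u, mul_one]; exact q.nrm_r.trans q.ε_le)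
  have h2 := congrArg norm e4
  rw [Complex.norm_real, Real.norm_of_nonneg (by positivity)] at h2
  rw [h2]
  refine (norm_add_le _ _).trans ?_
  rw [norm_one]; linarith

theorem nrm_V (q : M.Quasimode h ε u r) : nrm (M.V h u) ≤ 2 := by
  nlinarith [q.sq_add_sq_le, sq_nonneg (nrm (M.D h u)), nrm_nonneg (M.V h u)]

theorem nrm_D (q : M.Quasimode h ε u r) : nrm (M.D h u) ≤ 2 := by
  nlinarith [q.sq_add_sq_le, sq_nonneg (nrm (M.V h u)), nrm_nonneg (M.D h u)]

theorem nrm_shift_u (q : M.Quasimode h ε u r) (ℓ : ℝ) : nrm (shift M.s ℓ u) ≤ 1 :=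
  (q.cov.nrm_shift ℓ).trans_le q.nrm_u.le

theorem nrm_shift_V (q : M.Quasimode h ε u r) (ℓ : ℝ) : nrm (shift M.s ℓ (M.V h u)) ≤ 2 :=
  ((q.cov.V q.smooth h).nrm_shift ℓ).trans_le q.nrm_V

theorem nrm_shift_D (q : M.Quasimode h ε u r) (ℓ : ℝ) : nrm (shift M.s ℓ (M.D h u)) ≤ 2 :=
  ((q.cov.D q.smooth h).nrm_shift ℓ).trans_le q.nrm_D

theorem nrm_shift_r (q : M.Quasimode h ε u r) (ℓ : ℝ) : nrm (shift M.s ℓ r) ≤ ε :=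
  (q.cov_r.nrm_shift ℓ).trans_le q.nrm_r

theorem nrm_field_u (q : M.Quasimode h ε u r) : nrm (M.field * u) ≤ M.bd := by
  simpa [q.nrm_u] using nrm_mul_le (fun x => M.norm_field_le x) u

theorem nrm_shift_field_u (q : M.Quasimode h ε u r) (ℓ : ℝ) :
    nrm (shift M.s ℓ (M.field * u)) ≤ M.bd :=
  ((q.cov.mul_left M.coef_field.per).nrm_shift ℓ).trans_le q.nrm_field_u

theorem hasDerivAt_corr (q : M.Quasimode h ε u r) (k : C(Pt, ℂ)) (ℓ : ℝ) :
    HasDerivAt (M.corr k u) (M.dcorr h k u ℓ) ℓ :=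
  hasDerivAt_ip q.smooth k u q.h_pos.ne' ℓ

theorem hasDerivAt_corrD (q : M.Quasimode h ε u r) (k : C(Pt, ℂ)) (ℓ : ℝ) :
    HasDerivAt (M.corrD h k u) (M.dcorrD h k u ℓ) ℓ :=
  hasDerivAt_ip q.smooth k _ q.h_pos.ne' ℓ

theorem hasDerivAt_corrV (q : M.Quasimode h ε u r) (k : C(Pt, ℂ)) (ℓ : ℝ) :
    HasDerivAt (M.corrV h k u) (M.dcorrV h k u ℓ) ℓ := by
  refine ((hasDerivAt_ip q.smooth k (M.V h u) q.h_pos.ne' ℓ).add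
    (hasDerivAt_ip (contDiff_V q.contDiff h) k u q.h_pos.ne' ℓ)).congr_deriv ?_
  rw [dcorrV, D_shift (contDiff_V q.contDiff h), mul_add]

theorem norm_quadr_le (q : M.Quasimode h ε u r) {k : C(Pt, ℂ)} {K : ℝ} (hk : ∀ x, ‖k x‖ ≤ K)
    (ℓ : ℝ) : ‖M.quadr h k u ℓ‖ ≤ 9 * K := by
  refine (norm_add_le_of_le (norm_sub_le_of_le (norm_ip_mul_le hk (q.nrm_shift_V ℓ) q.nrm_V)
    (norm_ip_mul_le hk (q.nrm_shift_D ℓ) q.nrm_D))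
    (norm_ip_mul_le hk (q.nrm_shift_u ℓ) q.nrm_u.le)).trans (le_of_eq ?_)
  ring

theorem norm_corrV_le (q : M.Quasimode h ε u r) {k : C(Pt, ℂ)} {K : ℝ} (hk : ∀ x, ‖k x‖ ≤ K)
    (ℓ : ℝ) : ‖M.corrV h k u ℓ‖ ≤ 4 * K := by
  refine (norm_add_le_of_le (norm_ip_mul_le hk (q.nrm_shift_u ℓ) q.nrm_V)
    (norm_ip_mul_le hk (q.nrm_shift_V ℓ) q.nrm_u.le)).trans (le_of_eq ?_)
  ring

theorem norm_corrD_le (q : M.Quasimode h ε u r) {k : C(Pt, ℂ)} {K : ℝ} (hk : ∀ x, ‖k x‖ ≤ K)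
    (ℓ : ℝ) : ‖M.corrD h k u ℓ‖ ≤ 2 * K := by
  refine (norm_ip_mul_le hk (q.nrm_shift_u ℓ) q.nrm_D).trans (le_of_eq ?_)
  ring

/-- `|⟨k S_ℓ u, u⟩| ≤ ‖k u‖`. -/
theorem norm_corr_le (q : M.Quasimode h ε u r) {k : C(Pt, ℂ)} (hk : star k = k)
    (ℓ : ℝ) : ‖M.corr k u ℓ‖ ≤ nrm (k * u) := by
  rw [corr, ip_mul_left hk]
  refine (norm_ip_le _ _).trans ?_
  exact mul_le_of_le_one_left (nrm_nonneg _) (q.nrm_shift_u ℓ)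

end Quasimode

theorem exists_virial_estimate {a : C(Pt, ℂ)} (ha : Coef 2 a) :
    ∃ C, 0 ≤ C ∧ ∀ {h ε : ℝ} {u r : C(Pt, ℂ)}, M.Quasimode h ε u r → ∀ ℓ, 0 ≤ ℓ → ℓ ≤ 1 →
      ‖h ^ 2 * M.dcorrV h (pdc M.s a) u ℓ - Complex.I * h * M.quadr h (pdc M.t a) u ℓ
        - h * ℓ * M.quadr h (a * M.field) u ℓ‖ ≤ C * (ε + h ^ 2 + h * ℓ ^ 2) := by
  have hA := ha.per.norm_le_cn
  have hss := ((ha.dir M.s).per.dir (ha.dir M.s).contDiff M.s).norm_le_cn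
  have hA0 := cn_nonneg a
  have hss0 := cn_nonneg (pdc M.s (pdc M.s a))
  have hb0 := M.bd_nonneg
  set A := cn a
  set A2 := cn (pdc M.s (pdc M.s a))
  refine ⟨4 * A + 2 * A2 + 13 * (A * M.bd), by positivity, ?_⟩
  intro h ε u r q ℓ hℓ hℓ1
  have hh := q.h_pos
  have hε := q.ε_nonneg
  have key := (q.orbit ℓ).identity_virial ha
  have hβ : M.quadr h (a * M.β h ℓ) u ℓ = h * ℓ * M.quadr h (a * M.field) u ℓ
      + M.quadr h (a * (M.β h ℓ - ((h * ℓ : ℝ) : ℂ) • M.field)) u ℓ := by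
    rw [show (h : ℂ) * ℓ = ((h * ℓ : ℝ) : ℂ) by push_cast; rfl, ← quadr_smul, ← quadr_add]
    congr 1
    rw [mul_sub, mul_smul_comm]; ring
  have e : h ^ 2 * M.dcorrV h (pdc M.s a) u ℓ - Complex.I * h * M.quadr h (pdc M.t a) u ℓ
        - h * ℓ * M.quadr h (a * M.field) u ℓ
      = ip (a * shift M.s ℓ (M.V h u)) r - ip (a * shift M.s ℓ r) (M.V h u)
        + ((h ^ 2 : ℝ) : ℂ) * ip (pdc M.s (pdc M.s a) * shift M.s ℓ (M.V h u)) u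
        - Complex.I * ((h ^ 2 : ℝ) : ℂ) * ip (a * shift M.s ℓ (M.D h u)) (M.field * u)
        - Complex.I * ((h ^ 2 : ℝ) : ℂ) * ip (a * shift M.s ℓ (M.field * u)) (M.D h u)
        + M.quadr h (a * (M.β h ℓ - ((h * ℓ : ℝ) : ℂ) • M.field)) u ℓ := by
    have hc : (h : ℂ) ≠ 0 := by exact_mod_cast hh.ne'
    have hd : h ^ 2 * M.dcorrV h (pdc M.s a) u ℓ = -(Complex.I * h) *
      (ip (pdc M.s a * shift M.s ℓ (M.D h u)) (M.V h u)
        + ip (pdc M.s a * M.D h (shift M.s ℓ (M.V h u))) u) := by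
      rw [dcorrV]; field_simp
    rw [hd, Complex.ofReal_pow]
    rw [quadr] at hβ
    rw [quadr]
    linear_combination key + hβ
  rw [e]
  have n2 : ∀ X : ℂ, ‖((h ^ 2 : ℝ) : ℂ) * X‖ = h ^ 2 * ‖X‖ := fun X => by
    rw [norm_mul, Complex.norm_real, Real.norm_of_nonneg (by positivity)]
  have n3 : ∀ X : ℂ, ‖Complex.I * ((h ^ 2 : ℝ) : ℂ) * X‖ = h ^ 2 * ‖X‖ := fun X => by
    rw [mul_assoc, norm_mul, Complex.norm_I, one_mul, n2]
  have b1 := norm_ip_mul_le hA (q.nrm_shift_V ℓ) q.nrm_r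
  have b2 := norm_ip_mul_le hA (q.nrm_shift_r ℓ) q.nrm_V
  have b3 := norm_ip_mul_le hss (q.nrm_shift_V ℓ) q.nrm_u.le
  have b4 := norm_ip_mul_le hA (q.nrm_shift_D ℓ) q.nrm_field_u
  have b5 := norm_ip_mul_le hA (q.nrm_shift_field_u ℓ) q.nrm_D
  have b6 := q.norm_quadr_le (k := a * (M.β h ℓ - ((h * ℓ : ℝ) : ℂ) • M.field))
    (K := A * (h * ℓ ^ 2 * M.bd)) (fun x => by
      rw [ContinuousMap.mul_apply, norm_mul]
      exact mul_le_mul (hA x) (norm_β_sub_le hh.le hℓ x) (norm_nonneg _) hA0) ℓ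
  refine (norm_add_le_of_le (norm_sub_le_of_le (norm_sub_le_of_le (norm_add_le_of_le
    (norm_sub_le_of_le b1 b2) ((n2 _).trans_le (mul_le_mul_of_nonneg_left b3 (sq_nonneg h))))
    ((n3 _).trans_le (mul_le_mul_of_nonneg_left b4 (sq_nonneg h))))
    ((n3 _).trans_le (mul_le_mul_of_nonneg_left b5 (sq_nonneg h)))) b6).trans ?_
  have p1 : 0 ≤ h * ℓ ^ 2 := by positivity
  have p2 : 0 ≤ h ^ 2 := by positivity
  have p3 : 0 ≤ A * M.bd := by positivity
  nlinarith [mul_nonneg hA0 p1, mul_nonneg hA0 p2, mul_nonneg hss0 p1, mul_nonneg hss0 hε,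
    mul_nonneg p3 p1, mul_nonneg p3 p2, mul_nonneg p3 hε]

theorem exists_kinetic_estimate {a : C(Pt, ℂ)} (ha : Coef 1 a) :
    ∃ C, 0 ≤ C ∧ ∀ {h ε : ℝ} {u r : C(Pt, ℂ)}, M.Quasimode h ε u r → ∀ ℓ, 0 ≤ ℓ → ℓ ≤ 1 →
      ‖M.quadr h a u ℓ - 2 * M.corr a u ℓ + 2 * (Complex.I * h) * M.dcorrD h a u ℓ‖
        ≤ C * (ε + h) := by
  have hA := ha.per.norm_le_cn
  have hs := (ha.per.dir ha.contDiff M.s).norm_le_cn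
  have ht := (ha.per.dir ha.contDiff M.t).norm_le_cn
  have hA0 := cn_nonneg a
  have hs0 := cn_nonneg (pdc M.s a)
  have ht0 := cn_nonneg (pdc M.t a)
  have hb0 := M.bd_nonneg
  set A := cn a
  set As := cn (pdc M.s a)
  set At := cn (pdc M.t a)
  refine ⟨A + 2 * As + 2 * At + 2 * (A * M.bd), by positivity, ?_⟩
  intro h ε u r q ℓ hℓ hℓ1
  have hh := q.h_pos
  have hε := q.ε_nonneg
  have key := (q.orbit ℓ).identity_kinetic ha
  have e : M.quadr h a u ℓ - 2 * M.corr a u ℓ + 2 * (Complex.I * h) * M.dcorrD h a u ℓ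
      = ip (a * shift M.s ℓ r) u - ip (a * M.β h ℓ * shift M.s ℓ (M.V h u)) u
        - Complex.I * h * ip (pdc M.t a * shift M.s ℓ (M.V h u)) u
        - Complex.I * h * ip (pdc M.s a * shift M.s ℓ (M.D h u)) u := by
    have hc : (h : ℂ) ≠ 0 := by exact_mod_cast hh.ne'
    have hd : Complex.I * h * M.dcorrD h a u ℓ
        = ip (a * shift M.s ℓ (M.D h u)) (M.D h u) := by
      rw [dcorrD]; field_simp
      linear_combination -ip (a * shift M.s ℓ (M.D h u)) (M.D h u) * Complex.I_sq
    rw [quadr, corr]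
    linear_combination key + 2 * hd
  rw [e]
  have n3 : ∀ X : ℂ, ‖Complex.I * (h : ℂ) * X‖ = h * ‖X‖ := fun X => by
    rw [norm_mul, norm_mul, Complex.norm_I, one_mul, Complex.norm_real, Real.norm_of_nonneg hh.le]
  have b1 := norm_ip_mul_le hA (q.nrm_shift_r ℓ) q.nrm_u.le
  have b2 := norm_ip_mul_le (k := a * M.β h ℓ) (K := A * (h * ℓ * M.bd)) (fun x => by
      rw [ContinuousMap.mul_apply, norm_mul]
      exact mul_le_mul (hA x) (norm_β_le hh.le hℓ x) (norm_nonneg _) hA0)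
      (q.nrm_shift_V ℓ) q.nrm_u.le
  have b3 := norm_ip_mul_le ht (q.nrm_shift_V ℓ) q.nrm_u.le
  have b4 := norm_ip_mul_le hs (q.nrm_shift_D ℓ) q.nrm_u.le
  refine (norm_sub_le_of_le (norm_sub_le_of_le (norm_sub_le_of_le b1 b2)
    ((n3 _).trans_le (mul_le_mul_of_nonneg_left b3 hh.le)))
    ((n3 _).trans_le (mul_le_mul_of_nonneg_left b4 hh.le))).trans ?_
  have p1 : h * ℓ ≤ h := by nlinarith
  have p3 : 0 ≤ A * M.bd := by positivity
  nlinarith [mul_nonneg hA0 hh.le, mul_nonneg hs0 hε, mul_nonneg ht0 hε,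
    mul_le_mul_of_nonneg_left p1 p3, mul_nonneg p3 hε]

end MagFrame

end

noncomputable section

namespace MagFrame

variable {M : MagFrame}

theorem exists_transport_estimate {a : C(Pt, ℂ)} (ha : Coef 2 a) (hat : pdc M.t a = 0) :
    ∃ C, 0 ≤ C ∧ ∀ {h ε : ℝ} {u r : C(Pt, ℂ)}, M.Quasimode h ε u r → ∀ ℓ, 0 ≤ ℓ → ℓ ≤ 1 →
      h ^ 2 * ‖M.dcorr h (pdc M.s a) u ℓ‖
        ≤ C * (ε + h ^ 2 + h * ℓ ^ 2) + 2 * M.bd * (h * ℓ) * nrm (a * u) := by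
  have h1 : Coef 1 a := ha.of_le (by norm_num)
  have hB := h1.mul M.coef_field
  have hA := ha.per.norm_le_cn
  have hss := ((ha.dir M.s).per.dir (ha.dir M.s).contDiff M.s).norm_le_cn
  have ht := (hB.per.dir hB.contDiff M.t).norm_le_cn
  have hA0 := cn_nonneg a
  have hss0 := cn_nonneg (pdc M.s (pdc M.s a))
  have ht0 := cn_nonneg (pdc M.t (a * M.field))
  have hb0 := M.bd_nonneg
  set A := cn a
  set A2 := cn (pdc M.s (pdc M.s a))
  set At := cn (pdc M.t (a * M.field))
  refine ⟨A + A2 + A * M.bd + A * M.bd * M.bd + At, by positivity, ?_⟩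
  intro h ε u r q ℓ hℓ hℓ1
  have hh := q.h_pos
  have hε := q.ε_nonneg
  have O := q.orbit ℓ
  have key := O.identity_transport ha hat
  have e1 := ip_mul_V hB O.cov_U O.cov_u O.smooth_U O.smooth_u h
  rw [O.V_U, mul_sub, ip_sub_left, ← mul_assoc] at e1
  have e2 : ip (a * M.β h ℓ * shift M.s ℓ u) (M.V h u)
      = ip (a * (M.β h ℓ - ((h * ℓ : ℝ) : ℂ) • M.field) * shift M.s ℓ u) (M.V h u)
        + ((h * ℓ : ℝ) : ℂ) * ip (a * M.field * shift M.s ℓ u) (M.V h u) := by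
    rw [← ip_smul_left, ← ip_add_left]
    congr 1
    rw [mul_sub, sub_mul, mul_smul_comm, smul_mul_assoc]; ring
  have e : (2 * h ^ 2 : ℝ) * M.dcorr h (pdc M.s a) u ℓ
      = ip (a * shift M.s ℓ u) r - ip (a * shift M.s ℓ r) u
        + ((h ^ 2 : ℝ) : ℂ) * ip (pdc M.s (pdc M.s a) * shift M.s ℓ u) u
        + ip (M.β h ℓ * shift M.s ℓ (M.V h u)) (a * u)
        + ip (a * (M.β h ℓ - ((h * ℓ : ℝ) : ℂ) • M.field) * shift M.s ℓ u) (M.V h u)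
        + ((h * ℓ : ℝ) : ℂ) * (ip (M.field * shift M.s ℓ (M.V h u)) (a * u)
          - ip (a * M.field * M.β h ℓ * shift M.s ℓ u) u
          - Complex.I * h * ip (pdc M.t (a * M.field) * shift M.s ℓ u) u) := by
    have hc : (h : ℂ) ≠ 0 := by exact_mod_cast hh.ne'
    have hd : (2 * h ^ 2 : ℝ) * M.dcorr h (pdc M.s a) u ℓ = -(2 * Complex.I * h) *
      ip (pdc M.s a * shift M.s ℓ (M.D h u)) u := by
      rw [dcorr]; push_cast; field_simp
    rw [hd, ← ip_mul_left ha.real, ← ip_mul_left ha.real, ← mul_assoc, ← mul_assoc,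
      Complex.ofReal_pow]
    rw [O.V_u] at e1
    linear_combination key + e2 - ((h * ℓ : ℝ) : ℂ) * e1
  have n1 := congrArg norm e
  rw [norm_mul, Complex.norm_real, Real.norm_of_nonneg (by positivity)] at n1
  have n2 : ∀ X : ℂ, ‖((h ^ 2 : ℝ) : ℂ) * X‖ = h ^ 2 * ‖X‖ := fun X => by
    rw [norm_mul, Complex.norm_real, Real.norm_of_nonneg (by positivity)]
  have n3 : ∀ X : ℂ, ‖((h * ℓ : ℝ) : ℂ) * X‖ = h * ℓ * ‖X‖ := fun X => by
    rw [norm_mul, Complex.norm_real, Real.norm_of_nonneg (by positivity)]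
  have n4 : ∀ X : ℂ, ‖Complex.I * (h : ℂ) * X‖ = h * ‖X‖ := fun X => by
    rw [norm_mul, norm_mul, Complex.norm_I, one_mul, Complex.norm_real, Real.norm_of_nonneg hh.le]
  have b1 := norm_ip_mul_le hA (q.nrm_shift_u ℓ) q.nrm_r
  have b2 := norm_ip_mul_le hA (q.nrm_shift_r ℓ) q.nrm_u.le
  have b3 := norm_ip_mul_le hss (q.nrm_shift_u ℓ) q.nrm_u.le
  have b4 := norm_ip_mul_le (fun x => M.norm_β_le hh.le hℓ x) (q.nrm_shift_V ℓ)
    (le_refl (nrm (a * u)))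
  have b5 := norm_ip_mul_le (k := a * (M.β h ℓ - ((h * ℓ : ℝ) : ℂ) • M.field))
    (K := A * (h * ℓ ^ 2 * M.bd)) (fun x => by
      rw [ContinuousMap.mul_apply, norm_mul]
      exact mul_le_mul (hA x) (norm_β_sub_le hh.le hℓ x) (norm_nonneg _) hA0)
      (q.nrm_shift_u ℓ) q.nrm_V
  have b6 := norm_ip_mul_le (fun x => M.norm_field_le x) (q.nrm_shift_V ℓ)
    (le_refl (nrm (a * u)))
  have b7 := norm_ip_mul_le (k := a * M.field * M.β h ℓ)
    (K := A * M.bd * (h * ℓ * M.bd)) (fun x => by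
      rw [ContinuousMap.mul_apply, ContinuousMap.mul_apply, norm_mul, norm_mul]
      exact mul_le_mul (mul_le_mul (hA x) (M.norm_field_le x) (norm_nonneg _) hA0)
        (norm_β_le hh.le hℓ x) (norm_nonneg _) (by positivity))
      (q.nrm_shift_u ℓ) q.nrm_u.le
  have b8 := norm_ip_mul_le ht (q.nrm_shift_u ℓ) q.nrm_u.le
  have hhl : 0 ≤ h * ℓ := by positivity
  have n5 := n1.trans_le (norm_add_le_of_le (norm_add_le_of_le (norm_add_le_of_le
    (norm_add_le_of_le (norm_sub_le_of_le b1 b2)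
      ((n2 _).trans_le (mul_le_mul_of_nonneg_left b3 (sq_nonneg h)))) b4) b5)
      ((n3 _).trans_le (mul_le_mul_of_nonneg_left (norm_sub_le_of_le (norm_sub_le_of_le b6 b7)
        ((n4 _).trans_le (mul_le_mul_of_nonneg_left b8 hh.le))) hhl)))
  have p1 : 0 ≤ h * ℓ ^ 2 := by positivity
  have p2 : 0 ≤ h ^ 2 := by positivity
  have p3 : 0 ≤ A * M.bd := by positivity
  have p4 : 0 ≤ A * M.bd * M.bd := by positivity
  have p5 : h * ℓ * h ≤ h ^ 2 := by nlinarith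
  have p6 : h * ℓ * (h * ℓ) ≤ h ^ 2 := by nlinarith
  nlinarith [mul_nonneg hA0 p1, mul_nonneg hA0 p2, mul_nonneg hss0 p1, mul_nonneg hss0 hε,
    mul_nonneg hss0 p2, mul_nonneg p3 p2, mul_nonneg p3 hε, mul_nonneg p4 hε, mul_nonneg p4 p1,
    mul_le_mul_of_nonneg_left p5 ht0, mul_le_mul_of_nonneg_left p6 p4, mul_nonneg ht0 hε,
    mul_nonneg ht0 p1, mul_nonneg ht0 p2, mul_nonneg p4 p2]

theorem exists_corrV_estimate {a : C(Pt, ℂ)} (ha : Coef 2 a) (hat : pdc M.t a = 0) :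
    ∃ C, 0 ≤ C ∧ ∀ {h ε : ℝ} {u r : C(Pt, ℂ)}, M.Quasimode h ε u r → ∀ ℓ, 0 ≤ ℓ → ℓ ≤ 1 →
      ‖M.corrV h (pdc M.s a) u ℓ‖ ≤ 4 * nrm (pdc M.s a * u) + C * h := by
  have hs := (ha.dir M.s).per.norm_le_cn
  have hs0 := cn_nonneg (pdc M.s a)
  have hb0 := M.bd_nonneg
  set A := cn (pdc M.s a)
  refine ⟨A * M.bd, by positivity, ?_⟩
  intro h ε u r q ℓ hℓ hℓ1
  have hh := q.h_pos
  have O := q.orbit ℓ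
  have e1 := ip_mul_V (ha.dir M.s) O.cov_U O.cov_u O.smooth_U O.smooth_u h
  rw [O.V_U, O.V_u, mul_sub, ip_sub_left, ← mul_assoc, pdc_comm ha.contDiff, hat, pdc_zero] at e1
  have e0 : ip (0 * shift M.s ℓ u) u = 0 := by simp [ip]
  have e : M.corrV h (pdc M.s a) u ℓ = ip (shift M.s ℓ (M.V h u)) (pdc M.s a * u)
      + ip (shift M.s ℓ (M.V h u)) (pdc M.s a * u)
      - ip (pdc M.s a * M.β h ℓ * shift M.s ℓ u) u := by
    rw [corrV, ← ip_mul_left (ha.dir M.s).real]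
    rw [e0] at e1
    linear_combination -e1
  rw [e]
  have b1 : ‖ip (shift M.s ℓ (M.V h u)) (pdc M.s a * u)‖ ≤ 2 * nrm (pdc M.s a * u) :=
    (norm_ip_le _ _).trans (mul_le_mul_of_nonneg_right (q.nrm_shift_V ℓ) (nrm_nonneg _))
  have b2 := norm_ip_mul_le (k := pdc M.s a * M.β h ℓ) (K := A * (h * ℓ * M.bd)) (fun x => by
      rw [ContinuousMap.mul_apply, norm_mul]
      exact mul_le_mul (hs x) (norm_β_le hh.le hℓ x) (norm_nonneg _) hs0)
      (q.nrm_shift_u ℓ) q.nrm_u.le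
  refine (norm_sub_le_of_le (norm_add_le_of_le b1 b1) b2).trans ?_
  have p1 : h * ℓ ≤ h := by nlinarith
  nlinarith [mul_le_mul_of_nonneg_left p1 (mul_nonneg hs0 hb0)]

/-- The combination of correlations whose derivative is governed by the averaged field `b`. -/
def total (M : MagFrame) (h : ℝ) (f g b u : C(Pt, ℂ)) (ℓ : ℝ) : ℂ :=
  h ^ 2 * (M.corrV h (pdc M.s f) u ℓ
    + Complex.I * (ℓ * (M.corrV h (pdc M.s (f * g)) u ℓ + 2 * M.corrD h (f * b) u ℓ)))

theorem exists_total_estimate {f g b : C(Pt, ℂ)} (hf : Coef 2 f) (hg : Coef 2 g) (hb : Coef 2 b)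
    (hft : pdc M.t f = 0) (hgt : pdc M.t g = M.field - b) :
    ∃ C, 0 ≤ C ∧ ∀ {h ε : ℝ} {u r : C(Pt, ℂ)}, M.Quasimode h ε u r → ∀ ℓ, 0 ≤ ℓ → ℓ ≤ 1 →
      ∃ Z', HasDerivAt (M.total h f g b u) Z' ℓ ∧
        ‖Z' - 2 * (h * ℓ) * M.corr (f * b) u ℓ‖ ≤ C * (ε + h ^ 2 + h * ℓ ^ 2) := by
  have hfg := hf.mul hg
  have hfb := hf.mul hb
  have hfg1 : Coef 1 (f * g) := hfg.of_le (by norm_num)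
  have hfb1 : Coef 1 (f * b) := hfb.of_le (by norm_num)
  have hkB := hfg1.mul M.coef_field
  obtain ⟨C1, hC1, E1⟩ := exists_virial_estimate (M := M) hf
  obtain ⟨C2, hC2, E2⟩ := exists_virial_estimate (M := M) hfg
  obtain ⟨C3, hC3, E3⟩ := exists_kinetic_estimate (M := M) hfb1
  have k1 := hkB.per.norm_le_cn
  have k2 := (hfg.dir M.s).per.norm_le_cn
  have k3 := hfb.per.norm_le_cn
  have k10 := cn_nonneg (f * g * M.field)
  have k20 := cn_nonneg (pdc M.s (f * g))
  have k30 := cn_nonneg (f * b)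
  set K1 := cn (f * g * M.field)
  set K2 := cn (pdc M.s (f * g))
  set K3 := cn (f * b)
  refine ⟨C1 + C2 + C3 + 9 * K1 + 4 * K2 + 4 * K3, by positivity, ?_⟩
  intro h ε u r q ℓ hℓ hℓ1
  have hh := q.h_pos
  have hh1 := q.h_le
  have hε := q.ε_nonneg
  have d : HasDerivAt (M.total h f g b u)
      (h ^ 2 * (M.dcorrV h (pdc M.s f) u ℓ
        + Complex.I * (1 * (M.corrV h (pdc M.s (f * g)) u ℓ + 2 * M.corrD h (f * b) u ℓ)
        + ℓ * (M.dcorrV h (pdc M.s (f * g)) u ℓ + 2 * M.dcorrD h (f * b) u ℓ)))) ℓ :=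
    ((q.hasDerivAt_corrV _ ℓ).add (((Complex.ofRealCLM.hasDerivAt (x := ℓ)).mul
      ((q.hasDerivAt_corrV _ ℓ).add ((q.hasDerivAt_corrD _ ℓ).const_mul 2))).const_mul
        Complex.I)).const_mul _
  refine ⟨_, d, ?_⟩
  have x1 := E1 q ℓ hℓ hℓ1
  have x2 := E2 q ℓ hℓ hℓ1
  have x3 := E3 q ℓ hℓ hℓ1
  have hfgt : pdc M.t (f * g) = f * M.field - f * b := by
    rw [pdc_mul (hf.of_le (by norm_num)).contDiff (hg.of_le (by norm_num)).contDiff, hft, hgt]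
    ring
  have hq0 : M.quadr h (pdc M.t f) u ℓ = 0 := by simp [hft, quadr, ip]
  have hqa : M.quadr h (f * M.field) u ℓ
      = M.quadr h (pdc M.t (f * g)) u ℓ + M.quadr h (f * b) u ℓ := by
    rw [← quadr_add, hfgt, sub_add_cancel]
  set q1 := M.quadr h (pdc M.t (f * g)) u ℓ
  set q2 := M.quadr h (f * b) u ℓ
  set q3 := M.quadr h (f * g * M.field) u ℓ with hq3
  have y1 : ‖q3‖ ≤ 9 * K1 := q.norm_quadr_le k1 ℓ
  have y2 := q.norm_corrV_le k2 ℓ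
  have y3 := q.norm_corrD_le k3 ℓ
  rw [hq0, hqa] at x1
  set v1 := M.dcorrV h (pdc M.s f) u ℓ
  set v2 := M.dcorrV h (pdc M.s (f * g)) u ℓ
  set v3 := M.dcorrD h (f * b) u ℓ
  have e : (h : ℂ) ^ 2 * (v1 + Complex.I * (1 * (M.corrV h (pdc M.s (f * g)) u ℓ
        + 2 * M.corrD h (f * b) u ℓ) + ℓ * (v2 + 2 * v3)))
        - 2 * (h * ℓ) * M.corr (f * b) u ℓ
      = (h ^ 2 * v1 - Complex.I * h * 0 - h * ℓ * (q1 + q2))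
        + Complex.I * ((ℓ : ℝ) * ((h ^ 2 * v2 - Complex.I * h * q1 - h * ℓ * q3)
          + ((h * ℓ : ℝ) : ℂ) * q3))
        + ((h * ℓ : ℝ) : ℂ) * (q2 - 2 * M.corr (f * b) u ℓ + 2 * (Complex.I * h) * v3)
        + Complex.I * (((h ^ 2 : ℝ) : ℂ) * (M.corrV h (pdc M.s (f * g)) u ℓ
        + 2 * M.corrD h (f * b) u ℓ)) := by
    push_cast
    linear_combination (h * ℓ * q1) * Complex.I_sq
  rw [e]
  have nI : ∀ X : ℂ, ‖Complex.I * X‖ = ‖X‖ := fun X => by rw [norm_mul, Complex.norm_I, one_mul]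
  have nR : ∀ {a : ℝ} (X : ℂ), 0 ≤ a → ‖(a : ℂ) * X‖ = a * ‖X‖ := fun X ha => by
    rw [norm_mul, Complex.norm_real, Real.norm_of_nonneg ha]
  have hhl : 0 ≤ h * ℓ := by positivity
  have n2 : ∀ X : ℂ, ‖(2 : ℂ) * X‖ = 2 * ‖X‖ := fun X => by rw [norm_mul]; simp
  have b2 : ‖Complex.I * ((ℓ : ℝ) * ((h ^ 2 * v2 - Complex.I * h * q1 - h * ℓ * q3)
          + ((h * ℓ : ℝ) : ℂ) * q3))‖ ≤ ℓ * (C2 * (ε + h ^ 2 + h * ℓ ^ 2) + h * ℓ * (9 * K1)) := by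
    rw [nI, nR _ hℓ]
    refine mul_le_mul_of_nonneg_left (norm_add_le_of_le x2 ?_) hℓ
    rw [nR _ hhl]
    exact mul_le_mul_of_nonneg_left y1 hhl
  have b3 : ‖((h * ℓ : ℝ) : ℂ) * (q2 - 2 * M.corr (f * b) u ℓ + 2 * (Complex.I * h) * v3)‖
      ≤ h * ℓ * (C3 * (ε + h)) := by
    rw [nR _ hhl]
    exact mul_le_mul_of_nonneg_left x3 hhl
  have b4 : ‖Complex.I * (((h ^ 2 : ℝ) : ℂ) * (M.corrV h (pdc M.s (f * g)) u ℓ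
        + 2 * M.corrD h (f * b) u ℓ))‖ ≤ h ^ 2 * (4 * K2 + 2 * (2 * K3)) := by
    rw [nI, nR _ (sq_nonneg h)]
    refine mul_le_mul_of_nonneg_left (norm_add_le_of_le y2 ?_) (sq_nonneg h)
    rw [n2]
    exact mul_le_mul_of_nonneg_left y3 zero_le_two
  refine (norm_add_le_of_le (norm_add_le_of_le (norm_add_le_of_le x1 b2) b3) b4).trans ?_
  have p0 : 0 ≤ ε + h ^ 2 + h * ℓ ^ 2 := by positivity
  have p1 : 0 ≤ h * ℓ ^ 2 := by positivity
  have p2 : ℓ * (C2 * (ε + h ^ 2 + h * ℓ ^ 2)) ≤ C2 * (ε + h ^ 2 + h * ℓ ^ 2) :=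
    mul_le_of_le_one_left (by positivity) hℓ1
  have p3 : h * ℓ * (C3 * (ε + h)) ≤ C3 * (ε + h ^ 2 + h * ℓ ^ 2) := by
    have : h * ℓ * (ε + h) ≤ ε + h ^ 2 + h * ℓ ^ 2 := by
      have : h * ℓ ≤ h := by nlinarith
      nlinarith [mul_le_mul_of_nonneg_right this hh.le,
        mul_le_mul_of_nonneg_right (this.trans hh1) hε]
    calc _ = C3 * (h * ℓ * (ε + h)) := by ring
      _ ≤ _ := by gcongr
  nlinarith [mul_nonneg k10 hε, mul_nonneg k10 (sq_nonneg h), mul_nonneg k20 hε,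
    mul_nonneg k20 p1, mul_nonneg k30 hε, mul_nonneg k30 p1]

end MagFrame

end

noncomputable section

theorem norm_sub_zero_le_of_hasDerivAt {W : ℝ → ℂ} {L K : ℝ} (hL : 0 ≤ L)
    (hW : ∀ ℓ, 0 ≤ ℓ → ℓ ≤ L → ∃ W', HasDerivAt W W' ℓ ∧ ‖W'‖ ≤ K) :
    ‖W L - W 0‖ ≤ L * K := by
  have hW1 : ∀ ℓ : ℝ, ∃ W', (0 ≤ ℓ → ℓ ≤ L → HasDerivAt W W' ℓ ∧ ‖W'‖ ≤ K) := by
    intro ℓ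
    by_cases h : 0 ≤ ℓ ∧ ℓ ≤ L
    · obtain ⟨W', h1⟩ := hW ℓ h.1 h.2
      exact ⟨W', fun _ _ => h1⟩
    · exact ⟨0, fun h1 h2 => absurd ⟨h1, h2⟩ h⟩
  choose W' hW' using hW1
  have := norm_image_sub_le_of_norm_deriv_le_segment' (f := W) (f' := W') (C := K) (a := 0) (b := L)
    (fun x hx => (hW' x hx.1 hx.2).1.hasDerivWithinAt)
    (fun x hx => (hW' x hx.1 hx.2.le).2) L ⟨hL, le_rfl⟩
  linarith

namespace MagFrame

variable {M : MagFrame}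

theorem corr_sub (k k' u : C(Pt, ℂ)) (ℓ : ℝ) :
    M.corr (k - k') u ℓ = M.corr k u ℓ - M.corr k' u ℓ := by
  simp only [corr, sub_mul, ip_sub_left]

theorem corr_smul (c : ℂ) (k u : C(Pt, ℂ)) (ℓ : ℝ) :
    M.corr (c • k) u ℓ = c * M.corr k u ℓ := by
  simp only [corr, smul_mul_assoc, ip_smul_left]

theorem exists_core_estimate {f g b f₁ : C(Pt, ℂ)} (hf : Coef 2 f) (hg : Coef 2 g)
    (hb : Coef 2 b) (hf₁ : Coef 2 f₁) (hft : pdc M.t f = 0) (hgt : pdc M.t g = M.field - b)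
    (hf₁t : pdc M.t f₁ = 0) (b₀ : ℝ) :
    ∃ C, 0 ≤ C ∧ ∀ {h ε : ℝ} {u r : C(Pt, ℂ)}, M.Quasimode h ε u r → ∀ L, 0 ≤ L → L ≤ 1 →
      h * L ^ 2 * (|b₀| * ‖ip (f * u) u‖) ≤
        h ^ 2 * (8 * nrm (pdc M.s f * u) + C * (h + L)) + L * (C * (ε + h ^ 2 + h * L ^ 2)
          + 2 * (h * L) * (nrm ((f * b - (b₀ : ℂ) • f) * u) + |b₀| *
            (2 * nrm ((f - pdc M.s f₁) * u)
              + L * ((C * (ε + h ^ 2 + h * L ^ 2) + 2 * M.bd * (h * L) * nrm (f₁ * u)) / h ^ 2)))) := by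
  obtain ⟨C1, hC1, E1⟩ := exists_total_estimate (M := M) hf hg hb hft hgt
  obtain ⟨C2, hC2, E2⟩ := exists_transport_estimate (M := M) hf₁ hf₁t
  obtain ⟨C3, hC3, E3⟩ := exists_corrV_estimate (M := M) hf hft
  have k2 := ((hf.mul hg).dir M.s).per.norm_le_cn
  have k3 := (hf.mul hb).per.norm_le_cn
  have k20 := cn_nonneg (pdc M.s (f * g))
  have k30 := cn_nonneg (f * b)
  have hbd := M.bd_nonneg
  set K2 := cn (pdc M.s (f * g))
  set K3 := cn (f * b)
  set C := C1 + C2 + 2 * C3 + 4 * K2 + 4 * K3 with hCdef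
  have hCC : 0 ≤ C := by positivity
  have hC1C : C1 ≤ C := by rw [hCdef]; linarith
  have hC2C : C2 ≤ C := by rw [hCdef]; linarith
  refine ⟨C, hCC, ?_⟩
  intro h ε u r q L hL hL1
  have hh := q.h_pos
  have hε := q.ε_nonneg
  have hqf : ∀ ℓ, 0 ≤ ℓ → ℓ ≤ L → ‖M.corr f u ℓ - M.corr f u 0‖ ≤
      2 * nrm ((f - pdc M.s f₁) * u) + L * ((C * (ε + h ^ 2 + h * L ^ 2)
        + 2 * M.bd * (h * L) * nrm (f₁ * u)) / h ^ 2) := by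
    intro ℓ hℓ hℓL
    have hreal : star (f - pdc M.s f₁) = f - pdc M.s f₁ := by
      rw [star_sub, hf.real, (hf₁.dir M.s).real]
    have n1 := q.norm_corr_le hreal ℓ
    have n2 := q.norm_corr_le hreal 0
    have n3 := norm_sub_zero_le_of_hasDerivAt (W := M.corr (pdc M.s f₁) u)
      (K := (C * (ε + h ^ 2 + h * L ^ 2) + 2 * M.bd * (h * L) * nrm (f₁ * u)) / h ^ 2) hℓ
      (fun t ht htℓ => ⟨_, q.hasDerivAt_corr _ t, by
        rw [le_div_iff₀' (by positivity)]
        refine (E2 q t ht (by linarith)).trans ?_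
        have := nrm_nonneg (f₁ * u)
        have htL : t ≤ L := htℓ.trans hℓL
        gcongr⟩)
    rw [corr_sub] at n1 n2
    have e : M.corr f u ℓ - M.corr f u 0 = (M.corr f u ℓ - M.corr (pdc M.s f₁) u ℓ)
        - (M.corr f u 0 - M.corr (pdc M.s f₁) u 0)
        + (M.corr (pdc M.s f₁) u ℓ - M.corr (pdc M.s f₁) u 0) := by ring
    rw [e]
    refine (norm_add_le_of_le (norm_sub_le_of_le n1 n2) n3).trans ?_
    have := nrm_nonneg (f₁ * u)
    rw [two_mul (nrm _)]
    gcongr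
  have hrealb : star (f * b - (b₀ : ℂ) • f) = f * b - (b₀ : ℂ) • f := by
    rw [star_sub, (hf.mul hb).real, star_smul, hf.real]; simp
  set Q := nrm ((f * b - (b₀ : ℂ) • f) * u)
  set R := 2 * nrm ((f - pdc M.s f₁) * u) + L * ((C * (ε + h ^ 2 + h * L ^ 2)
        + 2 * M.bd * (h * L) * nrm (f₁ * u)) / h ^ 2)
  have hQ : 0 ≤ Q := nrm_nonneg _
  have hR : 0 ≤ R := (norm_nonneg _).trans (hqf 0 le_rfl hL)
  have main := norm_sub_zero_le_of_hasDerivAt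
    (W := fun ℓ : ℝ => M.total h f g b u ℓ - ((h * ℓ ^ 2 * b₀ : ℝ) : ℂ) * M.corr f u 0)
    (L := L) (K := C * (ε + h ^ 2 + h * L ^ 2) + 2 * (h * L) * (Q + |b₀| * R)) hL (by
      intro ℓ hℓ hℓL
      obtain ⟨Z', hZ, hZb⟩ := E1 q ℓ hℓ (hℓL.trans hL1)
      have d1 : HasDerivAt (fun ℓ : ℝ => h * ℓ ^ 2 * b₀) (2 * (h * ℓ) * b₀) ℓ := by
        have := (((hasDerivAt_id ℓ).pow 2).const_mul h).mul_const b₀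
        refine this.congr_deriv ?_
        simp only [id, Nat.cast_ofNat, Nat.add_one_sub_one, pow_one]; ring
      refine ⟨_, hZ.sub ((d1.ofReal_comp).mul_const (M.corr f u 0)), ?_⟩
      have n1 := q.norm_corr_le hrealb ℓ
      rw [corr_sub, corr_smul] at n1
      have n2 := hqf ℓ hℓ hℓL
      have e : Z' - ((2 * (h * ℓ) * b₀ : ℝ) : ℂ) * M.corr f u 0
          = (Z' - 2 * (h * ℓ) * M.corr (f * b) u ℓ)
            + ((2 * (h * ℓ) : ℝ) : ℂ) * ((M.corr (f * b) u ℓ - b₀ * M.corr f u ℓ)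
              + (b₀ : ℂ) * (M.corr f u ℓ - M.corr f u 0)) := by
        push_cast; ring
      rw [e]
      have n3 : ‖(b₀ : ℂ) * (M.corr f u ℓ - M.corr f u 0)‖ ≤ |b₀| * R := by
        rw [norm_mul, Complex.norm_real, Real.norm_eq_abs]
        gcongr
      have n4 := norm_add_le_of_le n1 n3
      have n5 : ‖((2 * (h * ℓ) : ℝ) : ℂ) * ((M.corr (f * b) u ℓ - b₀ * M.corr f u ℓ)
              + (b₀ : ℂ) * (M.corr f u ℓ - M.corr f u 0))‖ ≤ 2 * (h * L) * (Q + |b₀| * R) := by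
        rw [norm_mul, Complex.norm_real, Real.norm_of_nonneg (by positivity)]
        gcongr
      refine norm_add_le_of_le (hZb.trans ?_) n5
      gcongr)
  have t0 : ‖M.total h f g b u 0‖ ≤ h ^ 2 * (4 * nrm (pdc M.s f * u) + C3 * h) := by
    rw [total]
    simp only [Complex.ofReal_zero, zero_mul, mul_zero, add_zero]
    rw [norm_mul, norm_pow, Complex.norm_real, Real.norm_of_nonneg hh.le]
    have := E3 q 0 le_rfl zero_le_one
    gcongr
  have tL : ‖M.total h f g b u L‖ ≤ h ^ 2 * (4 * nrm (pdc M.s f * u) + C3 * h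
      + L * (4 * K2 + 4 * K3)) := by
    rw [total, norm_mul, norm_pow, Complex.norm_real, Real.norm_of_nonneg hh.le]
    have a1 := E3 q L hL hL1
    have a2 := q.norm_corrV_le k2 L
    have a3 := q.norm_corrD_le k3 L
    have a4 : ‖2 * M.corrD h (f * b) u L‖ ≤ 4 * K3 := by
      rw [norm_mul, RCLike.norm_ofNat]; linarith
    have a5 : ‖Complex.I * ((L : ℂ) * (M.corrV h (pdc M.s (f * g)) u L
        + 2 * M.corrD h (f * b) u L))‖ ≤ L * (4 * K2 + 4 * K3) := by
      rw [norm_mul, Complex.norm_I, one_mul, norm_mul, Complex.norm_real, Real.norm_of_nonneg hL]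
      exact mul_le_mul_of_nonneg_left (norm_add_le_of_le a2 a4) hL
    exact mul_le_mul_of_nonneg_left (norm_add_le_of_le a1 a5) (by positivity)
  have q0 : M.corr f u 0 = ip (f * u) u := by rw [corr, shift_zero]
  have e : ((h * L ^ 2 * b₀ : ℝ) : ℂ) * M.corr f u 0 = M.total h f g b u L - M.total h f g b u 0
      - ((M.total h f g b u L - ((h * L ^ 2 * b₀ : ℝ) : ℂ) * M.corr f u 0)
        - (M.total h f g b u 0 - ((h * 0 ^ 2 * b₀ : ℝ) : ℂ) * M.corr f u 0)) := by
    push_cast; ring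
  have e1 := congrArg norm e
  rw [norm_mul, Complex.norm_real, Real.norm_eq_abs, abs_mul, abs_of_nonneg (by positivity),
    q0] at e1
  rw [← mul_assoc, e1, ← q0]
  refine (norm_sub_le_of_le (norm_sub_le_of_le tL t0) main).trans ?_
  have p1 : h ^ 2 * (2 * C3 * h + L * (4 * K2 + 4 * K3)) ≤ h ^ 2 * (C * (h + L)) := by
    have : 0 ≤ C1 + C2 := by positivity
    have : 2 * C3 ≤ C := by rw [hCdef]; linarith
    have : 4 * K2 + 4 * K3 ≤ C := by rw [hCdef]; linarith
    rw [mul_add C]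
    gcongr h ^ 2 * (?_ + ?_)
    · gcongr
    · rw [mul_comm]; gcongr
  linarith

/-- The inequality at the scale `L = T √h`, with `h = κ²` and `ε = η κ³`. -/
theorem exists_scaled_estimate {f g b f₁ : C(Pt, ℂ)} (hf : Coef 2 f) (hg : Coef 2 g)
    (hb : Coef 2 b) (hf₁ : Coef 2 f₁) (hft : pdc M.t f = 0) (hgt : pdc M.t g = M.field - b)
    (hf₁t : pdc M.t f₁ = 0) (b₀ : ℝ) {T : ℝ} (hT : 0 < T) :
    ∃ C, ∀ {κ η : ℝ} {u r : C(Pt, ℂ)}, 0 < κ → κ ≤ 1 → κ * T ≤ 1 →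
      M.Quasimode (κ ^ 2) (η * κ ^ 3) u r →
      |b₀| * ‖ip (f * u) u‖ ≤ 8 / T ^ 2 * nrm (pdc M.s f * u)
        + 2 * nrm ((f * b - (b₀ : ℂ) • f) * u) + |b₀| * (4 * nrm ((f - pdc M.s f₁) * u)
          + 4 * M.bd * T ^ 2 * nrm (f₁ * u)) + C * (η + κ) := by
  obtain ⟨C, hC, E⟩ := exists_core_estimate hf hg hb hf₁ hft hgt hf₁t b₀
  refine ⟨C * ((1 + T) / T ^ 2) + C * (1 + (1 + T ^ 2)) / T
    + 2 * |b₀| * (T * (C * (1 + (1 + T ^ 2)))), ?_⟩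
  intro κ η u r hκ hκ1 hκT q
  have h1 := E q (κ * T) (by positivity) hκT
  have hη : 0 ≤ η := by
    have := q.ε_nonneg
    exact nonneg_of_mul_nonneg_left this (by positivity)
  set q0 := ‖ip (f * u) u‖
  set N4 := nrm (pdc M.s f * u)
  set N1 := nrm ((f * b - (b₀ : ℂ) • f) * u)
  set N2 := nrm ((f - pdc M.s f₁) * u)
  set N3 := nrm (f₁ * u)
  have hlhs : κ ^ 2 * (κ * T) ^ 2 * (|b₀| * q0) = κ ^ 4 * T ^ 2 * (|b₀| * q0) := by ring
  rw [hlhs, ← le_div_iff₀' (by positivity)] at h1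
  refine h1.trans ?_
  have e : ((κ ^ 2) ^ 2 * (8 * N4 + C * (κ ^ 2 + κ * T)) + κ * T * (C * (η * κ ^ 3 + (κ ^ 2) ^ 2
      + κ ^ 2 * (κ * T) ^ 2) + 2 * (κ ^ 2 * (κ * T)) * (N1 + |b₀| * (2 * N2 + κ * T * ((C *
      (η * κ ^ 3 + (κ ^ 2) ^ 2 + κ ^ 2 * (κ * T) ^ 2) + 2 * M.bd * (κ ^ 2 * (κ * T)) * N3)
        / (κ ^ 2) ^ 2))))) / (κ ^ 4 * T ^ 2)
      = 8 / T ^ 2 * N4 + 2 * N1 + |b₀| * (4 * N2 + 4 * M.bd * T ^ 2 * N3)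
        + (C * ((κ ^ 2 + κ * T) / T ^ 2) + C * (η + κ * (1 + T ^ 2)) / T
          + 2 * |b₀| * (T * (C * (η + κ * (1 + T ^ 2))))) := by
    field_simp
    ring
  rw [e]
  have p1 : κ ^ 2 + κ * T ≤ (1 + T) * (η + κ) := by nlinarith
  have p2 : η + κ * (1 + T ^ 2) ≤ (1 + (1 + T ^ 2)) * (η + κ) := by nlinarith [sq_nonneg T]
  have p3 : C * ((κ ^ 2 + κ * T) / T ^ 2) ≤ C * ((1 + T) / T ^ 2) * (η + κ) := by
    calc _ ≤ C * ((1 + T) * (η + κ) / T ^ 2) := by gcongr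
      _ = _ := by ring
  have p4 : C * (η + κ * (1 + T ^ 2)) / T ≤ C * (1 + (1 + T ^ 2)) / T * (η + κ) := by
    calc _ ≤ C * ((1 + (1 + T ^ 2)) * (η + κ)) / T := by gcongr
      _ = _ := by ring
  have p5 : 2 * |b₀| * (T * (C * (η + κ * (1 + T ^ 2))))
      ≤ 2 * |b₀| * (T * (C * (1 + (1 + T ^ 2)))) * (η + κ) := by
    calc _ ≤ 2 * |b₀| * (T * (C * ((1 + (1 + T ^ 2)) * (η + κ)))) := by gcongr
      _ = _ := by ring
  linarith

end MagFrame

end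

noncomputable section

theorem contDiff_pdc_two {X : C(Pt, ℂ)} (v : Pt) (hX : ContDiff ℝ 3 X) :
    ContDiff ℝ 2 (pdc v X) := by
  rw [coe_pdc (hX.of_le (by norm_num))]
  exact (hX.fderiv_right (by norm_num)).clm_apply contDiff_const

theorem pdc_eq_of_hasDerivAt {X : C(Pt, ℂ)} (hX : ContDiff ℝ 1 X) {v x : Pt} {c : ℂ}
    (h : HasDerivAt (fun r : ℝ => X (x + r • v)) c 0) : pdc v X x = c := by
  have h1 : HasDerivAt (fun r : ℝ => x + r • v) ((1 : ℝ) • v) 0 :=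
    ((hasDerivAt_id (0 : ℝ)).smul_const v).const_add x
  have h2 : HasFDerivAt X (fderiv ℝ X x) (x + (0 : ℝ) • v) := by
    rw [zero_smul, add_zero]; exact (hX.differentiable (by simp) x).hasFDerivAt
  rw [pdc_apply hX]
  simpa using (h2.comp_hasDerivAt 0 h1).unique h

theorem pdc_mk {X : C(Pt, ℂ)} (hX : ContDiff ℝ 1 X) (v : Pt) :
    pdc v X = (v.1 : ℂ) • pdc (1, 0) X + (v.2 : ℂ) • pdc (0, 1) X := by
  ext x
  rw [ContinuousMap.add_apply, ContinuousMap.smul_apply, ContinuousMap.smul_apply,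
    pdc_apply hX, pdc_apply hX, pdc_apply hX]
  have : v = v.1 • ((1, 0) : Pt) + v.2 • ((0, 1) : Pt) := by ext <;> simp
  conv_lhs => rw [this, map_add, map_smul, map_smul]
  simp

theorem exists_primitive {J : C(Pt, ℂ)} (hJ : ContDiff ℝ 3 J) (hr : star J = J) {a₁ a₂ : ℝ}
    (ha : a₁ ^ 2 + a₂ ^ 2 = 1) :
    ∃ G : C(Pt, ℂ), ContDiff ℝ 3 G ∧ star G = G ∧ pdc (a₁, a₂) G = J := by
  set σ : Pt → ℝ := fun x => a₁ * x.1 + a₂ * x.2 with hσ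
  set y : Pt → ℝ → Pt := fun x τ =>
    (τ * a₁ - (a₁ * x.2 - a₂ * x.1) * a₂, τ * a₂ + (a₁ * x.2 - a₂ * x.1) * a₁) with hy
  set G : Pt → ℂ := fun x => (σ x : ℂ) * ∫ r in Set.Icc (0 : ℝ) 1, J (y x (r * σ x)) with hG
  have hGs : ContDiff ℝ 3 G := by
    refine ContDiff.mul ?_ ?_
    · have : ContDiff ℝ 3 σ := by simp only [hσ]; fun_prop
      exact Complex.ofRealCLM.contDiff.comp this
    · exact contDiff_setIntegral_of_isCompact (μ := volume) isCompact_Icc 3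
        (F := fun x r => J (y x (r * σ x))) (hJ.comp (by
          simp only [hy, hσ]; fun_prop))
  have hGi : ∀ x, G x = ∫ τ in (0:ℝ)..σ x, J (y x τ) := by
    intro x
    have h1 : ∫ r in Set.Icc (0 : ℝ) 1, J (y x (r * σ x)) = ∫ r in (0:ℝ)..1, J (y x (r * σ x)) := by
      rw [intervalIntegral.integral_of_le zero_le_one, integral_Icc_eq_integral_Ioc]
    have := intervalIntegral.smul_integral_comp_mul_right (fun τ => J (y x τ)) (σ x)
      (a := 0) (b := 1)
    rw [zero_mul, one_mul] at this
    rw [← this, hG, ← h1, Complex.real_smul]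
  refine ⟨⟨G, hGs.continuous⟩, hGs, ?_, ?_⟩
  · ext x
    change (starRingEnd ℂ) (G x) = G x
    simp only [hG, map_mul, Complex.conj_ofReal]
    rw [← integral_conj]
    congr 2
    ext r
    exact DFunLike.congr_fun hr _
  · ext x
    refine pdc_eq_of_hasDerivAt (hGs.of_le (by norm_num)) ?_
    have e : ∀ r : ℝ, G (x + r • ((a₁, a₂) : Pt)) = ∫ τ in (0:ℝ)..(σ x + r), J (y x τ) := by
      intro r
      rw [hGi]
      have e1 : σ (x + r • ((a₁, a₂) : Pt)) = σ x + r := by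
        simp [hσ]; linear_combination r * ha
      have e2 : y (x + r • ((a₁, a₂) : Pt)) = y x := by
        funext τ; simp [hy]; constructor <;> ring_nf <;> simp
      rw [e1, e2]
    change HasDerivAt (fun r : ℝ => G (x + r • ((a₁, a₂) : Pt))) (J x) 0
    simp only [e]
    have hc : Continuous fun τ => J (y x τ) := by
      refine J.continuous.comp ?_; simp only [hy]; fun_prop
    have h1 := (hc.integral_hasStrictDerivAt 0 (σ x + 0)).hasDerivAt
    have h2 := HasDerivAt.scomp (0 : ℝ) (h := fun r => σ x + r) h1
      ((hasDerivAt_id (0 : ℝ)).const_add (σ x))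
    have e3 : y x (σ x + 0) = x := by
      ext
      · simp [hy, hσ]; linear_combination x.1 * ha
      · simp [hy, hσ]; linear_combination x.2 * ha
    rw [e3, one_smul] at h2
    exact h2

/-- `exp (i X)`. -/
def cexpI (X : C(Pt, ℂ)) : C(Pt, ℂ) := ⟨fun x => Complex.exp (Complex.I * X x), by fun_prop⟩

theorem cexpI_apply (X : C(Pt, ℂ)) (x : Pt) : cexpI X x = Complex.exp (Complex.I * X x) := rfl

theorem contDiff_cexpI {X : C(Pt, ℂ)} {n : WithTop ℕ∞} (hX : ContDiff ℝ n X) :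
    ContDiff ℝ n (cexpI X) := (contDiff_const.mul hX).cexp

theorem pdc_cexpI {X : C(Pt, ℂ)} (hX : ContDiff ℝ 1 X) (v : Pt) :
    pdc v (cexpI X) = Complex.I • (pdc v X * cexpI X) := by
  ext x
  have h1 := (((hX.differentiable (by simp) x).hasFDerivAt).const_mul Complex.I).cexp
  have h2 : fderiv ℝ (cexpI X) x = _ := h1.fderiv
  rw [pdc_apply (contDiff_cexpI hX), h2]
  simp [cexpI_apply, pdc_apply hX]
  ring

theorem cexpI_mul_star {X : C(Pt, ℂ)} (hX : star X = X) : cexpI X * star (cexpI X) = 1 := by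
  ext x
  have : (starRingEnd ℂ) (X x) = X x := DFunLike.congr_fun hX x
  change Complex.exp (Complex.I * X x) * (starRingEnd ℂ) (Complex.exp (Complex.I * X x)) = 1
  rw [← Complex.exp_conj, ← Complex.exp_add, map_mul, Complex.conj_I, this]
  simp

/-- The function `x ↦ m ∧ x`. -/
def wedgec (m : ℤ × ℤ) : C(Pt, ℂ) :=
  ⟨fun x => ((wedge ((m.1 : ℝ), (m.2 : ℝ)) x : ℝ) : ℂ), by unfold wedge; fun_prop⟩

theorem contDiff_wedgec (m : ℤ × ℤ) {n : WithTop ℕ∞} : ContDiff ℝ n (wedgec m) := by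
  have : ContDiff ℝ n (fun x : Pt => (m.1 : ℝ) * x.2 - (m.2 : ℝ) * x.1) := by fun_prop
  exact Complex.ofRealCLM.contDiff.comp this

theorem star_wedgec (m : ℤ × ℤ) : star (wedgec m) = wedgec m := by
  ext x; exact Complex.conj_ofReal _

theorem pdc_wedgec (m : ℤ × ℤ) (v : Pt) :
    pdc v (wedgec m) = ((wedge ((m.1 : ℝ), (m.2 : ℝ)) v : ℝ) : ℂ) • 1 := by
  ext x
  refine pdc_eq_of_hasDerivAt (contDiff_wedgec m) ?_
  have h1 : HasDerivAt (fun r : ℝ => wedge ((m.1 : ℝ), (m.2 : ℝ)) x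
      + r * wedge ((m.1 : ℝ), (m.2 : ℝ)) v) (1 * wedge ((m.1 : ℝ), (m.2 : ℝ)) v) 0 :=
    ((hasDerivAt_id (0:ℝ)).mul_const _).const_add _
  refine (h1.ofReal_comp.congr_of_eventuallyEq (Eventually.of_forall fun r => ?_)).congr_deriv ?_
  · simp [wedgec, wedge]; ring
  · simp

/-- The data of a potential `(P, Q)` of the magnetic field `B` with flux `B₀`. -/
structure IsPotential (B₀ : ℝ) (B P Q : C(Pt, ℂ)) : Prop where
  contDiff_P : ContDiff ℝ 3 P
  contDiff_Q : ContDiff ℝ 3 Q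
  real_P : star P = P
  real_Q : star Q = Q
  curl : pdc (1, 0) Q - pdc (0, 1) P = B
  per : IsPeriodic B
  itrans_P : ∀ m : ℤ × ℤ, itrans m P - P = ((-(B₀ / 2) * m.2 : ℝ) : ℂ) • 1
  itrans_Q : ∀ m : ℤ × ℤ, itrans m Q - Q = ((B₀ / 2 * m.1 : ℝ) : ℂ) • 1

namespace IsPotential

variable {B₀ : ℝ} {B P Q G : C(Pt, ℂ)} {a₁ a₂ : ℝ}

theorem pdc_component (hp : IsPotential B₀ B P Q) (ha : a₁ ^ 2 + a₂ ^ 2 = 1)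
    (hG : ContDiff ℝ 3 G) (hGs : pdc (a₁, a₂) G = (a₁ : ℂ) • P + (a₂ : ℂ) • Q) :
    pdc (a₁, a₂) ((-a₂ : ℂ) • P + (a₁ : ℂ) • Q - pdc (-a₂, a₁) G) = B := by
  have hP1 : ContDiff ℝ 1 P := hp.contDiff_P.of_le (by norm_num)
  have hQ1 : ContDiff ℝ 1 Q := hp.contDiff_Q.of_le (by norm_num)
  have hac : (a₁ : ℂ) ^ 2 + (a₂ : ℂ) ^ 2 = 1 := by exact_mod_cast congrArg ((↑) : ℝ → ℂ) ha
  have e : ∀ (c d : ℂ) (v : Pt), pdc v (c • P + d • Q) = c • pdc v P + d • pdc v Q := by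
    intro c d v
    have h1 : ContDiff ℝ 1 ⇑(c • P) := hP1.const_smul c
    have h2 : ContDiff ℝ 1 ⇑(d • Q) := hQ1.const_smul d
    rw [pdc_add h1 h2, pdc_smul hP1, pdc_smul hQ1]
  have hJ : ContDiff ℝ 1 ⇑((-a₂ : ℂ) • P + (a₁ : ℂ) • Q) :=
    (hP1.const_smul (-a₂ : ℂ)).add (hQ1.const_smul (a₁ : ℂ))
  rw [pdc_sub hJ ((contDiff_pdc_two _ hG).of_le (by norm_num)),
    pdc_comm (hG.of_le (by norm_num)), hGs, e, e, pdc_mk hP1, pdc_mk hQ1, pdc_mk hP1 (-a₂, a₁),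
    pdc_mk hQ1 (-a₂, a₁), ← hp.curl]
  ext x
  simp
  linear_combination (pdc (1, 0) Q x - pdc (0, 1) P x) * hac

/-- The frame associated with a potential and a primitive of its component along `(a₁, a₂)`. -/
def frame (hp : IsPotential B₀ B P Q) (ha : a₁ ^ 2 + a₂ ^ 2 = 1) (hG : ContDiff ℝ 3 G)
    (hGr : star G = G) (hGs : pdc (a₁, a₂) G = (a₁ : ℂ) • P + (a₂ : ℂ) • Q) : MagFrame :=
  have hG1 : ContDiff ℝ 1 G := hG.of_le (by norm_num)
  have hdiff : ∀ m v, pdc v (-(itrans m G - G) + ((B₀ / 2 : ℝ) : ℂ) • wedgec m)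
      = pdc v G - itrans m (pdc v G) + (((B₀ / 2 : ℝ) : ℂ) *
        ((wedge ((m.1 : ℝ), (m.2 : ℝ)) v : ℝ) : ℂ)) • 1 := fun m v => by
    have h1 : ContDiff ℝ 1 ⇑(G - itrans m G) := hG1.sub (contDiff_itrans hG1 m)
    have h2 : ContDiff ℝ 1 ⇑(((B₀ / 2 : ℝ) : ℂ) • wedgec m) :=
      (contDiff_wedgec m).const_smul ((B₀ / 2 : ℝ) : ℂ)
    rw [neg_sub, pdc_add h1 h2, pdc_sub hG1 (contDiff_itrans hG1 m), pdc_itrans hG1,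
      pdc_smul (contDiff_wedgec m), pdc_wedgec, smul_smul]
  have hsm : ∀ m, ContDiff ℝ 1 ⇑(-(itrans m G - G) + ((B₀ / 2 : ℝ) : ℂ) • wedgec m) := fun m =>
    ((contDiff_itrans hG1 m).sub hG1).neg.add ((contDiff_wedgec m).const_smul ((B₀ / 2 : ℝ) : ℂ))
  { s := (a₁, a₂)
    t := (-a₂, a₁)
    p := (-a₂ : ℂ) • P + (a₁ : ℂ) • Q - pdc (-a₂, a₁) G
    contDiff_p := ((((hp.contDiff_P.of_le (by norm_num)).const_smul (-a₂ : ℂ)).add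
      ((hp.contDiff_Q.of_le (by norm_num)).const_smul (a₁ : ℂ)))).sub (contDiff_pdc_two _ hG)
    real_p := by
      rw [star_sub, star_add, star_smul, star_smul, hp.real_P, hp.real_Q, ← pdc_star hG1, hGr]
      simp
    χ := fun m => cexpI (-(itrans m G - G) + ((B₀ / 2 : ℝ) : ℂ) • wedgec m)
    contDiff_χ := fun m => contDiff_cexpI (hsm m)
    χ_mul_star := fun m => cexpI_mul_star (by
      rw [star_add, star_neg, star_sub, ← itrans_star, hGr, star_smul, star_wedgec]
      simp)
    pdc_s_χ := fun m => by
      have h1 := hp.itrans_P m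
      have h2 := hp.itrans_Q m
      rw [pdc_cexpI (hsm m), hdiff, hGs, itrans_add, itrans_smul, itrans_smul,
        sub_eq_iff_eq_add.1 h1, sub_eq_iff_eq_add.1 h2]
      ext x
      simp [wedge]
      left
      ring
    pdc_t_χ := fun m => by
      have h1 := hp.itrans_P m
      have h2 := hp.itrans_Q m
      rw [pdc_cexpI (hsm m), hdiff, itrans_sub, itrans_add, itrans_smul, itrans_smul,
        sub_eq_iff_eq_add.1 h1, sub_eq_iff_eq_add.1 h2]
      ext x
      simp [wedge]
      left
      ring
    per_field := by rw [pdc_component hp ha hG hGs]; exact hp.per }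

end IsPotential

end

noncomputable section

/-- `(-i∂_v - P) X`. -/
def covd (v : Pt) (P X : C(Pt, ℂ)) : C(Pt, ℂ) := (-Complex.I) • pdc v X - P * X

theorem covd_add {X Y P : C(Pt, ℂ)} (hX : ContDiff ℝ 1 X) (hY : ContDiff ℝ 1 Y) (v : Pt) :
    covd v P (X + Y) = covd v P X + covd v P Y := by
  rw [covd, covd, covd, pdc_add hX hY]
  ext x
  simp
  ring

theorem covd_smul {X P : C(Pt, ℂ)} (hX : ContDiff ℝ 1 X) (c : ℂ) (v : Pt) :
    covd v P (c • X) = c • covd v P X := by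
  rw [covd, covd, pdc_smul hX, smul_sub, smul_comm, mul_smul_comm]

theorem contDiff_covd {X P : C(Pt, ℂ)} (hX : ContDiff ℝ 2 X) (hP : ContDiff ℝ 1 P) (v : Pt) :
    ContDiff ℝ 1 (covd v P X) :=
  ((contDiff_pdc v hX).const_smul (-Complex.I)).sub (hP.mul (hX.of_le (by norm_num)))

theorem covd_gauge {X P G : C(Pt, ℂ)} (hX : ContDiff ℝ 1 X) (hG : ContDiff ℝ 1 G) (v : Pt) :
    covd v (P - pdc v G) (cexpI (-G) * X) = cexpI (-G) * covd v P X := by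
  have hG' : ContDiff ℝ 1 ⇑(-G) := hG.neg
  have h0 : pdc v (-G) = -pdc v G := by
    have h1 : ∀ X : C(Pt, ℂ), -X = (-1 : ℂ) • X := fun X => by ext x; simp
    rw [h1, h1, pdc_smul hG]
  rw [covd, covd, pdc_mul (contDiff_cexpI hG') hX, pdc_cexpI hG', h0]
  ext x
  simp
  linear_combination (pdc v G x * cexpI (-G) x * X x) * Complex.I_sq

theorem norm_cexpI {X : C(Pt, ℂ)} (hX : star X = X) (x : Pt) : ‖cexpI X x‖ = 1 := by
  have h1 : (starRingEnd ℂ) (X x) = X x := DFunLike.congr_fun hX x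
  obtain ⟨r, hr⟩ := Complex.conj_eq_iff_real.1 h1
  rw [cexpI_apply, hr, mul_comm, Complex.norm_exp_ofReal_mul_I]

theorem nrm_congr {X Y : C(Pt, ℂ)} (h : ∀ x, ‖X x‖ = ‖Y x‖) : nrm X = nrm Y := by
  simp only [nrm, h]

namespace IsPotential

variable {B₀ : ℝ} {B P Q G : C(Pt, ℂ)} {a₁ a₂ : ℝ}

theorem quasimode (hp : IsPotential B₀ B P Q) (ha : a₁ ^ 2 + a₂ ^ 2 = 1) (hG : ContDiff ℝ 3 G)
    (hGr : star G = G) (hGs : pdc (a₁, a₂) G = (a₁ : ℂ) • P + (a₂ : ℂ) • Q) {h ε : ℝ}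
    {U R : C(Pt, ℂ)} (hU : ContDiff ℝ 2 U) (hh : 0 < h) (hh1 : h ≤ 1) (hε : ε ≤ 1)
    (hcov : ∀ m, itrans m U = cexpI (((B₀ / 2 : ℝ) : ℂ) • wedgec m) * U) (hU1 : nrm U = 1)
    (hR : R = ((h ^ 2 : ℝ) : ℂ) • (covd (1, 0) P (covd (1, 0) P U)
      + covd (0, 1) Q (covd (0, 1) Q U)) - U) (hRε : nrm R ≤ ε) :
    (hp.frame ha hG hGr hGs).Quasimode h ε (cexpI (-G) * U) (cexpI (-G) * R) := by
  have hG1 : ContDiff ℝ 1 G := hG.of_le (by norm_num)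
  have hU1' : ContDiff ℝ 1 U := hU.of_le (by norm_num)
  have hP1 : ContDiff ℝ 1 P := hp.contDiff_P.of_le (by norm_num)
  have hQ1 : ContDiff ℝ 1 Q := hp.contDiff_Q.of_le (by norm_num)
  have ha' : (a₁ : ℂ) ^ 2 + (a₂ : ℂ) ^ 2 = 1 := by exact_mod_cast congrArg ((↑) : ℝ → ℂ) ha
  have hGr' : star (-G) = -G := by rw [star_neg, hGr]
  have hn : ∀ X : C(Pt, ℂ), nrm (cexpI (-G) * X) = nrm X := fun X => nrm_congr fun x => by
    rw [ContinuousMap.mul_apply, norm_mul, norm_cexpI hGr', one_mul]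
  set M := hp.frame ha hG hGr hGs
  have hD : ∀ X : C(Pt, ℂ), ContDiff ℝ 1 X → M.D h (cexpI (-G) * X)
      = (h : ℂ) • (cexpI (-G) * ((a₁ : ℂ) • covd (1, 0) P X + (a₂ : ℂ) • covd (0, 1) Q X)) := by
    intro X hX
    have h1 := covd_gauge (P := pdc (a₁, a₂) G) hX hG1 (a₁, a₂)
    rw [sub_self, covd, covd, zero_mul, sub_zero, pdc_mk hX, hGs] at h1
    have h2 : M.D h (cexpI (-G) * X)
        = (h : ℂ) • ((-Complex.I) • pdc (a₁, a₂) (cexpI (-G) * X)) := by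
      rw [smul_smul, mul_neg, mul_comm (h : ℂ)]; rfl
    rw [h2, h1]
    ext x
    simp [covd]
    ring_nf
    simp
  have hV : ∀ X : C(Pt, ℂ), ContDiff ℝ 1 X → M.V h (cexpI (-G) * X)
      = (h : ℂ) • (cexpI (-G) * ((-a₂ : ℂ) • covd (1, 0) P X + (a₁ : ℂ) • covd (0, 1) Q X)) := by
    intro X hX
    have h1 := covd_gauge (P := (-a₂ : ℂ) • P + (a₁ : ℂ) • Q) hX hG1 (-a₂, a₁)
    rw [covd, covd, pdc_mk hX] at h1
    have h2 : M.V h (cexpI (-G) * X) = (h : ℂ) • ((-Complex.I) • pdc (-a₂, a₁) (cexpI (-G) * X)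
        - ((-a₂ : ℂ) • P + (a₁ : ℂ) • Q - pdc (-a₂, a₁) G) * (cexpI (-G) * X)) := by
      rw [smul_sub, smul_smul, mul_neg, mul_comm (h : ℂ)]; rfl
    rw [h2, h1]
    ext x
    simp [covd]
    ring_nf
    simp
  have hX1 := contDiff_covd hU hP1 (1, 0)
  have hX2 := contDiff_covd hU hQ1 (0, 1)
  have hlin : ∀ (c d : ℂ) (v : Pt) (P' : C(Pt, ℂ)),
      covd v P' (c • covd (1, 0) P U + d • covd (0, 1) Q U)
        = c • covd v P' (covd (1, 0) P U) + d • covd v P' (covd (0, 1) Q U) := by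
    intro c d v P'
    have h1 : ContDiff ℝ 1 ⇑(c • covd (1, 0) P U) := hX1.const_smul c
    have h2 : ContDiff ℝ 1 ⇑(d • covd (0, 1) Q U) := hX2.const_smul d
    rw [covd_add h1 h2, covd_smul hX1, covd_smul hX2]
  have hsm : ∀ c d : ℂ, ContDiff ℝ 1 ⇑(c • covd (1, 0) P U + d • covd (0, 1) Q U) := fun c d =>
    (hX1.const_smul c).add (hX2.const_smul d)
  have hE : ∀ c d : ℂ, ContDiff ℝ 1 ⇑(cexpI (-G) * (c • covd (1, 0) P U + d • covd (0, 1) Q U)) :=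
    fun c d => (contDiff_cexpI hG1.neg).mul (hsm c d)
  have hDs : ∀ (c : ℂ) {X : C(Pt, ℂ)}, ContDiff ℝ 1 X → M.D h (c • X) = c • M.D h X :=
    fun c X hX => by rw [MagFrame.D, MagFrame.D, pdc_smul hX, smul_comm]
  have hVs : ∀ (c : ℂ) {X : C(Pt, ℂ)}, ContDiff ℝ 1 X → M.V h (c • X) = c • M.V h X :=
    fun c X hX => by
      rw [MagFrame.V, MagFrame.V, pdc_smul hX]
      ext x
      simp
      ring
  refine ⟨(contDiff_cexpI (hG.of_le (by norm_num)).neg).mul hU, fun m => ?_, ?_, hh, hh1, hε,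
    (hn U).trans hU1, (hn R).trans_le hRε⟩
  · rw [itrans_mul, hcov]
    ext x
    change Complex.exp (Complex.I * -(itrans m G x)) * (Complex.exp (Complex.I * _) * U x)
      = Complex.exp (Complex.I * (-(itrans m G x - G x) + _))
        * (Complex.exp (Complex.I * -(G x)) * U x)
    rw [← mul_assoc, ← mul_assoc, ← Complex.exp_add, ← Complex.exp_add]
    congr 2
    ring
  · rw [hD U hU1', hV U hU1', hDs _ (hE _ _), hVs _ (hE _ _), hD _ (hsm _ _), hV _ (hsm _ _)]
    simp only [hlin]
    rw [hR]
    ext x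
    simp
    linear_combination (-(h : ℂ) ^ 2 * cexpI (-G) x * (covd (1, 0) P (covd (1, 0) P U) x
      + covd (0, 1) Q (covd (0, 1) Q U) x)) * ha'

end IsPotential

end

noncomputable section

theorem pdc_smul_dir {X : C(Pt, ℂ)} (hX : ContDiff ℝ 1 X) (c : ℝ) (v : Pt) :
    pdc (c • v) X = (c : ℂ) • pdc v X := by
  ext x
  rw [ContinuousMap.smul_apply, pdc_apply hX, pdc_apply hX, map_smul]
  simp

theorem contDiff_weighted_average {X : C(Pt, ℂ)} {n : ℕ} (hX : ContDiff ℝ n X) (v : Pt)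
    {w : ℝ → ℂ} (hw : ContDiff ℝ n w) :
    ContDiff ℝ n fun x => ∫ r in Set.Icc (0 : ℝ) 1, w r * X (x + r • v) := by
  refine contDiff_setIntegral_of_isCompact (μ := volume) isCompact_Icc n
    (F := fun (x : Pt) (r : ℝ) => w r * X (x + r • v)) ?_
  exact (hw.comp contDiff_snd).mul (hX.comp (by fun_prop))

/-- The average of `X (x + r v)` over `r ∈ [0, 1]`, with weight `w`. -/
def wavg (w : C(ℝ, ℂ)) (v : Pt) (X : C(Pt, ℂ)) : C(Pt, ℂ) :=
  ⟨fun x => ∫ r in Set.Icc (0 : ℝ) 1, w r * X (x + r • v),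
    (contDiff_weighted_average (n := 0) (contDiff_zero.2 X.continuous) v
      (contDiff_zero.2 w.continuous)).continuous⟩

theorem wavg_apply (w : C(ℝ, ℂ)) (v : Pt) (X : C(Pt, ℂ)) (x : Pt) :
    wavg w v X x = ∫ r in (0:ℝ)..1, w r * X (x + r • v) := by
  rw [intervalIntegral.integral_of_le zero_le_one, ← integral_Icc_eq_integral_Ioc]; rfl

theorem contDiff_wavg {w : C(ℝ, ℂ)} {X : C(Pt, ℂ)} (hX : ContDiff ℝ 1 X) (hw : ContDiff ℝ 1 w)
    (v : Pt) : ContDiff ℝ 1 (wavg w v X) := by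
  have := contDiff_weighted_average (n := 1) (X := X) (by simpa using hX) v
    (w := w) (by simpa using hw)
  rw [Nat.cast_one] at this
  exact this

theorem coef_wavg {w : C(ℝ, ℂ)} {X : C(Pt, ℂ)} {n : ℕ} (hX : Coef n X) (hw : ContDiff ℝ n w)
    (hwr : star w = w) (v : Pt) : Coef n (wavg w v X) := by
  refine ⟨contDiff_weighted_average hX.contDiff v hw, fun m x => ?_, ?_⟩
  · rw [wavg_apply, wavg_apply]
    congr 1; ext r
    rw [← hX.per m (x + r • v)]
    congr 2
    ext <;> simp <;> ring
  · ext x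
    change (starRingEnd ℂ) (∫ r in Set.Icc (0 : ℝ) 1, w r * X (x + r • v)) = _
    rw [← integral_conj]
    change _ = ∫ r in Set.Icc (0 : ℝ) 1, w r * X (x + r • v)
    congr 1; ext r
    rw [map_mul]
    congr 1
    · exact DFunLike.congr_fun hwr r
    · exact DFunLike.congr_fun hX.real _

/-- The weight `r`. -/
def idWeight : C(ℝ, ℂ) := ⟨fun r => (r : ℂ), by fun_prop⟩

theorem contDiff_idWeight {n : WithTop ℕ∞} : ContDiff ℝ n idWeight := Complex.ofRealCLM.contDiff

theorem star_idWeight : star idWeight = idWeight := by ext r; exact Complex.conj_ofReal r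

theorem periodic_along {X : C(Pt, ℂ)} {v : Pt} (hv : ∀ x, X (x + v) = X x) (x : Pt) :
    Function.Periodic (fun r : ℝ => X (x + r • v)) 1 := fun r => by
  simp only
  rw [← hv (x + r • v)]
  congr 1
  rw [add_smul, one_smul, add_assoc]

theorem wavg_one_add_smul {X : C(Pt, ℂ)} {v : Pt} (hv : ∀ x, X (x + v) = X x) (x : Pt) (ℓ : ℝ) :
    wavg 1 v X (x + ℓ • v) = wavg 1 v X x := by
  have h1 : ∀ r : ℝ, x + ℓ • v + r • v = x + (r + ℓ) • v := fun r => by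
    rw [add_smul, add_comm (r • v), add_assoc]
  rw [wavg_apply, wavg_apply]
  simp only [ContinuousMap.one_apply, one_mul, h1]
  rw [intervalIntegral.integral_comp_add_right (fun r : ℝ => X (x + r • v)) ℓ, zero_add,
    add_comm 1 ℓ, (periodic_along hv x).intervalIntegral_add_eq ℓ 0, zero_add]

theorem pdc_wavg_idWeight {X : C(Pt, ℂ)} {v : Pt} (hX : ContDiff ℝ 1 X)
    (hv : ∀ x, X (x + v) = X x) : pdc v (wavg idWeight v X) = X - wavg 1 v X := by
  ext x
  refine pdc_eq_of_hasDerivAt (contDiff_wavg hX contDiff_idWeight v) ?_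
  set φ : ℝ → ℂ := fun r => X (x + r • v) with hφ
  have hφc : Continuous φ := by fun_prop
  have hrc : Continuous fun r : ℝ => (r : ℂ) * φ r := by fun_prop
  have e : ∀ ℓ : ℝ, wavg idWeight v X (x + ℓ • v)
      = (∫ r in (0:ℝ)..(1 + ℓ), (r : ℂ) * φ r) - (∫ r in (0:ℝ)..ℓ, (r : ℂ) * φ r)
        - (ℓ : ℂ) * wavg 1 v X x := by
    intro ℓ
    have h1 : ∀ r : ℝ, x + ℓ • v + r • v = x + (r + ℓ) • v := fun r => by
      rw [add_smul, add_comm (r • v), add_assoc]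
    have h2 := intervalIntegral.integral_comp_add_right (a := 0) (b := 1)
      (fun r : ℝ => (r : ℂ) * φ r) ℓ
    rw [zero_add] at h2
    rw [wavg_apply, ← wavg_one_add_smul hv x ℓ, wavg_apply,
      intervalIntegral.integral_interval_sub_left (hrc.intervalIntegrable _ _)
        (hrc.intervalIntegrable _ _), ← intervalIntegral.integral_const_mul, ← h2,
      ← intervalIntegral.integral_sub]
    · congr 1; ext r
      simp only [h1, idWeight, ContinuousMap.coe_mk, hφ, ContinuousMap.one_apply]
      push_cast; ring
    · refine Continuous.intervalIntegrable ?_ _ _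
      fun_prop
    · refine Continuous.intervalIntegrable ?_ _ _
      fun_prop
  simp only [e]
  have d1 := HasDerivAt.scomp (0 : ℝ) (h := fun r => 1 + r)
    (hrc.integral_hasStrictDerivAt 0 (1 + 0)).hasDerivAt
    ((hasDerivAt_id (0 : ℝ)).const_add (1 : ℝ))
  have d2 := (hrc.integral_hasStrictDerivAt 0 0).hasDerivAt
  have d3 := (Complex.ofRealCLM.hasDerivAt (x := (0 : ℝ))).mul_const (wavg 1 v X x)
  refine ((d1.sub d2).sub d3).congr_deriv ?_
  simp [hφ, hv]

/-- The direction `e^⊥`. -/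
def perp (e : ℤ × ℤ) : Pt := (-(e.2 : ℝ), (e.1 : ℝ))

theorem IsPeriodic.add_perp {E : Type*} {X : Pt → E} (hX : IsPeriodic X) (e : ℤ × ℤ) (x : Pt) :
    X (x + perp e) = X x := by
  rw [← hX (-e.2, e.1) x]
  congr 1
  ext <;> simp [perp]

theorem exists_eq_add_perp {e : ℤ × ℤ} (he : Int.gcd e.1 e.2 = 1) {x y : Pt} {k : ℤ}
    (h : (e.1 : ℝ) * (y.1 - x.1) + e.2 * (y.2 - x.2) = k) :
    ∃ (m : ℤ × ℤ) (c : ℝ), y = ((x + c • perp e).1 + m.1, (x + c • perp e).2 + m.2) := by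
  have hb := Int.gcd_eq_gcd_ab e.1 e.2
  rw [he] at hb
  set p := Int.gcdA e.1 e.2
  set q := Int.gcdB e.1 e.2
  have hbr : (1 : ℝ) = e.1 * p + e.2 * q := by exact_mod_cast hb
  have hN : (e.1 : ℝ) ^ 2 + (e.2 : ℝ) ^ 2 ≠ 0 := by
    intro h0
    have h1 : (e.1 : ℝ) = 0 := by nlinarith [sq_nonneg (e.1 : ℝ), sq_nonneg (e.2 : ℝ)]
    have h2 : (e.2 : ℝ) = 0 := by nlinarith [sq_nonneg (e.1 : ℝ), sq_nonneg (e.2 : ℝ)]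
    rw [h1, h2] at hbr; norm_num at hbr
  refine ⟨(k * p, k * q), (-(e.2 : ℝ) * (y.1 - x.1 - k * p) + e.1 * (y.2 - x.2 - k * q))
    / ((e.1 : ℝ) ^ 2 + (e.2 : ℝ) ^ 2), ?_⟩
  ext
  · simp only [perp, Prod.fst_add, Prod.smul_fst, smul_eq_mul]
    push_cast
    field_simp
    linear_combination (e.1 : ℝ) * h + k * e.1 * hbr
  · simp only [perp, Prod.snd_add, Prod.smul_snd, smul_eq_mul]
    push_cast
    field_simp
    linear_combination (e.2 : ℝ) * h + k * e.2 * hbr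

theorem wavg_one_eq {e : ℤ × ℤ} (he : Int.gcd e.1 e.2 = 1) {X : C(Pt, ℂ)} (hX : IsPeriodic X)
    {x y : Pt} {k : ℤ} (h : (e.1 : ℝ) * (y.1 - x.1) + e.2 * (y.2 - x.2) = k) :
    wavg 1 (perp e) X y = wavg 1 (perp e) X x := by
  obtain ⟨m, c, rfl⟩ := exists_eq_add_perp he h
  rw [← wavg_one_add_smul (hX.add_perp e) x c]
  rw [wavg_apply, wavg_apply]
  congr 1; ext r
  rw [← hX m (x + c • perp e + r • perp e)]
  congr 2
  ext <;> simp <;> ring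

end

noncomputable section

theorem isOpenQuotientMap_proj2 : IsOpenQuotientMap proj2 :=
  (QuotientAddGroup.isOpenQuotientMap_mk (G := ℝ) (N := AddSubgroup.zmultiples (1:ℝ))).prodMap
    (QuotientAddGroup.isOpenQuotientMap_mk (G := ℝ) (N := AddSubgroup.zmultiples (1:ℝ)))

theorem exists_int_of_proj2_eq {x y : Pt} (h : proj2 x = proj2 y) :
    ∃ m : ℤ × ℤ, y = (x.1 + m.1, x.2 + m.2) := by
  have h1 : ∀ a b : ℝ, (a : UnitAddCircle) = b → ∃ m : ℤ, b = a + m := by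
    intro a b hab
    obtain ⟨m, hm⟩ := AddSubgroup.mem_zmultiples_iff.1 (QuotientAddGroup.eq.1 hab)
    refine ⟨m, ?_⟩
    simp only [zsmul_eq_mul, mul_one] at hm
    linarith
  obtain ⟨m₁, hm₁⟩ := h1 _ _ (congrArg Prod.fst h)
  obtain ⟨m₂, hm₂⟩ := h1 _ _ (congrArg Prod.snd h)
  exact ⟨(m₁, m₂), Prod.ext hm₁ hm₂⟩

/-- The function on the torus induced by a periodic function on the plane. -/
def lift (k : C(Pt, ℂ)) (p : T2) : ℂ := k (Function.surjInv isOpenQuotientMap_proj2.surjective p)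

theorem lift_proj2 {k : C(Pt, ℂ)} (hk : IsPeriodic k) (x : Pt) : lift k (proj2 x) = k x := by
  obtain ⟨m, hm⟩ := exists_int_of_proj2_eq
    (Function.surjInv_eq isOpenQuotientMap_proj2.surjective (proj2 x))
  conv_rhs => rw [hm]
  exact (hk m _).symm

theorem continuous_lift {k : C(Pt, ℂ)} (hk : IsPeriodic k) : Continuous (lift k) := by
  rw [isOpenQuotientMap_proj2.isQuotientMap.continuous_iff]
  refine k.continuous.congr fun x => ?_
  exact (lift_proj2 hk x).symm

/-- The `L²(ν)` norm of the function induced on the torus. -/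
def tnrm (ν : Measure T2) (k : C(Pt, ℂ)) : ℝ := Real.sqrt (∫ p, ‖lift k p‖ ^ 2 ∂ν)

section WeakLimit

variable {ν : Measure T2} {u : ℕ → Pt → ℂ} {U : ℕ → C(Pt, ℂ)}

theorem tendsto_ip (hw : ∀ f : T2 → ℂ, Continuous f →
      Tendsto (fun n => ∫ x in fund, f (proj2 x) * ((‖u n x‖ ^ 2 : ℝ) : ℂ)) atTop
        (𝓝 (∫ p, f p ∂ν))) (hU : ∀ n x, ‖U n x‖ = ‖u n x‖) {k : C(Pt, ℂ)} (hk : IsPeriodic k) :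
    Tendsto (fun n => ip (k * U n) (U n)) atTop (𝓝 (∫ p, lift k p ∂ν)) := by
  refine (hw _ (continuous_lift hk)).congr fun n => ?_
  rw [ip_def]
  congr 1; ext x
  rw [lift_proj2 hk, ContinuousMap.mul_apply, mul_assoc, Complex.mul_conj,
    Complex.normSq_eq_norm_sq, hU]

theorem tendsto_nrm (hw : ∀ f : T2 → ℂ, Continuous f →
      Tendsto (fun n => ∫ x in fund, f (proj2 x) * ((‖u n x‖ ^ 2 : ℝ) : ℂ)) atTop
        (𝓝 (∫ p, f p ∂ν))) (hU : ∀ n x, ‖U n x‖ = ‖u n x‖) {k : C(Pt, ℂ)} (hk : IsPeriodic k) :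
    Tendsto (fun n => nrm (k * U n)) atTop (𝓝 (tnrm ν k)) := by
  have hk' : IsPeriodic ⇑(star k * k) := IsPeriodic.mul (fun m x => by
    change (starRingEnd ℂ) _ = (starRingEnd ℂ) _
    rw [hk m x]) hk
  have h1 := (Complex.continuous_re.tendsto _).comp (tendsto_ip hw hU hk')
  have e1 : ∀ p, lift (star k * k) p = ((‖lift k p‖ ^ 2 : ℝ) : ℂ) := fun p => by
    rw [← Complex.normSq_eq_norm_sq, Complex.normSq_eq_conj_mul_self]; rfl
  have e2 : (∫ p, lift (star k * k) p ∂ν).re = ∫ p, ‖lift k p‖ ^ 2 ∂ν := by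
    simp only [e1]
    rw [integral_complex_ofReal, Complex.ofReal_re]
  rw [e2] at h1
  refine (Real.continuous_sqrt.tendsto _ |>.comp h1).congr fun n => ?_
  have e3 : ip (star k * k * U n) (U n) = ip (k * U n) (k * U n) := by
    simp only [ip, star_mul]; congr 1; ring
  simp only [Function.comp_apply]
  rw [e3, ip_self, Complex.ofReal_re, Real.sqrt_sq (nrm_nonneg _)]

end WeakLimit

theorem tendsto_tnrm_zero {ι : Type} {l : Filter ι} [l.IsCountablyGenerated] {ν : Measure T2}
    [IsFiniteMeasure ν] {k : ι → C(Pt, ℂ)} (hk : ∀ i, IsPeriodic (k i)) {K : ℝ}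
    (hK : ∀ᶠ i in l, ∀ x, ‖k i x‖ ≤ K) (h0 : ∀ x, Tendsto (fun i => k i x) l (𝓝 0)) :
    Tendsto (fun i => tnrm ν (k i)) l (𝓝 0) := by
  have h1 : Tendsto (fun i => ∫ p, ‖lift (k i) p‖ ^ 2 ∂ν) l (𝓝 (∫ _, (0:ℝ) ∂ν)) := by
    refine tendsto_integral_filter_of_dominated_convergence (fun _ => K ^ 2) ?_ ?_
      (integrable_const _) ?_
    · exact Eventually.of_forall fun i =>
        ((continuous_lift (hk i)).norm.pow 2).aestronglyMeasurable
    · filter_upwards [hK] with i hi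
      refine Eventually.of_forall fun p => ?_
      rw [Real.norm_of_nonneg (by positivity)]
      exact pow_le_pow_left₀ (norm_nonneg _) (hi _) 2
    · refine Eventually.of_forall fun p => ?_
      have := ((h0 (Function.surjInv isOpenQuotientMap_proj2.surjective p)).norm).pow 2
      simpa [lift] using this
  rw [integral_zero] at h1
  have := (Real.continuous_sqrt.tendsto _).comp h1
  rw [Real.sqrt_zero] at this
  exact this

end

noncomputable section

theorem MagFrame.limit_estimate {M : MagFrame} {f g b f₁ : C(Pt, ℂ)} (hf : Coef 2 f)
    (hg : Coef 2 g) (hb : Coef 2 b) (hf₁ : Coef 2 f₁) (hft : pdc M.t f = 0)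
    (hgt : pdc M.t g = M.field - b) (hf₁t : pdc M.t f₁ = 0) (b₀ : ℝ) {T : ℝ} (hT : 0 < T)
    {ν : Measure T2} {u : ℕ → Pt → ℂ} {U R : ℕ → C(Pt, ℂ)} {κ η : ℕ → ℝ}
    (hw : ∀ f : T2 → ℂ, Continuous f →
      Tendsto (fun n => ∫ x in fund, f (proj2 x) * ((‖u n x‖ ^ 2 : ℝ) : ℂ)) atTop
        (𝓝 (∫ p, f p ∂ν))) (hU : ∀ n x, ‖U n x‖ = ‖u n x‖)
    (hκ : ∀ n, 0 < κ n) (hκ0 : Tendsto κ atTop (𝓝 0)) (hη0 : Tendsto η atTop (𝓝 0))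
    (hq : ∀ᶠ n in atTop, M.Quasimode (κ n ^ 2) (η n * κ n ^ 3) (U n) (R n)) :
    |b₀| * ‖∫ p, lift f p ∂ν‖ ≤ 8 / T ^ 2 * tnrm ν (pdc M.s f)
      + 2 * tnrm ν (f * b - (b₀ : ℂ) • f) + |b₀| * (4 * tnrm ν (f - pdc M.s f₁)
        + 4 * M.bd * T ^ 2 * tnrm ν f₁) := by
  obtain ⟨C, hC⟩ := M.exists_scaled_estimate hf hg hb hf₁ hft hgt hf₁t b₀ hT
  have p3 : IsPeriodic ⇑(f * b - (b₀ : ℂ) • f) := fun m x => by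
    simp only [ContinuousMap.sub_apply, ContinuousMap.mul_apply, ContinuousMap.smul_apply,
      hf.per m x, hb.per m x]
  have l1 := (tendsto_ip hw hU hf.per).norm.const_mul |b₀|
  have l2 := tendsto_nrm hw hU (hf.dir M.s).per
  have l3 := tendsto_nrm hw hU p3
  have l4 := tendsto_nrm hw hU ((hf.of_le (by norm_num)).sub (hf₁.dir M.s)).per
  have l5 := tendsto_nrm hw hU hf₁.per
  have l6 := (hη0.add hκ0).const_mul C
  have l7 := (((l2.const_mul (8 / T ^ 2)).add (l3.const_mul 2)).add
    (((l4.const_mul 4).add (l5.const_mul (4 * M.bd * T ^ 2))).const_mul |b₀|)).add l6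
  rw [add_zero, mul_zero, add_zero] at l7
  refine le_of_tendsto_of_tendsto l1 l7 ?_
  have hκT : Tendsto (fun n => κ n * T) atTop (𝓝 0) := by simpa using hκ0.mul_const T
  filter_upwards [hq, hκ0.eventually_le_const one_pos, hκT.eventually_le_const one_pos]
    with n h1 h2 h3
  exact hC (hκ n) h2 h3 h1

theorem tnrm_smul {ν : Measure T2} (c : ℂ) (k : C(Pt, ℂ)) : tnrm ν (c • k) = ‖c‖ * tnrm ν k := by
  have h1 : ∀ p, ‖lift (c • k) p‖ ^ 2 = ‖c‖ ^ 2 * ‖lift k p‖ ^ 2 := fun p => by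
    rw [← mul_pow, ← norm_mul]; rfl
  simp only [tnrm, h1]
  rw [integral_const_mul, Real.sqrt_mul (by positivity), Real.sqrt_sq (norm_nonneg _)]

/-- The phase `2 π e · (x - x₀)`. -/
def ang (e : ℤ × ℤ) (x₀ x : Pt) : ℝ := 2 * π * (e.1 * (x.1 - x₀.1) + e.2 * (x.2 - x₀.2))

/-- The function `φ` of the phase `2 π e · (x - x₀)`. -/
def wave (e : ℤ × ℤ) (x₀ : Pt) (φ : C(ℝ, ℝ)) : C(Pt, ℂ) :=
  ⟨fun x => (φ (ang e x₀ x) : ℂ), by unfold ang; fun_prop⟩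

theorem wave_apply (e : ℤ × ℤ) (x₀ : Pt) (φ : C(ℝ, ℝ)) (x : Pt) :
    wave e x₀ φ x = (φ (ang e x₀ x) : ℂ) := rfl

theorem coef_wave (e : ℤ × ℤ) (x₀ : Pt) {φ : C(ℝ, ℝ)} {n : WithTop ℕ∞} (hφ : ContDiff ℝ n φ)
    (hp : Function.Periodic φ (2 * π)) : Coef n (wave e x₀ φ) := by
  refine ⟨?_, fun m x => ?_, ?_⟩
  · have h1 : ContDiff ℝ n (ang e x₀) := by unfold ang; fun_prop
    exact Complex.ofRealCLM.contDiff.comp (hφ.comp h1)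
  · have h1 : ang e x₀ (x.1 + m.1, x.2 + m.2)
        = ang e x₀ x + (e.1 * m.1 + e.2 * m.2 : ℤ) * (2 * π) := by
      simp only [ang]; push_cast; ring
    rw [wave_apply, wave_apply, h1, hp.int_mul]
  · ext x; exact Complex.conj_ofReal _

theorem pdc_wave (e : ℤ × ℤ) (x₀ : Pt) {φ φ' : C(ℝ, ℝ)} (hφ : ContDiff ℝ 1 φ)
    (h : ∀ θ, HasDerivAt φ (φ' θ) θ) (v : Pt) :
    pdc v (wave e x₀ φ) = ((2 * π * (e.1 * v.1 + e.2 * v.2) : ℝ) : ℂ) • wave e x₀ φ' := by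
  have h0 : ContDiff ℝ 1 (ang e x₀) := by unfold ang; fun_prop
  ext x
  refine pdc_eq_of_hasDerivAt (Complex.ofRealCLM.contDiff.comp (hφ.comp h0)) ?_
  have h1 : HasDerivAt (fun r : ℝ => ang e x₀ x + r * (2 * π * (e.1 * v.1 + e.2 * v.2)))
      (1 * (2 * π * (e.1 * v.1 + e.2 * v.2))) 0 :=
    ((hasDerivAt_id (0:ℝ)).mul_const _).const_add _
  have h2 := (HasDerivAt.scomp (0:ℝ) (h _) h1).ofReal_comp
  refine (h2.congr_of_eventuallyEq (Eventually.of_forall fun r => ?_)).congr_deriv ?_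
  · simp only [wave_apply, Function.comp_apply]
    congr 2
    simp [ang]; ring
  · simp [wave_apply]

end

noncomputable section

theorem sq_add_one_sub_cos_pos {δ : ℝ} (hδ : 0 < δ) (θ : ℝ) : 0 < δ ^ 2 + 1 - Real.cos θ := by
  nlinarith [Real.cos_le_one θ, pow_pos hδ 2]

/-- A cutoff concentrating at `2 π ℤ` as `δ → 0`. -/
def bump {δ : ℝ} (hδ : 0 < δ) : C(ℝ, ℝ) :=
  ⟨fun θ => δ ^ 2 / (δ ^ 2 + 1 - Real.cos θ),
    Continuous.div (by fun_prop) (by fun_prop) fun θ => ne_of_gt (sq_add_one_sub_cos_pos hδ θ)⟩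

/-- The derivative of `bump`. -/
def bumpDeriv {δ : ℝ} (hδ : 0 < δ) : C(ℝ, ℝ) :=
  ⟨fun θ => -(δ ^ 2 * Real.sin θ) / (δ ^ 2 + 1 - Real.cos θ) ^ 2,
    Continuous.div (by fun_prop) (by fun_prop) fun θ =>
      ne_of_gt (pow_pos (sq_add_one_sub_cos_pos hδ θ) 2)⟩

/-- An odd function whose slope is close to `bump` near `2 π ℤ`. -/
def ramp {δ : ℝ} (hδ : 0 < δ) : C(ℝ, ℝ) :=
  ⟨fun θ => δ ^ 2 * Real.sin θ / (δ ^ 2 + 1 - Real.cos θ),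
    Continuous.div (by fun_prop) (by fun_prop) fun θ => ne_of_gt (sq_add_one_sub_cos_pos hδ θ)⟩

/-- The derivative of `ramp`. -/
def rampDeriv {δ : ℝ} (hδ : 0 < δ) : C(ℝ, ℝ) :=
  ⟨fun θ => δ ^ 2 * (Real.cos θ * (δ ^ 2 + 1 - Real.cos θ) - Real.sin θ ^ 2)
      / (δ ^ 2 + 1 - Real.cos θ) ^ 2,
    Continuous.div (by fun_prop) (by fun_prop) fun θ =>
      ne_of_gt (pow_pos (sq_add_one_sub_cos_pos hδ θ) 2)⟩

section Cutoff

variable {δ : ℝ} (hδ : 0 < δ)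

theorem contDiff_bump {n : WithTop ℕ∞} : ContDiff ℝ n (bump hδ) :=
  ContDiff.div (by fun_prop) ((contDiff_const.sub Real.contDiff_cos)) fun θ =>
    (sq_add_one_sub_cos_pos hδ θ).ne'

theorem contDiff_ramp {n : WithTop ℕ∞} : ContDiff ℝ n (ramp hδ) :=
  ContDiff.div (contDiff_const.mul Real.contDiff_sin) ((contDiff_const.sub Real.contDiff_cos))
    fun θ => (sq_add_one_sub_cos_pos hδ θ).ne'

theorem periodic_bump : Function.Periodic (bump hδ) (2 * π) := fun θ => by simp [bump]

theorem periodic_ramp : Function.Periodic (ramp hδ) (2 * π) := fun θ => by simp [ramp]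

theorem hasDerivAt_bump (θ : ℝ) : HasDerivAt (bump hδ) (bumpDeriv hδ θ) θ := by
  refine ((hasDerivAt_const θ (δ ^ 2)).div ((Real.hasDerivAt_cos θ).const_sub (δ ^ 2 + 1))
    (sq_add_one_sub_cos_pos hδ θ).ne').congr_deriv ?_
  simp [bumpDeriv]

theorem hasDerivAt_ramp (θ : ℝ) : HasDerivAt (ramp hδ) (rampDeriv hδ θ) θ := by
  refine (((Real.hasDerivAt_sin θ).const_mul (δ ^ 2)).div
    ((Real.hasDerivAt_cos θ).const_sub (δ ^ 2 + 1))
    (sq_add_one_sub_cos_pos hδ θ).ne').congr_deriv ?_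
  simp only [rampDeriv, ContinuousMap.coe_mk]
  ring

theorem abs_bump_le (θ : ℝ) : |bump hδ θ| ≤ 1 := by
  have hd := sq_add_one_sub_cos_pos hδ θ
  simp only [bump, ContinuousMap.coe_mk]
  rw [abs_of_nonneg (by positivity), div_le_one hd]
  linarith [Real.cos_le_one θ]

theorem mul_abs_sin_le (θ : ℝ) : δ * |Real.sin θ| ≤ 3 / 2 * (δ ^ 2 + 1 - Real.cos θ) := by
  have h1 : Real.sin θ ^ 2 ≤ 2 * (1 - Real.cos θ) := by
    nlinarith [Real.sin_sq_add_cos_sq θ, Real.cos_le_one θ, Real.neg_one_le_cos θ]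
  nlinarith [sq_nonneg (δ - |Real.sin θ|), sq_abs (Real.sin θ), Real.cos_le_one θ, sq_nonneg δ]

theorem abs_mul_bumpDeriv_le (θ : ℝ) : |δ * bumpDeriv hδ θ| ≤ 2 := by
  have hd := sq_add_one_sub_cos_pos hδ θ
  have h1 := mul_abs_sin_le (δ := δ) θ
  have h2 : δ ^ 2 ≤ δ ^ 2 + 1 - Real.cos θ := by linarith [Real.cos_le_one θ]
  simp only [bumpDeriv, ContinuousMap.coe_mk]
  set d := δ ^ 2 + 1 - Real.cos θ
  rw [abs_mul, abs_div, abs_neg, abs_mul, abs_of_pos hδ, abs_of_pos (pow_pos hd 2),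
    abs_of_pos (pow_pos hδ 2), ← mul_div_assoc, div_le_iff₀ (pow_pos hd 2)]
  have := mul_le_mul h1 h2 (by positivity) (by positivity)
  nlinarith [sq_nonneg d]

theorem abs_inv_mul_ramp_le (θ : ℝ) : |δ⁻¹ * ramp hδ θ| ≤ 2 := by
  have hd := sq_add_one_sub_cos_pos hδ θ
  have h1 := mul_abs_sin_le (δ := δ) θ
  simp only [ramp, ContinuousMap.coe_mk]
  set d := δ ^ 2 + 1 - Real.cos θ
  have e : δ⁻¹ * (δ ^ 2 * Real.sin θ / d) = δ * Real.sin θ / d := by field_simp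
  rw [e, abs_div, abs_mul, abs_of_pos hδ, abs_of_pos hd, div_le_iff₀ hd]
  linarith

theorem abs_bump_sub_rampDeriv_le (θ : ℝ) : |bump hδ θ - rampDeriv hδ θ| ≤ 4 := by
  have hd := sq_add_one_sub_cos_pos hδ θ
  have h0 := abs_bump_le hδ θ
  have h1 : Real.sin θ ^ 2 ≤ 2 * (1 - Real.cos θ) := by
    nlinarith [Real.sin_sq_add_cos_sq θ, Real.cos_le_one θ, Real.neg_one_le_cos θ]
  have h2 : δ ^ 2 ≤ δ ^ 2 + 1 - Real.cos θ := by linarith [Real.cos_le_one θ]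
  have h3 : Real.sin θ ^ 2 ≤ 2 * (δ ^ 2 + 1 - Real.cos θ) := by nlinarith [sq_nonneg δ]
  have h4 : |rampDeriv hδ θ| ≤ 3 := by
    have hc := Real.cos_le_one θ
    have hc' := Real.neg_one_le_cos θ
    simp only [rampDeriv, ContinuousMap.coe_mk]
    set d := δ ^ 2 + 1 - Real.cos θ
    rw [abs_div, abs_of_pos (pow_pos hd 2), div_le_iff₀ (pow_pos hd 2), abs_mul,
      abs_of_pos (pow_pos hδ 2)]
    have h5 : |Real.cos θ * d - Real.sin θ ^ 2| ≤ 3 * d := by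
      rw [abs_le]; constructor <;> nlinarith [sq_nonneg (Real.sin θ)]
    have := mul_le_mul h2 h5 (abs_nonneg _) hd.le
    nlinarith
  rw [abs_le] at *
  constructor <;> linarith [h0.1, h0.2, h4.1, h4.2]

theorem bump_eq_one {θ : ℝ} (hθ : Real.cos θ = 1) : bump hδ θ = 1 := by
  simp only [bump, ContinuousMap.coe_mk, hθ]
  field_simp
  ring

theorem sin_eq_zero_of_cos {θ : ℝ} (hθ : Real.cos θ = 1) : Real.sin θ = 0 := by
  have := Real.sin_sq_add_cos_sq θ
  rw [hθ] at this
  nlinarith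

theorem bumpDeriv_eq_zero {θ : ℝ} (hθ : Real.cos θ = 1) : bumpDeriv hδ θ = 0 := by
  simp [bumpDeriv, sin_eq_zero_of_cos hθ]

theorem ramp_eq_zero {θ : ℝ} (hθ : Real.cos θ = 1) : ramp hδ θ = 0 := by
  simp [ramp, sin_eq_zero_of_cos hθ]

theorem rampDeriv_eq_one {θ : ℝ} (hθ : Real.cos θ = 1) : rampDeriv hδ θ = 1 := by
  simp only [rampDeriv, ContinuousMap.coe_mk, sin_eq_zero_of_cos hθ, hθ]
  field_simp
  ring

end Cutoff

section Limits

variable {δ : ℕ → ℝ} (hδ : ∀ j, 0 < δ j) (hδ0 : Tendsto δ atTop (𝓝 0)) {θ : ℝ}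

include hδ0

theorem tendsto_of_continuousAt_zero {F : ℝ → ℝ} (hF : ContinuousAt F 0) (h0 : F 0 = 0) :
    Tendsto (fun j => F (δ j)) atTop (𝓝 0) := by
  have := hF.tendsto.comp hδ0
  rwa [h0] at this

theorem tendsto_bump_zero (hθ : Real.cos θ ≠ 1) :
    Tendsto (fun j => bump (hδ j) θ) atTop (𝓝 0) :=
  tendsto_of_continuousAt_zero hδ0 (F := fun δ => δ ^ 2 / (δ ^ 2 + 1 - Real.cos θ))
    (ContinuousAt.div (by fun_prop) (by fun_prop) (by simpa [sub_eq_zero] using hθ.symm)) (by simp)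

theorem tendsto_rampDeriv_zero (hθ : Real.cos θ ≠ 1) :
    Tendsto (fun j => rampDeriv (hδ j) θ) atTop (𝓝 0) :=
  tendsto_of_continuousAt_zero hδ0 (F := fun δ =>
      δ ^ 2 * (Real.cos θ * (δ ^ 2 + 1 - Real.cos θ) - Real.sin θ ^ 2)
      / (δ ^ 2 + 1 - Real.cos θ) ^ 2)
    (ContinuousAt.div (by fun_prop) (by fun_prop) (by simpa [sub_eq_zero] using hθ.symm)) (by simp)

theorem tendsto_mul_bumpDeriv : Tendsto (fun j => δ j * bumpDeriv (hδ j) θ) atTop (𝓝 0) := by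
  by_cases hθ : Real.cos θ = 1
  · simp only [bumpDeriv_eq_zero _ hθ, mul_zero]; exact tendsto_const_nhds
  · exact tendsto_of_continuousAt_zero hδ0
      (F := fun δ => δ * (-(δ ^ 2 * Real.sin θ) / (δ ^ 2 + 1 - Real.cos θ) ^ 2))
      (continuousAt_id.mul (ContinuousAt.div (by fun_prop) (by fun_prop)
        (by simpa [sub_eq_zero] using Ne.symm hθ))) (by simp)

theorem tendsto_inv_mul_ramp : Tendsto (fun j => (δ j)⁻¹ * ramp (hδ j) θ) atTop (𝓝 0) := by
  by_cases hθ : Real.cos θ = 1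
  · simp only [ramp_eq_zero _ hθ, mul_zero]; exact tendsto_const_nhds
  · refine (tendsto_of_continuousAt_zero hδ0
      (F := fun δ => δ * Real.sin θ / (δ ^ 2 + 1 - Real.cos θ))
      (ContinuousAt.div (by fun_prop) (by fun_prop)
        (by simpa [sub_eq_zero] using Ne.symm hθ)) (by simp)).congr fun j => ?_
    have := (hδ j).ne'
    simp only [ramp, ContinuousMap.coe_mk]
    field_simp

theorem tendsto_bump_sub_rampDeriv :
    Tendsto (fun j => bump (hδ j) θ - rampDeriv (hδ j) θ) atTop (𝓝 0) := by
  by_cases hθ : Real.cos θ = 1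
  · simp only [bump_eq_one _ hθ, rampDeriv_eq_one _ hθ, sub_self]; exact tendsto_const_nhds
  · simpa using (tendsto_bump_zero hδ hδ0 hθ).sub (tendsto_rampDeriv_zero hδ hδ0 hθ)

end Limits

end

noncomputable section

theorem Coef.smul {n : WithTop ℕ∞} {a : C(Pt, ℂ)} (ha : Coef n a) (c : ℝ) :
    Coef n ((c : ℂ) • a) :=
  ⟨ha.contDiff.const_smul (c : ℂ), fun m x => by simp only [ContinuousMap.smul_apply, ha.per m x],
    by rw [star_smul, ha.real]; simp⟩

/-- The points of the torus at which the phase `2 π e · (x - x₀)` lies in `2 π ℤ`. -/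
def crest (e : ℤ × ℤ) (x₀ : Pt) : Set T2 :=
  {p | lift (wave e x₀ ⟨Real.cos, Real.continuous_cos⟩) p = 1}

theorem isClosed_crest (e : ℤ × ℤ) (x₀ : Pt) : IsClosed (crest e x₀) :=
  isClosed_eq (continuous_lift (coef_wave (n := 0) e x₀ (φ := ⟨Real.cos, Real.continuous_cos⟩)
    Real.contDiff_cos Real.cos_periodic).per) continuous_const

theorem mem_crest_iff {e : ℤ × ℤ} {x₀ x : Pt} :
    proj2 x ∈ crest e x₀ ↔ Real.cos (ang e x₀ x) = 1 := by
  rw [crest, Set.mem_ofPred_eq, lift_proj2 (coef_wave (n := 0) e x₀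
    (φ := ⟨Real.cos, Real.continuous_cos⟩) Real.contDiff_cos Real.cos_periodic).per, wave_apply]
  norm_cast

theorem tendsto_integral_lift_bump (e : ℤ × ℤ) (x₀ : Pt) {ν : Measure T2} [IsFiniteMeasure ν]
    {δ : ℕ → ℝ} (hδ : ∀ j, 0 < δ j) (hδ0 : Tendsto δ atTop (𝓝 0)) :
    Tendsto (fun j => ∫ p, lift (wave e x₀ (bump (hδ j))) p ∂ν) atTop
      (𝓝 ((ν.real (crest e x₀) : ℝ) : ℂ)) := by
  have hp : ∀ j, IsPeriodic ⇑(wave e x₀ (bump (hδ j))) := fun j =>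
    (coef_wave (n := 0) e x₀ (contDiff_bump (hδ j)) (periodic_bump (hδ j))).per
  have h1 : ((ν.real (crest e x₀) : ℝ) : ℂ) = ∫ p, (crest e x₀).indicator 1 p ∂ν := by
    rw [integral_indicator (isClosed_crest e x₀).measurableSet]
    simp
  rw [h1]
  refine tendsto_integral_of_dominated_convergence (fun _ => 1)
    (fun j => (continuous_lift (hp j)).aestronglyMeasurable) (integrable_const _)
    (fun j => Eventually.of_forall fun p => ?_) (Eventually.of_forall fun p => ?_)
  · rw [lift, wave_apply, Complex.norm_real]
    exact abs_bump_le _ _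
  · obtain ⟨x, rfl⟩ := isOpenQuotientMap_proj2.surjective p
    simp only [lift_proj2 (hp _), wave_apply]
    by_cases hx : Real.cos (ang e x₀ x) = 1
    · rw [Set.indicator_of_mem (mem_crest_iff.2 hx)]
      simp [bump_eq_one _ hx]
    · rw [Set.indicator_of_notMem (fun h => hx (mem_crest_iff.1 h))]
      exact_mod_cast (tendsto_bump_zero hδ hδ0 hx).ofReal

theorem wavg_one_eq_of_cos {e : ℤ × ℤ} (he : Int.gcd e.1 e.2 = 1) {X : C(Pt, ℂ)}
    (hX : IsPeriodic X) {x₀ x : Pt} (h : Real.cos (ang e x₀ x) = 1) :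
    wavg 1 (perp e) X x = wavg 1 (perp e) X x₀ := by
  obtain ⟨k, hk⟩ := (Real.cos_eq_one_iff _).1 h
  refine wavg_one_eq he hX (k := k) ?_
  have : (2 * π) * (e.1 * (x.1 - x₀.1) + e.2 * (x.2 - x₀.2)) = (2 * π) * k := by
    rw [mul_comm _ (k : ℝ), hk]; rfl
  exact mul_left_cancel₀ (by positivity) this

theorem MagFrame.average_eq_zero {M : MagFrame} {e : ℤ × ℤ} (he : Int.gcd e.1 e.2 = 1) {N : ℝ}
    (hN : 0 < N) (hN2 : N ^ 2 = (e.1 : ℝ) ^ 2 + (e.2 : ℝ) ^ 2)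
    (hs : M.s = ((e.1 : ℝ) / N, (e.2 : ℝ) / N)) (ht : M.t = (-((e.2 : ℝ) / N), (e.1 : ℝ) / N))
    {B : C(Pt, ℂ)} (hfield : M.field = B) (hB : Coef 2 B) {x₀ : Pt}
    {ν : Measure T2} [IsFiniteMeasure ν] {u : ℕ → Pt → ℂ} {U R : ℕ → C(Pt, ℂ)} {κ η : ℕ → ℝ}
    (hw : ∀ f : T2 → ℂ, Continuous f →
      Tendsto (fun n => ∫ x in fund, f (proj2 x) * ((‖u n x‖ ^ 2 : ℝ) : ℂ)) atTop
        (𝓝 (∫ p, f p ∂ν))) (hU : ∀ n x, ‖U n x‖ = ‖u n x‖)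
    (hκ : ∀ n, 0 < κ n) (hκ0 : Tendsto κ atTop (𝓝 0)) (hη0 : Tendsto η atTop (𝓝 0))
    (hq : ∀ᶠ n in atTop, M.Quasimode (κ n ^ 2) (η n * κ n ^ 3) (U n) (R n))
    (hν : 0 < ν (crest e x₀)) : wavg 1 (perp e) B x₀ = 0 := by
  have hv : ∀ x, B (x + perp e) = B x := hB.per.add_perp e
  have hB1 : ContDiff ℝ 1 B := hB.contDiff.of_le (by norm_num)
  set b := wavg 1 (perp e) B with hb_def
  have hb : Coef 2 b := coef_wavg (n := 2) hB contDiff_const (by simp) _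
  have hg : Coef 2 (wavg idWeight (perp e) B) :=
    coef_wavg (n := 2) hB contDiff_idWeight star_idWeight _
  have htp : M.t = N⁻¹ • perp e := by
    rw [ht]; ext <;> simp [perp] <;> field_simp
  have hgt : pdc M.t ((N : ℂ) • wavg idWeight (perp e) B) = M.field - b := by
    rw [pdc_smul (hg.contDiff.of_le (by norm_num)), htp,
      pdc_smul_dir (hg.contDiff.of_le (by norm_num)), pdc_wavg_idWeight hB1 hv, hfield, smul_smul,
      ← Complex.ofReal_mul, mul_inv_cancel₀ hN.ne', Complex.ofReal_one, one_smul]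
  set c : ℝ := 2 * π * N with hc
  have hc0 : 0 < c := by positivity
  have hes : 2 * π * (e.1 * M.s.1 + e.2 * M.s.2) = c := by
    rw [hs, hc]
    field_simp
    linear_combination -hN2
  have het : 2 * π * (e.1 * M.t.1 + e.2 * M.t.2) = 0 := by
    rw [ht]
    ring
  set b₀ : ℝ := (b x₀).re with hb₀
  have hbr : (b₀ : ℂ) = b x₀ := Complex.conj_eq_iff_re.1 (DFunLike.congr_fun hb.real x₀)
  set δ : ℕ → ℝ := fun j => 1 / ((j : ℝ) + 1) with hδ_def
  have hδ : ∀ j, 0 < δ j := fun j => by positivity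
  have hδ0 : Tendsto δ atTop (𝓝 0) := tendsto_one_div_add_atTop_nhds_zero_nat
  have cb : ∀ j, Coef 2 (wave e x₀ (bump (hδ j))) := fun j =>
    coef_wave e x₀ (contDiff_bump (hδ j)) (periodic_bump (hδ j))
  have cr : ∀ j, Coef 2 (wave e x₀ (ramp (hδ j))) := fun j =>
    coef_wave e x₀ (contDiff_ramp (hδ j)) (periodic_ramp (hδ j))
  have db : ∀ j v, pdc v (wave e x₀ (bump (hδ j)))
      = ((2 * π * (e.1 * v.1 + e.2 * v.2) : ℝ) : ℂ) • wave e x₀ (bumpDeriv (hδ j)) := fun j =>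
    pdc_wave e x₀ (contDiff_bump (hδ j)) (hasDerivAt_bump (hδ j))
  have dr : ∀ j v, pdc v (wave e x₀ (ramp (hδ j)))
      = ((2 * π * (e.1 * v.1 + e.2 * v.2) : ℝ) : ℂ) • wave e x₀ (rampDeriv (hδ j)) := fun j =>
    pdc_wave e x₀ (contDiff_ramp (hδ j)) (hasDerivAt_ramp (hδ j))
  have drs : ∀ j, pdc M.s (((c⁻¹ : ℝ) : ℂ) • wave e x₀ (ramp (hδ j)))
      = wave e x₀ (rampDeriv (hδ j)) := fun j => by
    rw [pdc_smul ((cr j).contDiff.of_le (by norm_num)), dr, hes, smul_smul, ← Complex.ofReal_mul,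
      inv_mul_cancel₀ hc0.ne', Complex.ofReal_one, one_smul]
  have key : ∀ j, |b₀| * ‖∫ p, lift (wave e x₀ (bump (hδ j))) p ∂ν‖
      ≤ 8 * c * tnrm ν ((δ j : ℂ) • wave e x₀ (bumpDeriv (hδ j)))
        + 2 * tnrm ν (wave e x₀ (bump (hδ j)) * b - (b₀ : ℂ) • wave e x₀ (bump (hδ j)))
        + |b₀| * (4 * tnrm ν (wave e x₀ (bump (hδ j)) - wave e x₀ (rampDeriv (hδ j)))
          + 4 * M.bd * c⁻¹ * tnrm ν (((δ j)⁻¹ : ℂ) • wave e x₀ (ramp (hδ j)))) := fun j => by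
    have hT : (0:ℝ) < (Real.sqrt (δ j))⁻¹ := inv_pos.2 (Real.sqrt_pos.2 (hδ j))
    have hT2 : ((Real.sqrt (δ j))⁻¹) ^ 2 = (δ j)⁻¹ := by
      rw [inv_pow, Real.sq_sqrt (hδ j).le]
    refine (MagFrame.limit_estimate (cb j) (hg.smul N) hb ((cr j).smul c⁻¹) ?_ hgt ?_ b₀ hT hw hU
      hκ hκ0 hη0 hq).trans (le_of_eq ?_)
    · rw [db, het]; ext; simp
    · rw [pdc_smul ((cr j).contDiff.of_le (by norm_num)), dr, het]; ext; simp
    · rw [drs, db, hes, hT2, tnrm_smul, tnrm_smul, tnrm_smul, tnrm_smul, norm_inv,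
        Complex.norm_real, Complex.norm_real, Complex.norm_real, Real.norm_of_nonneg hc0.le,
        Real.norm_of_nonneg (hδ j).le, Real.norm_of_nonneg (inv_pos.2 hc0).le]
      have := hδ j
      field_simp
  have z1 : Tendsto (fun j => tnrm ν ((δ j : ℂ) • wave e x₀ (bumpDeriv (hδ j)))) atTop (𝓝 0) := by
    refine tendsto_tnrm_zero (K := 2) (fun j => ?_) (Eventually.of_forall fun j x => ?_) fun x => ?_
    · have h1 := (((cb j).dir M.s).smul c⁻¹).smul (δ j)
      rw [db, hes, smul_smul ((c⁻¹ : ℝ) : ℂ), ← Complex.ofReal_mul, inv_mul_cancel₀ hc0.ne',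
        Complex.ofReal_one, one_smul] at h1
      exact h1.per
    · rw [ContinuousMap.smul_apply, wave_apply, smul_eq_mul, ← Complex.ofReal_mul,
        Complex.norm_real]
      exact abs_mul_bumpDeriv_le _ _
    · simp only [ContinuousMap.smul_apply, wave_apply, smul_eq_mul, ← Complex.ofReal_mul]
      exact_mod_cast (tendsto_mul_bumpDeriv hδ hδ0).ofReal
  have z2 : Tendsto (fun j => tnrm ν (wave e x₀ (bump (hδ j)) * b
      - (b₀ : ℂ) • wave e x₀ (bump (hδ j)))) atTop (𝓝 0) := by
    have e1 : ∀ j x, (wave e x₀ (bump (hδ j)) * b - (b₀ : ℂ) • wave e x₀ (bump (hδ j))) x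
        = (bump (hδ j) (ang e x₀ x) : ℂ) * (b x - b x₀) := fun j x => by
      simp only [ContinuousMap.sub_apply, ContinuousMap.mul_apply, ContinuousMap.smul_apply,
        wave_apply, smul_eq_mul, hbr]
      ring
    refine tendsto_tnrm_zero (K := cn b + cn b) (fun j m x => ?_)
      (Eventually.of_forall fun j x => ?_) fun x => ?_
    · simp only [ContinuousMap.sub_apply, ContinuousMap.mul_apply, ContinuousMap.smul_apply,
        (cb j).per m x, hb.per m x]
    · rw [e1, norm_mul, Complex.norm_real, ← one_mul (cn b + cn b)]
      refine mul_le_mul (abs_bump_le _ _) ?_ (norm_nonneg _) zero_le_one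
      exact (norm_sub_le _ _).trans (add_le_add (hb.per.norm_le_cn _) (hb.per.norm_le_cn _))
    · simp only [e1]
      by_cases hx : Real.cos (ang e x₀ x) = 1
      · simp only [hb_def, wavg_one_eq_of_cos he hB.per hx, sub_self, mul_zero]
        exact tendsto_const_nhds
      · have := (tendsto_bump_zero hδ hδ0 hx).ofReal.mul_const (b x - b x₀)
        simpa using this
  have z3 : Tendsto (fun j => tnrm ν (wave e x₀ (bump (hδ j)) - wave e x₀ (rampDeriv (hδ j))))
      atTop (𝓝 0) := by
    refine tendsto_tnrm_zero (K := 4) (fun j => ?_) (Eventually.of_forall fun j x => ?_) fun x => ?_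
    · rw [← drs]
      exact (((cb j).of_le (by norm_num)).sub (((cr j).smul c⁻¹).dir M.s)).per
    · rw [ContinuousMap.sub_apply, wave_apply, wave_apply, ← Complex.ofReal_sub, Complex.norm_real]
      exact abs_bump_sub_rampDeriv_le _ _
    · simp only [ContinuousMap.sub_apply, wave_apply, ← Complex.ofReal_sub]
      exact_mod_cast (tendsto_bump_sub_rampDeriv hδ hδ0).ofReal
  have z4 : Tendsto (fun j => tnrm ν (((δ j)⁻¹ : ℂ) • wave e x₀ (ramp (hδ j)))) atTop (𝓝 0) := by
    refine tendsto_tnrm_zero (K := 2) (fun j => ?_) (Eventually.of_forall fun j x => ?_) fun x => ?_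
    · rw [← Complex.ofReal_inv]
      exact ((cr j).smul _).per
    · rw [ContinuousMap.smul_apply, wave_apply, smul_eq_mul, ← Complex.ofReal_inv,
        ← Complex.ofReal_mul, Complex.norm_real]
      exact abs_inv_mul_ramp_le _ _
    · simp only [ContinuousMap.smul_apply, wave_apply, smul_eq_mul, ← Complex.ofReal_inv,
        ← Complex.ofReal_mul]
      exact_mod_cast (tendsto_inv_mul_ramp hδ hδ0).ofReal
  have lim := le_of_tendsto_of_tendsto'
    ((tendsto_integral_lift_bump e x₀ hδ hδ0).norm.const_mul |b₀|)
    (((z1.const_mul (8 * c)).add (z2.const_mul 2)).add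
      (((z3.const_mul 4).add (z4.const_mul (4 * M.bd * c⁻¹))).const_mul |b₀|)) key
  have hpos : 0 < ν.real (crest e x₀) := ENNReal.toReal_pos hν.ne' (measure_ne_top _ _)
  rw [Complex.norm_real, Real.norm_of_nonneg hpos.le] at lim
  simp only [mul_zero, add_zero] at lim
  have h0 : |b₀| = 0 := le_antisymm (nonpos_of_mul_nonpos_left lim hpos) (abs_nonneg _)
  rw [← hbr, abs_eq_zero.1 h0, Complex.ofReal_zero]

end

noncomputable section

/-- A real continuous function, as a complex one. -/
def complexify (f : Pt → ℝ) (hf : Continuous f) : C(Pt, ℂ) := ⟨fun x => (f x : ℂ), by fun_prop⟩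

theorem complexify_apply {f : Pt → ℝ} (hf : Continuous f) (x : Pt) :
    complexify f hf x = (f x : ℂ) := rfl

theorem contDiff_complexify {f : Pt → ℝ} {n : WithTop ℕ∞} (hf : ContDiff ℝ n f) :
    ContDiff ℝ n (complexify f hf.continuous) := Complex.ofRealCLM.contDiff.comp hf

theorem star_complexify {f : Pt → ℝ} (hf : Continuous f) :
    star (complexify f hf) = complexify f hf := by ext x; exact Complex.conj_ofReal _

theorem pdc_complexify {f : Pt → ℝ} (hf : ContDiff ℝ 1 f) (v x : Pt) :
    pdc v (complexify f hf.continuous) x = ((fderiv ℝ f x v : ℝ) : ℂ) := by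
  rw [pdc_apply (contDiff_complexify hf)]
  have h1 : HasFDerivAt (complexify f hf.continuous) (Complex.ofRealCLM.comp (fderiv ℝ f x)) x :=
    Complex.ofRealCLM.hasFDerivAt.comp x (hf.differentiable (by simp) x).hasFDerivAt
  rw [h1.fderiv]; rfl

section Potential

variable {B : Pt → ℝ} {B0 : ℝ} {Aper A : Pt → Pt}

theorem contDiff_of_eq_add (hApersm : ContDiff ℝ (⊤ : ℕ∞) Aper)
    (hA : ∀ x, A x = A0 B0 x + Aper x) : ContDiff ℝ (⊤ : ℕ∞) A := by
  have h1 : ContDiff ℝ (⊤ : ℕ∞) (A0 B0) := by unfold A0; fun_prop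
  rw [funext hA]
  exact h1.add hApersm

theorem isPotential_complexify (hBc : Continuous B) (hBper : IsPeriodic B)
    (hAperper : IsPeriodic Aper) (hA : ∀ x, A x = A0 B0 x + Aper x)
    (hcurl : ∀ x, pdR1 (fun y => (A y).2) x - pdR2 (fun y => (A y).1) x = B x) (α : Pt)
    (h1 : ContDiff ℝ 3 fun x => α.1 + (A x).1) (h2 : ContDiff ℝ 3 fun x => α.2 + (A x).2) :
    IsPotential B0 (complexify B hBc) (complexify _ h1.continuous)
      (complexify _ h2.continuous) where
  contDiff_P := contDiff_complexify h1
  contDiff_Q := contDiff_complexify h2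
  real_P := star_complexify _
  real_Q := star_complexify _
  curl := by
    ext x
    rw [ContinuousMap.sub_apply, pdc_complexify (h2.of_le (by norm_num)),
      pdc_complexify (h1.of_le (by norm_num)), complexify_apply, fderiv_const_add,
      fderiv_const_add, ← hcurl x]
    simp [pdR1, pdR2]
  per := fun m x => by rw [complexify_apply, complexify_apply, hBper]
  itrans_P := fun m => by
    ext x
    rw [ContinuousMap.sub_apply, itrans_apply, complexify_apply, complexify_apply, hA, hA]
    simp only [Prod.fst_add, hAperper m x, A0, ContinuousMap.smul_apply, ContinuousMap.one_apply]
    push_cast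
    simp
    ring
  itrans_Q := fun m => by
    ext x
    rw [ContinuousMap.sub_apply, itrans_apply, complexify_apply, complexify_apply, hA, hA]
    simp only [Prod.snd_add, hAperper m x, A0, ContinuousMap.smul_apply, ContinuousMap.one_apply]
    push_cast
    simp
    ring

end Potential

theorem itrans_of_magTrans {B0 : ℝ} {U : C(Pt, ℂ)} {m : ℤ × ℤ} (h : magTrans B0 m U = U) :
    itrans m U = cexpI (((B0 / 2 : ℝ) : ℂ) • wedgec m) * U := by
  ext x
  have h1 := congrFun h (x.1 + m.1, x.2 + m.2)
  rw [itrans_apply, ← h1, magTrans, ContinuousMap.mul_apply, cexpI_apply]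
  congr 2
  · simp [wedgec, wedge]
    ring
  · simp

theorem magLap_eq {α : Pt} {A : Pt → Pt} {U : C(Pt, ℂ)} (hU : ContDiff ℝ 2 U)
    (h1 : ContDiff ℝ 1 fun x => α.1 + (A x).1) (h2 : ContDiff ℝ 1 fun x => α.2 + (A x).2) (x : Pt) :
    magLap α A U x
      = (covd (1, 0) (complexify _ h1.continuous) (covd (1, 0) (complexify _ h1.continuous) U)
        + covd (0, 1) (complexify _ h2.continuous) (covd (0, 1) (complexify _ h2.continuous) U))
          x := by
  have e1 : ∀ V : C(Pt, ℂ), ContDiff ℝ 1 V →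
      Dop1 α A V = covd (1, 0) (complexify _ h1.continuous) V := fun V hV => by
    ext x
    simp [Dop1, covd, pd1, pdc_apply hV, complexify_apply]
  have e2 : ∀ V : C(Pt, ℂ), ContDiff ℝ 1 V →
      Dop2 α A V = covd (0, 1) (complexify _ h2.continuous) V := fun V hV => by
    ext x
    simp [Dop2, covd, pd2, pdc_apply hV, complexify_apply]
  have hU1 : ContDiff ℝ 1 U := hU.of_le (by norm_num)
  rw [magLap, e1 U hU1, e2 U hU1, e1 _ (contDiff_covd hU (contDiff_complexify h1) _),
    e2 _ (contDiff_covd hU (contDiff_complexify h2) _)]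
  rfl

theorem tendsto_ray_average {X : C(Pt, ℂ)} {v : Pt} (hv : ∀ x, X (x + v) = X x) {N : ℝ}
    (hN : 0 < N) (y : Pt) :
    Tendsto (fun n : ℕ => ((1 / (n * N) : ℝ) : ℂ) * ∫ t in (0:ℝ)..(n * N), X (y + t • (N⁻¹ • v)))
      atTop (𝓝 (wavg 1 v X y)) := by
  refine tendsto_const_nhds.congr' ?_
  filter_upwards [eventually_gt_atTop 0] with n hn
  have hn' : (n : ℂ) ≠ 0 := by exact_mod_cast hn.ne'
  have hN' : (N : ℂ) ≠ 0 := by exact_mod_cast hN.ne'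
  have h1 := intervalIntegral.integral_comp_div (a := 0) (b := n * N)
    (fun r : ℝ => X (y + r • v)) hN.ne'
  have h2 := (periodic_along hv y).intervalIntegral_add_zsmul_eq n 0
    fun _ _ => (by fun_prop : Continuous fun r : ℝ => X (y + r • v)).intervalIntegrable _ _
  have h3 : ∀ t : ℝ, y + t • (N⁻¹ • v) = y + (t / N) • v := fun t => by
    rw [smul_smul, div_eq_mul_inv]
  simp only [h3]
  rw [h1, zero_div, mul_div_cancel_right₀ _ hN.ne', wavg_apply]
  simp only [zero_add, zsmul_eq_mul, mul_one, Int.cast_natCast] at h2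
  rw [h2]
  simp only [ContinuousMap.one_apply, one_mul, Complex.real_smul]
  push_cast
  field_simp

end

/-- second item of Theorem A.1: if a quantum limit charges a closed
geodesic `γ` in direction `θ₀ = e^⊥/|e|`, then `B_∞(·,θ₀)` vanishes along `γ`. -/
theorem statement18
    (B : Pt → ℝ) (hBsm : ContDiff ℝ (⊤ : ℕ∞) B) (hBper : IsPeriodic B)
    (B0 : ℝ) (hB0 : B0 = ∫ x in fund, B x) (hflux : ∃ k : ℤ, B0 = 2 * π * k)
    (hB0pos : 0 < B0)
    (Aper : Pt → Pt) (hApersm : ContDiff ℝ (⊤ : ℕ∞) Aper) (hAperper : IsPeriodic Aper)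
    (A : Pt → Pt) (hA : ∀ x, A x = A0 B0 x + Aper x)
    (hcurl : ∀ x, pdR1 (fun y => (A y).2) x - pdR2 (fun y => (A y).1) x = B x)
    (Binf : Pt → Pt → ℝ)
    (hBinf : ∀ x θ : Pt, Tendsto (fun T : ℝ => (1 / T) * ∫ t in (0:ℝ)..T, B (x + t • θ))
      atTop (𝓝 (Binf x θ)))
    (α : Pt) (ν : Measure T2) (hν : IsQuantumLimit B0 α A ν)
    (e : ℤ × ℤ) (he : Int.gcd e.1 e.2 = 1) (x₀ : Pt) (θ₀ : Pt)
    (hθ₀ : θ₀ = (-(e.2 : ℝ) / Real.sqrt ((e.1 : ℝ) ^ 2 + (e.2 : ℝ) ^ 2),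
      (e.1 : ℝ) / Real.sqrt ((e.1 : ℝ) ^ 2 + (e.2 : ℝ) ^ 2)))
    (hγ : 0 < ν {p : T2 | ∃ t : ℝ, p = proj2 (x₀ + t • θ₀)}) :
    ∀ y : Pt, (∃ t : ℝ, proj2 y = proj2 (x₀ + t • θ₀)) → Binf y θ₀ = 0 := by
  set N : ℝ := Real.sqrt ((e.1 : ℝ) ^ 2 + (e.2 : ℝ) ^ 2) with hN_def
  have hpos : 0 < (e.1 : ℝ) ^ 2 + (e.2 : ℝ) ^ 2 := by
    have h1 : e.1 ≠ 0 ∨ e.2 ≠ 0 := by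
      by_contra! h
      rw [h.1, h.2] at he
      norm_num at he
    rcases h1 with h | h
    · have : (e.1 : ℝ) ≠ 0 := by exact_mod_cast h
      positivity
    · have : (e.2 : ℝ) ≠ 0 := by exact_mod_cast h
      positivity
  have hN : 0 < N := Real.sqrt_pos.2 hpos
  have hN2 : N ^ 2 = (e.1 : ℝ) ^ 2 + (e.2 : ℝ) ^ 2 := Real.sq_sqrt hpos.le
  have hθ : θ₀ = N⁻¹ • perp e := by
    rw [hθ₀]; ext <;> simp [perp] <;> field_simp
  have hang : ∀ t : ℝ, ang e x₀ (x₀ + t • θ₀) = 0 := fun t => by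
    simp [ang, hθ, perp]; ring_nf
  have hAsm := contDiff_of_eq_add hApersm hA
  have h1 : ContDiff ℝ 3 fun x => α.1 + (A x).1 :=
    contDiff_const.add (contDiff_infty.1 hAsm.fst 3)
  have h2 : ContDiff ℝ 3 fun x => α.2 + (A x).2 :=
    contDiff_const.add (contDiff_infty.1 hAsm.snd 3)
  have hp := isPotential_complexify hBsm.continuous hBper hAperper hA hcurl α h1 h2
  set Bc := complexify B hBsm.continuous with hBc
  set P := complexify _ h1.continuous with hP
  set Q := complexify _ h2.continuous with hQ
  have hBcoef : Coef 2 Bc := ⟨contDiff_complexify (contDiff_infty.1 hBsm 2), hp.per,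
    star_complexify _⟩
  have ha : ((e.1 : ℝ) / N) ^ 2 + ((e.2 : ℝ) / N) ^ 2 = 1 := by
    field_simp
    exact hN2.symm
  obtain ⟨G, hG, hGr, hGs⟩ := exists_primitive
    (J := (((e.1 : ℝ) / N : ℝ) : ℂ) • P + (((e.2 : ℝ) / N : ℝ) : ℂ) • Q)
    ((hp.contDiff_P.const_smul (((e.1 : ℝ) / N : ℝ) : ℂ)).add
      (hp.contDiff_Q.const_smul (((e.2 : ℝ) / N : ℝ) : ℂ)))
    (by rw [star_add, star_smul, star_smul, hp.real_P, hp.real_Q]; simp) ha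
  obtain ⟨hνp, h, u, hh, hh0, hu, hcov, hnorm, hr, hw⟩ := hν
  set U : ℕ → C(Pt, ℂ) := fun n => ⟨u n, (hu n).continuous⟩ with hU_def
  set R : ℕ → C(Pt, ℂ) := fun n => ((h n ^ 2 : ℝ) : ℂ) • (covd (1, 0) P (covd (1, 0) P (U n))
    + covd (0, 1) Q (covd (0, 1) Q (U n))) - U n with hR_def
  have hR : ∀ n, (∫ x in fund, ‖((h n ^ 2 : ℝ) : ℂ) * magLap α A (u n) x - u n x‖ ^ 2)
      ^ ((1 : ℝ) / 2) = nrm (R n) := fun n => by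
    rw [nrm, Real.sqrt_eq_rpow]
    congr 1
    refine integral_congr_ae (Eventually.of_forall fun x => ?_)
    have := magLap_eq (U := U n) (hu n) (h1.of_le (by norm_num)) (h2.of_le (by norm_num)) x
    change ‖((h n ^ 2 : ℝ) : ℂ) * magLap α A (U n) x - U n x‖ ^ 2 = _
    rw [this]
    rfl
  simp only [hR] at hr
  have hsq : ∀ n, Real.sqrt (h n) ^ 2 = h n := fun n => Real.sq_sqrt (hh n).le
  have hκ : ∀ n, 0 < Real.sqrt (h n) := fun n => Real.sqrt_pos.2 (hh n)
  have hpow : ∀ n, h n ^ ((3 : ℝ) / 2) = Real.sqrt (h n) ^ 3 := fun n => by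
    rw [Real.sqrt_eq_rpow, ← Real.rpow_natCast, ← Real.rpow_mul (hh n).le]
    norm_num
  have hκ0 : Tendsto (fun n => Real.sqrt (h n)) atTop (𝓝 0) := by
    have := (Real.continuous_sqrt.tendsto 0).comp hh0
    rwa [Real.sqrt_zero] at this
  have hη0 := hr.tendsto_div_nhds_zero
  have hR0 : Tendsto (fun n => nrm (R n)) atTop (𝓝 0) := by
    have := hη0.mul (hκ0.pow 3)
    rw [zero_mul] at this
    refine this.congr fun n => ?_
    rw [hpow]
    exact div_mul_cancel₀ _ (pow_pos (hκ n) 3).ne'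
  have hUn : ∀ n x, ‖(cexpI (-G) * U n) x‖ = ‖u n x‖ := fun n x => by
    rw [ContinuousMap.mul_apply, norm_mul, norm_cexpI (by rw [star_neg, hGr]), one_mul]
    rfl
  have hq : ∀ᶠ n in atTop, (hp.frame ha hG hGr hGs).Quasimode (Real.sqrt (h n) ^ 2)
      (nrm (R n) / h n ^ ((3 : ℝ) / 2) * Real.sqrt (h n) ^ 3) (cexpI (-G) * U n)
      (cexpI (-G) * R n) := by
    filter_upwards [hh0.eventually_le_const one_pos, hR0.eventually_le_const one_pos]
      with n hn1 hn2
    rw [hsq, hpow, div_mul_cancel₀ _ (pow_pos (hκ n) 3).ne']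
    refine hp.quasimode ha hG hGr hGs (hu n) (hh n) hn1 hn2
      (fun m => itrans_of_magTrans (hcov n m)) ?_ rfl le_rfl
    rw [nrm, Real.sqrt_eq_one]
    exact hnorm n
  have hsub : {p : T2 | ∃ t : ℝ, p = proj2 (x₀ + t • θ₀)} ⊆ crest e x₀ := by
    rintro _ ⟨t, rfl⟩
    rw [mem_crest_iff, hang, Real.cos_zero]
  have hzero : wavg 1 (perp e) Bc x₀ = 0 :=
    MagFrame.average_eq_zero (M := hp.frame ha hG hGr hGs) he hN hN2 rfl rfl
      (hp.pdc_component ha hG hGs) hBcoef hw hUn hκ hκ0 hη0 hq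
      (hγ.trans_le (measure_mono hsub))
  rintro y ⟨t, hyt⟩
  have hy : Real.cos (ang e x₀ y) = 1 := by
    rw [← mem_crest_iff, hyt, mem_crest_iff, hang, Real.cos_zero]
  have l1 := tendsto_ray_average (hBcoef.per.add_perp e) hN y
  rw [wavg_one_eq_of_cos he hBcoef.per hy, hzero] at l1
  have l2 := (hBinf y θ₀).comp (tendsto_natCast_atTop_atTop.atTop_mul_const hN)
  have l3 := l2.ofReal
  have l4 := tendsto_nhds_unique (l3.congr fun n => ?_) l1
  · exact_mod_cast l4
  · rw [Function.comp_apply, Complex.ofReal_mul, ← intervalIntegral.integral_ofReal, hθ]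
    rfl
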